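/- Let q ∈ {4,8}, n ≥ 3 and 1 ≤ k ≤ n−2. The number of minimum weight codewords of C_k(n,q)^⊥ equals [n+1 choose k−1]_q · [n−k+2 choose 3]_q · δ(q), where [a choose b]_q denotes the Gaussian binomial coefficient, δ(4) = 168 and δ(8) = 32704. -/

import Mathlib

open Submodule

/-- The points of the projective space `PG(n, K)`: the 1-dimensional
`K`-subspaces of `K^{n+1}`. -/
def PGPoint (K : Type*) [Field K] (n : ℕ) : Type _ :=
  {W : Submodule K (Fin (n + 1) → K) // Module.finrank K W = 1}

/-- The set of points of `PG(n, K)` lying in a given linear subspace. -/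
def pts {K : Type*} [Field K] {n : ℕ} (W : Submodule K (Fin (n + 1) → K)) :
    Set (PGPoint K n) :=
  {P | P.1 ≤ W}

/-- `S` is a `k`-dimensional projective subspace of `PG(n, K)`. -/
def IsKSpace {K : Type*} [Field K] {n : ℕ} (k : ℕ) (S : Set (PGPoint K n)) : Prop :=
  ∃ W : Submodule K (Fin (n + 1) → K), Module.finrank K W = k + 1 ∧ S = pts W

/-- A set of points is of even type if every line meets it in an even
number of points. -/
def IsEvenType {K : Type*} [Field K] {n : ℕ} (S : Set (PGPoint K n)) : Prop :=
  ∀ L : Set (PGPoint K n), IsKSpace 1 L → Even (S ∩ L).ncard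

/-- `O` is a hyperoval in the plane `π`: a set of `q + 2` points of `π`,
no three of which are collinear. -/
def IsHyperovalIn {K : Type*} [Field K] {n : ℕ}
    (π O : Set (PGPoint K n)) : Prop :=
  O ⊆ π ∧ O.ncard = Nat.card K + 2 ∧
    ∀ L : Set (PGPoint K n), IsKSpace 1 L → (O ∩ L).ncard ≤ 2

/-- A hypercylinder in `PG(n, K)`, `n ≥ 3`: the set
`(⋃_{P ∈ O} ⟨P, τ⟩) \ τ`, where `O` is a hyperoval in a plane `π` and the
vertex `τ` is an `(n-3)`-dimensional projective subspace (linear dimension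
`n - 2`) disjoint from `π`.  (For `n = 3` the vertex is a point.) -/
def IsHypercylinder {K : Type*} [Field K] {n : ℕ}
    (S : Set (PGPoint K n)) : Prop :=
  ∃ (Wπ T : Submodule K (Fin (n + 1) → K)) (O : Set (PGPoint K n)),
    Module.finrank K Wπ = 3 ∧ Module.finrank K T = n - 2 ∧ Wπ ⊓ T = ⊥ ∧
    IsHyperovalIn (pts Wπ) O ∧
    S = {Q : PGPoint K n | (∃ P ∈ O, Q.1 ≤ P.1 ⊔ T) ∧ ¬ Q.1 ≤ T}

/-- A codeword of the dual code `C_k(n,q)^⊥`: a function from the points of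
`PG(n,q)` to `𝔽_p` summing to zero on every `k`-space. -/
def InDualCode {K : Type*} [Field K] {n : ℕ} (p k : ℕ)
    (c : PGPoint K n → ZMod p) : Prop :=
  ∀ σ : Set (PGPoint K n), IsKSpace k σ → ∑ᶠ P ∈ σ, c P = 0

/-- The weight of a codeword: the number of points with nonzero coefficient. -/
noncomputable def wt {K : Type*} [Field K] {n : ℕ} {p : ℕ}
    (c : PGPoint K n → ZMod p) : ℕ :=
  {P : PGPoint K n | c P ≠ 0}.ncard

/-- The Gaussian binomial coefficient `[a choose b]_q` (with `q = |K|`): the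
number of `b`-dimensional `K`-subspaces of `K^a`. -/
noncomputable def gaussBinom (K : Type*) [Field K] (a b : ℕ) : ℕ :=
  Nat.card {W : Submodule K (Fin a → K) // Module.finrank K W = b}

open Submodule
set_option linter.unusedSectionVars false
set_option linter.unusedVariables false
namespace HC
open scoped Classical
open Finset Module

variable {K V : Type*} [Field K] [Finite K] [AddCommGroup V] [Module K V] [Finite V]

noncomputable instance instFintypeSub : Fintype (Submodule K V) := Fintype.ofFinite _

/-- number of points of `S` inside `W` -/
noncomputable def s (S : Finset (Submodule K V)) (W : Submodule K V) : ℕ :=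
  (S.filter (fun P => P ≤ W)).card

/-- number of points of `S` inside `W`, outside `U` -/
noncomputable def dd (S : Finset (Submodule K V)) (U W : Submodule K V) : ℕ :=
  (S.filter (fun P => P ≤ W ∧ ¬ P ≤ U)).card

/-- subspaces of `X` covering `U` -/
noncomputable def pen (U X : Submodule K V) : Finset (Submodule K V) :=
  univ.filter (fun W => U ≤ W ∧ W ≤ X ∧ finrank K W = finrank K U + 1)

/-- a set of points -/
def IsPts (S : Finset (Submodule K V)) : Prop := ∀ P ∈ S, finrank K P = 1

/-- every `r`-dimensional subspace of `X` meets `S` in an even number of points -/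
def Ev (S : Finset (Submodule K V)) (r : ℕ) (X : Submodule K V) : Prop :=
  ∀ L, L ≤ X → finrank K L = r → Even (s S L)

/-- `1 + q + ... + q^(e-1)` -/
def th (q e : ℕ) : ℕ := ∑ i ∈ range e, q ^ i

/-- the points of `W` -/
noncomputable def ptsOf (W : Submodule K V) : Finset (Submodule K V) :=
  univ.filter (fun P => finrank K P = 1 ∧ P ≤ W)

theorem mem_pen {U X W : Submodule K V} :
    W ∈ pen U X ↔ U ≤ W ∧ W ≤ X ∧ finrank K W = finrank K U + 1 := by simp [pen]

theorem mem_ptsOf {W P : Submodule K V} : P ∈ ptsOf W ↔ finrank K P = 1 ∧ P ≤ W := by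
  simp [ptsOf]

theorem eq_of_le_rank {A B : Submodule K V} (h : A ≤ B) (h2 : finrank K B ≤ finrank K A) :
    A = B := Submodule.eq_of_le_of_finrank_le h h2

theorem rank_mono {A B : Submodule K V} (h : A ≤ B) : finrank K A ≤ finrank K B :=
  Submodule.finrank_mono h

theorem rank_sup_inf (A B : Submodule K V) :
    finrank K ↥(A ⊔ B) + finrank K ↥(A ⊓ B) = finrank K A + finrank K B :=
  Submodule.finrank_sup_add_finrank_inf_eq A B

theorem inf_pt {U P : Submodule K V} (hP : finrank K P = 1) (h : ¬ P ≤ U) :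
    finrank K ↥(U ⊓ P) = 0 := by
  have h1 : finrank K ↥(U ⊓ P) ≤ 1 := hP ▸ rank_mono inf_le_right
  by_contra h0
  have : finrank K P ≤ finrank K ↥(U ⊓ P) := by omega
  exact h ((eq_of_le_rank inf_le_right this) ▸ inf_le_left)

theorem rank_sup_pt {U P : Submodule K V} (hP : finrank K P = 1) (h : ¬ P ≤ U) :
    finrank K ↥(U ⊔ P) = finrank K U + 1 := by
  have := rank_sup_inf U P
  have := inf_pt hP h
  omega

theorem sup_mem_pen {U X P : Submodule K V} (hU : U ≤ X) (hP : finrank K P = 1) (hPX : P ≤ X)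
    (h : ¬ P ≤ U) : U ⊔ P ∈ pen U X :=
  mem_pen.2 ⟨le_sup_left, sup_le hU hPX, rank_sup_pt hP h⟩

theorem sup_eq_of_mem_pen {U X W P : Submodule K V} (hP : finrank K P = 1)
    (h : ¬ P ≤ U) (hW : W ∈ pen U X) (hPW : P ≤ W) : U ⊔ P = W := by
  obtain ⟨h1, h2, h3⟩ := mem_pen.1 hW
  exact eq_of_le_rank (sup_le h1 hPW) (by rw [rank_sup_pt hP h, h3])

theorem s_eq (S : Finset (Submodule K V)) {U W : Submodule K V} (h : U ≤ W) :
    s S W = s S U + dd S U W := by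
  unfold s dd
  rw [← card_union_of_disjoint]
  · congr 1
    ext P
    simp only [mem_filter, mem_union]
    constructor
    · rintro ⟨a, b⟩
      by_cases hh : P ≤ U
      · exact Or.inl ⟨a, hh⟩
      · exact Or.inr ⟨a, b, hh⟩
    · rintro (⟨a, b⟩ | ⟨a, b, c⟩)
      · exact ⟨a, b.trans h⟩
      · exact ⟨a, b⟩
  · rw [Finset.disjoint_left]
    intro P hP hP2
    simp only [mem_filter] at hP hP2
    exact hP2.2.2 hP.2

theorem pencil {S : Finset (Submodule K V)} (hS : IsPts S) {U X : Submodule K V} (hU : U ≤ X) :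
    dd S U X = ∑ W ∈ pen U X, dd S U W := by
  unfold dd
  rw [card_eq_sum_card_fiberwise (f := fun P => U ⊔ P) (t := pen U X)]
  · apply sum_congr rfl
    intro W hW
    congr 1
    ext P
    simp only [mem_filter]
    constructor
    · rintro ⟨⟨a, b, c⟩, d⟩
      exact ⟨a, d ▸ le_sup_right, c⟩
    · rintro ⟨a, b, c⟩
      exact ⟨⟨a, b.trans (mem_pen.1 hW).2.1, c⟩, sup_eq_of_mem_pen (hS P a) c hW b⟩
  · intro P hP
    simp only [coe_filter, Set.mem_ofPred_eq] at hP
    exact sup_mem_pen hU (hS P hP.1) hP.2.1 hP.2.2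

theorem pencil_sum {S : Finset (Submodule K V)} (hS : IsPts S) {U X : Submodule K V} (hU : U ≤ X) :
    s S X + (pen U X).card * s S U = s S U + ∑ W ∈ pen U X, s S W := by
  rw [s_eq S hU, pencil hS hU]
  have : ∑ W ∈ pen U X, s S W = ∑ W ∈ pen U X, (s S U + dd S U W) :=
    sum_congr rfl (fun W hW => s_eq S (mem_pen.1 hW).1)
  rw [this, sum_add_distrib, sum_const, smul_eq_mul]
  ring


theorem th_succ (q e : ℕ) : th q (e+1) = th q e + q ^ e := by
  unfold th; rw [sum_range_succ]

theorem th_succ' (q e : ℕ) : th q (e+1) = q * th q e + 1 := by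
  unfold th; rw [sum_range_succ', mul_sum]; simp [pow_succ']

theorem th_zero (q : ℕ) : th q 0 = 0 := rfl
theorem th_one (q : ℕ) : th q 1 = 1 := by simp [th]
theorem th_two (q : ℕ) : th q 2 = q + 1 := by rw [th_succ', th_one]; ring
theorem th_three (q : ℕ) : th q 3 = q * q + q + 1 := by rw [th_succ', th_two]; ring

theorem th_mul (q e : ℕ) (hq : 1 ≤ q) : th q e * (q - 1) + 1 = q ^ e := by
  obtain ⟨q, rfl⟩ : ∃ m, q = m + 1 := ⟨q - 1, by omega⟩
  induction e with
  | zero => simp [th]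
  | succ e ih =>
    rw [th_succ, add_mul, pow_succ]
    simp only [Nat.add_sub_cancel] at *
    linarith

theorem card_sub {q : ℕ} (hq : Nat.card K = q) (W : Submodule K V) :
    Nat.card W = q ^ finrank K W := by
  rw [Module.natCard_eq_pow_finrank (K := K), hq]

theorem one_lt_q {q : ℕ} (hq : Nat.card K = q) : 1 < q := by
  rw [← hq]; exact Finite.one_lt_card

theorem ncard_vec {q : ℕ} (hq : Nat.card K = q) (W : Submodule K V) :
    (W : Set V).ncard = q ^ finrank K W := by
  rw [← card_sub hq W]; rfl

theorem rank_span {x : V} (h : x ≠ 0) : finrank K (span K {x}) = 1 := finrank_span_singleton h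

theorem exists_span {P : Submodule K V} (h : finrank K P = 1) : ∃ x, x ≠ 0 ∧ P = span K {x} := by
  obtain ⟨v, hv, h2⟩ := finrank_eq_one_iff'.1 h
  refine ⟨v, by simpa using hv, ?_⟩
  apply le_antisymm
  · intro w hw
    obtain ⟨c, hc⟩ := h2 ⟨w, hw⟩
    exact mem_span_singleton.2 ⟨c, by simpa using congrArg Subtype.val hc⟩
  · simp

theorem span_le_iff {x : V} {W : Submodule K V} : span K {x} ≤ W ↔ x ∈ W :=
  span_singleton_le_iff_mem x W

theorem card_pen {q : ℕ} (hq : Nat.card K = q) {U X : Submodule K V} (hU : U ≤ X) :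
    (pen U X).card = th q (finrank K X - finrank K U) := by
  have := Fintype.ofFinite V
  have h1 : ∀ W : Submodule K V, (univ.filter (fun x : V => x ∈ W)).card = q ^ finrank K W := by
    intro W
    rw [← ncard_vec hq W, Set.ncard_eq_toFinset_card']
    congr 1; ext x; simp
  have h2 : ∀ W : Submodule K V, U ≤ W → (univ.filter (fun x : V => x ∈ W ∧ x ∉ U)).card
     + q ^ finrank K U = q ^ finrank K W := by
    intro W hW
    rw [← h1 U, ← h1 W, ← card_union_of_disjoint]
    · congr 1; ext x; simp only [mem_union, mem_filter, mem_univ, true_and]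
      constructor
      · rintro (h | h)
        · exact h.1
        · exact hW h
      · intro h; by_cases hh : x ∈ U <;> simp [h, hh]
    · rw [Finset.disjoint_left]; intro x hx; simp at hx ⊢; exact hx.2
  have h3 : (univ.filter (fun x : V => x ∈ X ∧ x ∉ U)).card =
      ∑ W ∈ pen U X, (univ.filter (fun x : V => x ∈ W ∧ x ∉ U)).card := by
    rw [card_eq_sum_card_fiberwise (f := fun x => U ⊔ span K {x}) (t := pen U X)]
    · apply sum_congr rfl
      intro W hW
      congr 1
      ext x
      simp only [mem_filter, mem_univ, true_and]
      constructor
      · rintro ⟨⟨b, c⟩, d⟩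
        exact ⟨d ▸ (le_sup_right : span K {x} ≤ _) (mem_span_singleton_self x), c⟩
      · rintro ⟨b, c⟩
        refine ⟨⟨(mem_pen.1 hW).2.1 b, c⟩, sup_eq_of_mem_pen (rank_span ?_) ?_ hW (span_le_iff.2 b)⟩
        · rintro rfl; exact c U.zero_mem
        · rwa [span_le_iff]
    · intro x hx
      simp only [coe_filter, Set.mem_ofPred_eq, mem_univ, true_and] at hx
      refine sup_mem_pen hU (rank_span ?_) (span_le_iff.2 hx.1) ?_
      · rintro rfl; exact hx.2 U.zero_mem
      · rw [span_le_iff]; exact hx.2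
  have q1 := one_lt_q hq
  have h4 : ∀ W ∈ pen U X, (univ.filter (fun x : V => x ∈ W ∧ x ∉ U)).card =
      q ^ finrank K U * (q - 1) := by
    intro W hW
    obtain ⟨a, b, e⟩ := mem_pen.1 hW
    have := h2 W a
    rw [e, pow_succ] at this
    rw [Nat.mul_sub, mul_one]; omega
  rw [sum_congr rfl h4, sum_const, smul_eq_mul] at h3
  have h5 := h2 X hU
  rw [h3] at h5
  obtain ⟨e, he⟩ := Nat.exists_eq_add_of_le (rank_mono hU)
  rw [he, pow_add, ← th_mul q e q1.le] at h5
  rw [he, Nat.add_sub_cancel_left]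
  have hp : 0 < q ^ finrank K U * (q - 1) := by
    apply Nat.mul_pos; positivity; omega
  apply Nat.eq_of_mul_eq_mul_right hp
  nlinarith

theorem exists_pt_not_le {U X : Submodule K V} (h : ¬ X ≤ U) :
    ∃ P : Submodule K V, finrank K P = 1 ∧ P ≤ X ∧ ¬ P ≤ U := by
  obtain ⟨x, hx, hx2⟩ := SetLike.not_le_iff_exists.1 h
  refine ⟨span K {x}, rank_span ?_, span_le_iff.2 hx, by rwa [span_le_iff]⟩
  rintro rfl; exact hx2 U.zero_mem

theorem exists_pt_of_rank_lt {U X : Submodule K V} (h : finrank K U < finrank K X) :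
    ∃ P : Submodule K V, finrank K P = 1 ∧ P ≤ X ∧ ¬ P ≤ U :=
  exists_pt_not_le (fun h2 => by have := rank_mono h2; omega)

/-- subspaces of each intermediate dimension -/
theorem exists_between {U X : Submodule K V} (hU : U ≤ X) (e : ℕ) (h1 : finrank K U ≤ e)
    (h2 : e ≤ finrank K X) : ∃ W, U ≤ W ∧ W ≤ X ∧ finrank K W = e := by
  induction e, h1 using Nat.le_induction with
  | base => exact ⟨U, le_rfl, hU, rfl⟩
  | succ e he ih =>
    obtain ⟨W, a, b, c⟩ := ih (by omega)
    obtain ⟨P, p1, p2, p3⟩ := exists_pt_of_rank_lt (U := W) (X := X) (by omega)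
    exact ⟨W ⊔ P, a.trans le_sup_left, sup_le b p2, by rw [rank_sup_pt p1 p3, c]⟩

theorem card_ptsOf {q : ℕ} (hq : Nat.card K = q) (X : Submodule K V) :
    (ptsOf X).card = th q (finrank K X) := by
  have := card_pen hq (bot_le : (⊥ : Submodule K V) ≤ X)
  rw [finrank_bot, Nat.sub_zero] at this
  rw [← this]; congr 1
  ext P; simp [mem_ptsOf, mem_pen, and_comm]

theorem pt_eq {P Q : Submodule K V} (hP : finrank K P = 1) (hQ : finrank K Q = 1) (h : P ≤ Q) :
    P = Q := eq_of_le_rank h (by omega)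

theorem pt_le_sup {U P Q : Submodule K V} (hP : finrank K P = 1) (hQ : finrank K Q = 1)
    (h : Q ≤ U ⊔ P) (h2 : ¬ Q ≤ U) : P ≤ U ⊔ Q := by
  have hP' : ¬ P ≤ U := fun h3 => h2 (h.trans (sup_le le_rfl h3))
  have := eq_of_le_rank (sup_le (le_sup_left) h : U ⊔ Q ≤ U ⊔ P)
    (by rw [rank_sup_pt hP hP', rank_sup_pt hQ h2])
  rw [this]; exact le_sup_right

/-- the line through two distinct points -/
theorem rank_line {P Q : Submodule K V} (hP : finrank K P = 1) (hQ : finrank K Q = 1)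
    (h : P ≠ Q) : finrank K ↥(P ⊔ Q) = 2 := by
  rw [rank_sup_pt hQ (fun h2 => h (pt_eq hQ hP h2).symm), hP]

theorem line_eq {P Q L : Submodule K V} (hP : finrank K P = 1) (hQ : finrank K Q = 1)
    (h : P ≠ Q) (hL : finrank K L = 2) (h1 : P ≤ L) (h2 : Q ≤ L) : P ⊔ Q = L :=
  eq_of_le_rank (sup_le h1 h2) (by rw [rank_line hP hQ h, hL])

theorem s_mono {S : Finset (Submodule K V)} {U W : Submodule K V} (h : U ≤ W) : s S U ≤ s S W := by
  rw [s_eq S h]; omega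

theorem s_pos_iff {S : Finset (Submodule K V)} {W : Submodule K V} :
    0 < s S W ↔ ∃ P ∈ S, P ≤ W := by
  unfold s; rw [card_pos]
  constructor
  · rintro ⟨P, h⟩; exact ⟨P, (mem_filter.1 h).1, (mem_filter.1 h).2⟩
  · rintro ⟨P, h, h2⟩; exact ⟨P, mem_filter.2 ⟨h, h2⟩⟩

theorem s_pt {S : Finset (Submodule K V)} (hS : IsPts S) {P : Submodule K V}
    (hP : finrank K P = 1) : s S P = if P ∈ S then 1 else 0 := by
  unfold s
  split_ifs with h
  · rw [card_eq_one]; refine ⟨P, ?_⟩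
    ext Q; simp only [mem_filter, mem_singleton]
    constructor
    · rintro ⟨a, b⟩; exact pt_eq (hS Q a) hP b
    · rintro rfl; exact ⟨h, le_rfl⟩
  · rw [card_eq_zero, filter_eq_empty_iff]
    intro Q hQ hQP
    exact h (pt_eq (hS Q hQ) hP hQP ▸ hQ)

theorem s_pt_mem {S : Finset (Submodule K V)} (hS : IsPts S) {P : Submodule K V}
    (h : P ∈ S) : s S P = 1 := by rw [s_pt hS (hS P h), if_pos h]

theorem s_pt_not_mem {S : Finset (Submodule K V)} (hS : IsPts S) {P : Submodule K V}
    (hP : finrank K P = 1) (h : P ∉ S) : s S P = 0 := by rw [s_pt hS hP, if_neg h]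

theorem two_le_s {S : Finset (Submodule K V)} {P Q W : Submodule K V} (hP : P ∈ S) (hQ : Q ∈ S)
    (h : P ≠ Q) (h1 : P ≤ W) (h2 : Q ≤ W) : 2 ≤ s S W := by
  have : 1 < s S W := one_lt_card.2 ⟨P, mem_filter.2 ⟨hP, h1⟩, Q, mem_filter.2 ⟨hQ, h2⟩, h⟩
  omega

theorem exists_of_lt_s {S : Finset (Submodule K V)} {U W : Submodule K V} (h : s S U < s S W) :
    ∃ P ∈ S, P ≤ W ∧ ¬ P ≤ U := by
  by_contra hh
  push Not at hh
  have : s S W ≤ s S U := by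
    apply card_le_card
    intro P hP
    rw [mem_filter] at hP ⊢
    exact ⟨hP.1, hh P hP.1 hP.2⟩
  omega

theorem s_le_th {q : ℕ} (hq : Nat.card K = q) {S : Finset (Submodule K V)} (hS : IsPts S)
    (W : Submodule K V) : s S W ≤ th q (finrank K W) := by
  rw [← card_ptsOf hq]
  apply card_le_card
  intro P hP; rw [mem_filter] at hP; exact mem_ptsOf.2 ⟨hS P hP.1, hP.2⟩

theorem exists_not_mem {q : ℕ} (hq : Nat.card K = q) {S : Finset (Submodule K V)}
    (hS : IsPts S) {W : Submodule K V} (h : s S W < th q (finrank K W)) :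
    ∃ P : Submodule K V, finrank K P = 1 ∧ P ≤ W ∧ P ∉ S := by
  by_contra hh
  push Not at hh
  have : (ptsOf W).card ≤ s S W := by
    apply card_le_card
    intro P hP; rw [mem_ptsOf] at hP; exact mem_filter.2 ⟨hh P hP.1 hP.2, hP.2⟩
  rw [card_ptsOf hq] at this; omega

/-- sum over the pencil at a point off `S` -/
theorem pencil_off {S : Finset (Submodule K V)} (hS : IsPts S) {U X : Submodule K V} (hU : U ≤ X)
    (h : s S U = 0) : s S X = ∑ W ∈ pen U X, s S W := by
  have := pencil_sum hS hU
  rw [h] at this; simpa using this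

/-- point count from a point of `S` -/
theorem pencil_on {q : ℕ} (hq : Nat.card K = q) {S : Finset (Submodule K V)} (hS : IsPts S)
    {P X : Submodule K V} (hP : P ∈ S) (hX : P ≤ X) :
    s S X + th q (finrank K X - 1) = 1 + ∑ W ∈ pen P X, s S W := by
  have := pencil_sum hS hX
  rw [card_pen hq hX, s_pt_mem hS hP, hS P hP] at this; omega

theorem rank_of_mem_pen_pt {P X L : Submodule K V} (hP : finrank K P = 1) (h : L ∈ pen P X) :
    finrank K L = 2 := by rw [(mem_pen.1 h).2.2, hP]

/-- lines through a point of an even set contain at least two points -/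
theorem two_le_line {S : Finset (Submodule K V)} (hS : IsPts S) {P X L : Submodule K V}
    (hE : Ev S 2 X) (hP : P ∈ S) (hL : L ∈ pen P X) : 2 ≤ s S L ∧ Even (s S L) := by
  have h1 := hE L (mem_pen.1 hL).2.1 (rank_of_mem_pen_pt (hS P hP) hL)
  have h2 : 0 < s S L := s_pos_iff.2 ⟨P, hP, (mem_pen.1 hL).1⟩
  exact ⟨by obtain ⟨a, ha⟩ := h1; omega, h1⟩

theorem exc {q : ℕ} (hq : Nat.card K = q) {S : Finset (Submodule K V)} (hS : IsPts S)
    {P X : Submodule K V} (hE : Ev S 2 X) (hP : P ∈ S) (hX : P ≤ X) :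
    s S X = 1 + th q (finrank K X - 1) + ∑ L ∈ pen P X, (s S L - 2) := by
  have h1 := pencil_on hq hS hP hX
  have h2 : ∑ L ∈ pen P X, s S L = ∑ L ∈ pen P X, (s S L - 2) + ∑ L ∈ pen P X, 2 := by
    rw [← sum_add_distrib]
    apply sum_congr rfl
    intro L hL
    have := (two_le_line hS hE hP hL).1; omega
  rw [h2, sum_const, smul_eq_mul, card_pen hq hX, hS P hP] at h1
  omega

theorem Ev.mono {S : Finset (Submodule K V)} {r : ℕ} {X Y : Submodule K V} (h : Ev S r X)
    (h2 : Y ≤ X) : Ev S r Y := fun L hL => h L (hL.trans h2)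

theorem th_odd {q : ℕ} (hq : Even q) (e : ℕ) : Odd (th q (e+1)) := by
  rw [th_succ']; exact (hq.mul_right _).add_one

theorem exists_pt {X : Submodule K V} (h : 0 < finrank K X) : ∃ P : Submodule K V, finrank K P = 1 ∧ P ≤ X := by
  obtain ⟨P, a, b, c⟩ := exists_pt_of_rank_lt (U := ⊥) (X := X) (by rwa [finrank_bot])
  exact ⟨P, a, b⟩

/-- even on lines implies even on larger subspaces -/
theorem Ev.up {q : ℕ} (hq : Nat.card K = q) (hev : Even q) {S : Finset (Submodule K V)}
    (hS : IsPts S) {X : Submodule K V} {r r' : ℕ} (h : Ev S r X) (hr : 1 ≤ r) (hrr : r ≤ r') :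
    Ev S r' X := by
  induction r', hrr using Nat.le_induction with
  | base => exact h
  | succ e he ih =>
    intro L hL hr2
    obtain ⟨U, u1, u2, u3⟩ := exists_between (bot_le : ⊥ ≤ L) (e - 1) (by simp) (by omega)
    have h1 := pencil_sum hS u2
    rw [card_pen hq u2, hr2, u3, show e + 1 - (e - 1) = 2 by omega, th_two] at h1
    have h2 : Even (∑ W ∈ pen U L, s S W) := by
      apply Finset.even_sum
      intro W hW
      obtain ⟨a, b, c⟩ := mem_pen.1 hW
      exact ih W (b.trans hL) (by omega)
    obtain ⟨a, ha⟩ := h2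
    obtain ⟨b, hb⟩ := hev
    rw [ha, hb] at h1
    rw [Nat.even_iff]
    have : (b + b + 1) * s S U = 2 * (b * s S U) + s S U := by ring
    omega

end HC

open Submodule
set_option linter.unusedSectionVars false
set_option linter.unusedVariables false
namespace HC
open scoped Classical
open Finset Module

variable {K V : Type*} [Field K] [Finite K] [AddCommGroup V] [Module K V] [Finite V]

theorem dc (S 𝓕 : Finset (Submodule K V)) (X : Submodule K V) (h : ∀ F ∈ 𝓕, F ≤ X) :
    ∑ P ∈ S.filter (fun P => P ≤ X), (𝓕.filter (fun F => P ≤ F)).card = ∑ F ∈ 𝓕, s S F := by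
  have := Finset.sum_card_bipartiteAbove_eq_sum_card_bipartiteBelow
    (s := S.filter (fun P => P ≤ X)) (t := 𝓕) (fun P F : Submodule K V => P ≤ F)
  unfold bipartiteAbove bipartiteBelow at this
  rw [this]
  apply sum_congr rfl
  intro F hF
  unfold s
  rw [filter_filter]
  congr 1
  ext P; simp only [mem_filter]
  exact ⟨fun ⟨a, b, c⟩ => ⟨a, c⟩, fun ⟨a, b⟩ => ⟨a, b.trans (h F hF), b⟩⟩

theorem pen_sub {U X Y : Submodule K V} (h : Y ≤ X) : pen U Y ⊆ pen U X := by
  intro W hW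
  obtain ⟨a, b, e⟩ := mem_pen.1 hW
  exact mem_pen.2 ⟨a, b.trans h, e⟩

theorem line_le_exc {S : Finset (Submodule K V)} {P X L : Submodule K V} (hL : L ∈ pen P X) :
    s S L - 2 ≤ ∑ L ∈ pen P X, (s S L - 2) :=
  single_le_sum (f := fun L => s S L - 2) (fun _ _ => Nat.zero_le _) hL

theorem lines_le_exc {S : Finset (Submodule K V)} {P X L M : Submodule K V} (hL : L ∈ pen P X)
    (hM : M ∈ pen P X) (h : L ≠ M) :
    (s S L - 2) + (s S M - 2) ≤ ∑ L ∈ pen P X, (s S L - 2) := by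
  rw [← sum_pair (f := fun L => s S L - 2) h]
  apply sum_le_sum_of_subset
  intro x hx
  simp only [mem_insert, mem_singleton] at hx
  rcases hx with rfl | rfl <;> assumption

theorem line_mem_pen {P L X : Submodule K V} (hP : finrank K P = 1) (hL : finrank K L = 2)
    (h1 : P ≤ L) (h2 : L ≤ X) : L ∈ pen P X := mem_pen.2 ⟨h1, h2, by omega⟩

theorem plane_exc {q : ℕ} (hq : Nat.card K = q) {S : Finset (Submodule K V)} (hS : IsPts S)
    {P F : Submodule K V} (hF : finrank K F = 3) (hE : Ev S 2 F) (hP : P ∈ S) (hX : P ≤ F) :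
    s S F = q + 2 + ∑ L ∈ pen P F, (s S L - 2) := by
  have := exc hq hS hE hP hX
  rw [hF, th_two] at this; omega

theorem solid_exc {q : ℕ} (hq : Nat.card K = q) {S : Finset (Submodule K V)} (hS : IsPts S)
    {P F : Submodule K V} (hF : finrank K F = 4) (hE : Ev S 2 F) (hP : P ∈ S) (hX : P ≤ F) :
    s S F = q * q + q + 2 + ∑ L ∈ pen P F, (s S L - 2) := by
  have := exc hq hS hE hP hX
  rw [hF, th_three] at this; omega

/-- two lines in a plane meet -/
theorem meet_pos {A B F : Submodule K V} (hA : A ≤ F) (hB : B ≤ F)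
    (h : finrank K F < finrank K A + finrank K B) :
    ∃ Z : Submodule K V, finrank K Z = 1 ∧ Z ≤ A ∧ Z ≤ B := by
  have h1 := rank_sup_inf A B
  have h2 := rank_mono (sup_le hA hB)
  obtain ⟨Z, a, b⟩ := exists_pt (X := A ⊓ B) (by omega)
  exact ⟨Z, a, b.trans inf_le_left, b.trans inf_le_right⟩

theorem lines_eq {P Q L M : Submodule K V} (hP : finrank K P = 1) (hQ : finrank K Q = 1)
    (h : P ≠ Q) (hL : finrank K L = 2) (hM : finrank K M = 2) (h1 : P ≤ L) (h2 : Q ≤ L)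
    (h3 : P ≤ M) (h4 : Q ≤ M) : L = M := by
  rw [← line_eq hP hQ h hL h1 h2, line_eq hP hQ h hM h3 h4]

theorem not_t0 {q : ℕ} (hq48 : q = 4 ∨ q = 8) (hq : Nat.card K = q)
    {S : Finset (Submodule K V)} (hS : IsPts S)
    {P X : Submodule K V} (hX : finrank K X = 4) (hE : Ev S 2 X) (hP : P ∈ S) (hPX : P ≤ X) :
    s S X ≠ q * q + q + 2 := by
  intro hs
  have h2 : ∀ Q ∈ S, ∀ L ≤ X, Q ≤ L → finrank K L = 2 → s S L = 2 := by
    intro Q hQ L hL hQL hr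
    have h1 := solid_exc hq hS hX hE hQ (hQL.trans hL)
    have hm := line_mem_pen (hS Q hQ) hr hQL hL
    have h3 := line_le_exc (S := S) hm
    have := two_le_line hS hE hQ hm
    omega
  have h3 : ∀ F ≤ X, finrank K F = 3 → s S F = 0 ∨ s S F = q + 2 := by
    intro F hF hr
    rcases Nat.eq_zero_or_pos (s S F) with h | h
    · exact Or.inl h
    · right
      obtain ⟨Q, hQ, hQF⟩ := s_pos_iff.1 h
      rw [plane_exc hq hS hr (hE.mono hF) hQ hQF, sum_eq_zero, add_zero]
      intro L hL
      rw [h2 Q hQ L ((mem_pen.1 hL).2.1.trans hF) (mem_pen.1 hL).1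
        (rank_of_mem_pen_pt (hS Q hQ) hL)]; rfl
  obtain ⟨F, hPF, hFX, hFr⟩ := exists_between hPX 3 (by rw [hS P hP]; omega) (by omega)
  have hsF : s S F = q + 2 := by
    rcases h3 F hFX hFr with h | h
    · have := s_pos_iff.2 ⟨P, hP, hPF⟩; omega
    · exact h
  obtain ⟨N, hN, hNF, hNS⟩ := exists_not_mem hq hS (W := F) (by
    rw [hFr, th_three, hsF]; rcases hq48 with rfl | rfl <;> norm_num)
  have h4 := pencil_off hS hNF (s_pt_not_mem hS hN hNS)
  have h5 : ∃ m ∈ pen N F, s S m = 0 := by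
    by_contra hh
    push Not at hh
    have : ∑ W ∈ pen N F, 2 ≤ ∑ W ∈ pen N F, s S W := by
      apply sum_le_sum
      intro W hW
      obtain ⟨a, ha⟩ := (hE.mono hFX) W (mem_pen.1 hW).2.1 (rank_of_mem_pen_pt hN hW)
      have := hh W hW
      omega
    rw [sum_const, card_pen hq hNF, hFr, hN, th_two, smul_eq_mul, ← h4, hsF] at this
    rcases hq48 with rfl | rfl <;> omega
  obtain ⟨m, hm, hm0⟩ := h5
  have hmr := rank_of_mem_pen_pt hN hm
  have h6 := pencil_off hS ((mem_pen.1 hm).2.1.trans hFX) hm0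
  have h7 : (q + 2) ∣ s S X := by
    rw [h6]
    apply dvd_sum
    intro W hW
    rcases h3 W (mem_pen.1 hW).2.1 (by rw [(mem_pen.1 hW).2.2, hmr]) with h | h <;> rw [h] <;> simp
  rw [hs] at h7
  rcases hq48 with rfl | rfl <;> revert h7 <;> decide

/-- a `q`-secant forces a vertex -/
theorem vertex_of_qsec {q : ℕ} (hq3 : 3 ≤ q) (hq : Nat.card K = q)
    {S : Finset (Submodule K V)} (hS : IsPts S)
    {X l : Submodule K V} (hX : finrank K X = 4) (hE : Ev S 2 X) (hs : s S X ≤ q * (q + 2))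
    (hl : l ≤ X) (hlr : finrank K l = 2) (hls : s S l = q) :
    s S X = q * (q + 2) ∧ ∃ N : Submodule K V, finrank K N = 1 ∧ N ≤ X ∧ N ∉ S ∧
      ∀ Q ∈ S, Q ≤ X → s S (Q ⊔ N) = q := by
  have hPs : ∀ P ∈ S, P ≤ l → s S X = q * (q + 2) ∧
      ∀ L ≤ X, finrank K L = 2 → P ≤ L → L ≠ l → s S L = 2 := by
    intro P hP hPl
    have h1 := solid_exc hq hS hX hE hP (hPl.trans hl)
    have hlm := line_mem_pen (hS P hP) hlr hPl hl
    have h2 := line_le_exc (S := S) hlm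
    have e : q * (q + 2) = q * q + 2 * q := by ring
    refine ⟨by omega, ?_⟩
    intro L hL hLr hPL hne
    have hLm := line_mem_pen (hS P hP) hLr hPL hL
    have h3 := lines_le_exc (S := S) hlm hLm hne.symm
    have := (two_le_line hS hE hP hLm).1
    omega
  obtain ⟨P, hP, hPl⟩ := s_pos_iff.1 (show 0 < s S l by omega)
  refine ⟨(hPs P hP hPl).1, ?_⟩
  obtain ⟨N, hN, hNl, hNS⟩ := exists_not_mem hq hS (W := l) (by rw [hlr, th_two]; omega)
  have huniq : ∀ Z : Submodule K V, finrank K Z = 1 → Z ≤ l → Z ∉ S → Z = N := by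
    intro Z hZ hZl hZS
    by_contra hne
    have h1 : (S.filter (fun P => P ≤ l) ∪ {Z, N}).card ≤ (ptsOf l).card := by
      apply card_le_card
      intro Y hY
      simp only [mem_union, mem_filter, mem_insert, mem_singleton] at hY
      rw [mem_ptsOf]
      rcases hY with h | rfl | rfl
      · exact ⟨hS Y h.1, h.2⟩
      · exact ⟨hZ, hZl⟩
      · exact ⟨hN, hNl⟩
    rw [card_union_of_disjoint, card_pair hne, card_ptsOf hq, hlr, th_two] at h1
    · have : (S.filter (fun P => P ≤ l)).card = q := hls
      omega
    · rw [Finset.disjoint_right]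
      intro Y hY
      simp only [mem_insert, mem_singleton] at hY
      rcases hY with rfl | rfl <;> simp [*]
  refine ⟨N, hN, hNl.trans hl, hNS, ?_⟩
  intro Q hQ hQX
  have hQN : Q ≠ N := fun h => hNS (h ▸ hQ)
  by_cases hQl : Q ≤ l
  · rw [line_eq (hS Q hQ) hN hQN hlr hQl hNl, hls]
  have hFr := rank_sup_pt (hS Q hQ) hQl
  rw [hlr] at hFr
  set F := l ⊔ Q with hF
  have hFX : F ≤ X := sup_le hl hQX
  have hlF : l ≤ F := le_sup_left
  have hQF : Q ≤ F := le_sup_right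
  -- the plane has `2 * q` points
  have h1 := plane_exc hq hS hFr (hE.mono hFX) hP (hPl.trans hlF)
  rw [sum_eq_single_of_mem l (line_mem_pen (hS P hP) hlr hPl hlF) (by
    intro L hL hne
    rw [(hPs P hP hPl).2 L ((mem_pen.1 hL).2.1.trans hFX) (rank_of_mem_pen_pt (hS P hP) hL)
      (mem_pen.1 hL).1 hne]; rfl)] at h1
  have h2 := plane_exc hq hS hFr (hE.mono hFX) hQ hQF
  have hQNF : Q ⊔ N ≤ F := sup_le hQF (hNl.trans hlF)
  have hQNm := line_mem_pen (hS Q hQ) (rank_line (hS Q hQ) hN hQN) le_sup_left hQNF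
  rw [sum_eq_single_of_mem (Q ⊔ N) hQNm (by
    intro L hL hne
    have hLr := rank_of_mem_pen_pt (hS Q hQ) hL
    obtain ⟨Z, hZ, hZl, hZL⟩ := meet_pos hlF (mem_pen.1 hL).2.1 (by omega)
    have hZS : Z ∈ S := by
      by_contra hZS
      have := huniq Z hZ hZl hZS
      subst this
      exact hne (line_eq (hS Q hQ) hN hQN hLr (mem_pen.1 hL).1 hZL).symm
    rw [(hPs Z hZS hZl).2 L ((mem_pen.1 hL).2.1.trans hFX) hLr hZL (by
      rintro rfl; exact hQl (mem_pen.1 hL).1)]; rfl)] at h2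
  have := (two_le_line hS (hE.mono hFX) hQ hQNm).1
  omega

/-- no 14-point even set of a plane of order 8 has a 6-secant -/
theorem no_six_plane (hq : Nat.card K = 8)
    {S : Finset (Submodule K V)} (hS : IsPts S)
    {F l : Submodule K V} (hF : finrank K F = 3) (hE : Ev S 2 F) (hs : s S F = 14)
    (hl : l ≤ F) (hlr : finrank K l = 2) (hls : s S l = 6) : False := by
  obtain ⟨Q, hQ, hQF, hQl⟩ := exists_of_lt_s (S := S) (U := l) (W := F) (by omega)
  have h1 := plane_exc hq hS hF hE hQ hQF
  obtain ⟨m, hm, hm0⟩ : ∃ m ∈ pen Q F, s S m - 2 ≠ 0 :=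
    exists_ne_zero_of_sum_ne_zero (by omega)
  have hm2 := two_le_line hS hE hQ hm
  have hm1 := line_le_exc (S := S) hm
  have hmr := rank_of_mem_pen_pt (hS Q hQ) hm
  obtain ⟨hQm, hmF, -⟩ := mem_pen.1 hm
  have hne : m ≠ l := by rintro rfl; exact hQl hQm
  have hoff : ∀ P ∈ S, P ≤ l → ¬ P ≤ m := by
    intro P hP hPl hPm
    have h2 := plane_exc hq hS hF hE hP (hPl.trans hl)
    have h3 := lines_le_exc (S := S) (line_mem_pen (hS P hP) hlr hPl hl)
      (line_mem_pen (hS P hP) hmr hPm hmF) hne.symm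
    omega
  obtain ⟨N, hN, hNl, hNm⟩ := meet_pos hl hmF (by omega)
  have hNS : N ∉ S := fun h => hoff N h hNl hNm
  -- a point `R` of `m` outside `S`, other than `N`
  obtain ⟨R, hR, hRm, hRS⟩ := exists_not_mem hq (S := insert N S) (W := m) (by
      intro P hP; rcases mem_insert.1 hP with rfl | h
      · exact hN
      · exact hS P h) (by
    have : s (insert N S) m ≤ s S m + 1 := by
      unfold s; rw [filter_insert]; split_ifs
      · exact card_insert_le _ _
    rw [hmr, th_two]; omega)
  rw [mem_insert, not_or] at hRS
  have hRl : ¬ R ≤ l := fun h => hne (lines_eq hR hN hRS.1 hmr hlr hRm hNm h hNl)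
  have h4 := pencil_off hS (hRm.trans hmF) (s_pt_not_mem hS hR hRS.2)
  set I := (S.filter (fun P => P ≤ l)).image (fun P => R ⊔ P) with hI
  have hRP : ∀ P ∈ S, P ≤ l → finrank K ↥(R ⊔ P) = 2 := fun P hP hPl =>
    rank_line hR (hS P hP) (by rintro rfl; exact hRl hPl)
  have hIc : I.card = 6 := by
    rw [card_image_of_injOn]; exact hls
    intro A hA B hB hAB
    simp only [coe_filter, Set.mem_ofPred_eq] at hA hB hAB
    by_contra hne2
    have : R ⊔ A = l := lines_eq (hS A hA.1) (hS B hB.1) hne2 (hRP A hA.1 hA.2) hlr le_sup_right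
      (hAB ▸ le_sup_right) hA.2 hB.2
    exact hRl (this ▸ le_sup_left)
  have hmI : m ∉ I := by
    intro h
    obtain ⟨P, hP, rfl⟩ := mem_image.1 h
    rw [mem_filter] at hP
    exact hoff P hP.1 hP.2 le_sup_right
  have h5 : ∑ L ∈ insert m I, s S L ≤ ∑ L ∈ pen R F, s S L := by
    apply sum_le_sum_of_subset
    intro L hL
    rcases mem_insert.1 hL with rfl | hL
    · exact line_mem_pen hR hmr hRm hmF
    · obtain ⟨P, hP, rfl⟩ := mem_image.1 hL
      rw [mem_filter] at hP
      exact line_mem_pen hR (hRP P hP.1 hP.2) le_sup_left (sup_le (hRm.trans hmF) (hP.2.trans hl))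
  have h6 : ∑ L ∈ I, 2 ≤ ∑ L ∈ I, s S L := by
    apply sum_le_sum
    intro L hL
    obtain ⟨P, hP, rfl⟩ := mem_image.1 hL
    rw [mem_filter] at hP
    exact (two_le_line hS hE hP.1 (line_mem_pen (hS P hP.1) (hRP P hP.1 hP.2) le_sup_right
      (sup_le (hRm.trans hmF) (hP.2.trans hl)))).1
  rw [sum_insert hmI] at h5
  rw [sum_const, hIc, smul_eq_mul] at h6
  obtain ⟨a, ha⟩ := hm2.2
  omega

theorem no_six (hq : Nat.card K = 8)
    {S : Finset (Submodule K V)} (hS : IsPts S)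
    {X l : Submodule K V} (hX : finrank K X = 4) (hE : Ev S 2 X) (hs : s S X ≤ 80)
    (hl : l ≤ X) (hlr : finrank K l = 2) (hls : s S l = 6) : False := by
  have h1 := pencil_sum hS hl
  rw [card_pen hq hl, hX, hlr, th_two, hls] at h1
  obtain ⟨P, hP, hPl⟩ := s_pos_iff.1 (show 0 < s S l by omega)
  have h2 : ∀ W ∈ pen l X, 16 ≤ s S W := by
    intro W hW
    obtain ⟨a, b, e⟩ := mem_pen.1 hW
    rw [hlr] at e
    have h3 := plane_exc hq hS e (hE.mono b) hP (hPl.trans a)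
    have h4 := line_le_exc (S := S) (line_mem_pen (hS P hP) hlr hPl a)
    obtain ⟨c, hc⟩ := Ev.up hq (by decide) hS hE (by norm_num) (show 2 ≤ 3 by norm_num) W b e
    by_contra hlt
    exact no_six_plane hq hS e (hE.mono b) (by omega) a hlr hls
  have h5 := card_nsmul_le_sum (pen l X) (fun W => s S W) 16 h2
  rw [card_pen hq hl, hX, hlr, th_two, smul_eq_mul] at h5
  omega
end HC

open Submodule
set_option linter.unusedSectionVars false
set_option linter.unusedVariables false
namespace HC
open scoped Classical
open Finset Module

variable {K V : Type*} [Field K] [Finite K] [AddCommGroup V] [Module K V] [Finite V]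

/-- the situation: order 8, all secants are 2- or 4-secants -/
structure C8 (S : Finset (Submodule K V)) (X : Submodule K V) (j : ℕ) : Prop where
  hq : Nat.card K = 8
  hS : IsPts S
  hX : finrank K X = 4
  hE : Ev S 2 X
  hl : ∀ L ≤ X, finrank K L = 2 → s S L ≤ 4
  hs : s S X = 74 + 2 * j

/-- 4-secants in `Y` through `P` -/
noncomputable def DD (S : Finset (Submodule K V)) (P Y : Submodule K V) : Finset (Submodule K V) :=
  (pen P Y).filter (fun L => s S L = 4)

/-- all 4-secants in `Y` -/
noncomputable def sec (S : Finset (Submodule K V)) (Y : Submodule K V) : Finset (Submodule K V) :=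
  univ.filter (fun L => L ≤ Y ∧ finrank K L = 2 ∧ s S L = 4)

/-- planes with `e` points in `X` -/
noncomputable def pla (S : Finset (Submodule K V)) (X : Submodule K V) (e : ℕ) :
    Finset (Submodule K V) :=
  univ.filter (fun F => F ≤ X ∧ finrank K F = 3 ∧ s S F = e)

/-- planes through `P` -/
noncomputable def PL (P X : Submodule K V) : Finset (Submodule K V) :=
  univ.filter (fun F => P ≤ F ∧ F ≤ X ∧ finrank K F = 3)

variable {S : Finset (Submodule K V)} {X : Submodule K V} {j : ℕ}

theorem mem_DD {P Y L : Submodule K V} (hP : finrank K P = 1) :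
    L ∈ DD S P Y ↔ P ≤ L ∧ L ≤ Y ∧ finrank K L = 2 ∧ s S L = 4 := by
  unfold DD; rw [mem_filter, mem_pen, hP]; tauto

theorem mem_sec {Y L : Submodule K V} :
    L ∈ sec S Y ↔ L ≤ Y ∧ finrank K L = 2 ∧ s S L = 4 := by simp [sec]

theorem mem_pla {e : ℕ} {F : Submodule K V} :
    F ∈ pla S X e ↔ F ≤ X ∧ finrank K F = 3 ∧ s S F = e := by simp [pla]

theorem mem_PL {P F : Submodule K V} :
    F ∈ PL P X ↔ P ≤ F ∧ F ≤ X ∧ finrank K F = 3 := by simp [PL]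

theorem C8.exc_DD (c : C8 S X j) {P Y : Submodule K V} (hP : P ∈ S) (hPY : P ≤ Y) (hY : Y ≤ X) :
    s S Y = 1 + th 8 (finrank K Y - 1) + 2 * (DD S P Y).card := by
  rw [exc c.hq c.hS (c.hE.mono hY) hP hPY]
  congr 1
  unfold DD
  rw [card_filter, mul_sum]
  apply sum_congr rfl
  intro L hL
  have h1 := two_le_line c.hS (c.hE.mono hY) hP hL
  have h2 := c.hl L ((mem_pen.1 hL).2.1.trans hY) (rank_of_mem_pen_pt (c.hS P hP) hL)
  obtain ⟨a, ha⟩ := h1.2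
  split_ifs <;> omega

theorem C8.DD_plane (c : C8 S X j) {P F : Submodule K V} (hP : P ∈ S) (hPY : P ≤ F) (hF : F ≤ X)
    (hr : finrank K F = 3) : s S F = 10 + 2 * (DD S P F).card := by
  rw [c.exc_DD hP hPY hF, hr, th_two]

theorem C8.DD_X (c : C8 S X j) {P : Submodule K V} (hP : P ∈ S) (hPX : P ≤ X) :
    (DD S P X).card = j := by
  have := c.exc_DD hP hPX le_rfl
  rw [c.hX, th_three, c.hs] at this; omega

theorem DD_mono {P F : Submodule K V} (h : F ≤ X) : DD S P F ⊆ DD S P X :=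
  filter_subset_filter _ (pen_sub h)

/-- two lines on a point span a plane -/
theorem rank_two_lines {P L M : Submodule K V} (hP : finrank K P = 1) (hL : finrank K L = 2)
    (hM : finrank K M = 2) (h1 : P ≤ L) (h2 : P ≤ M) (h : L ≠ M) :
    finrank K ↥(L ⊔ M) = 3 ∧ L ⊓ M = P := by
  have h3 := rank_sup_inf L M
  have h4 := rank_mono (le_inf h1 h2)
  have h5 : finrank K ↥(L ⊓ M) < 2 := by
    by_contra hh
    have e1 : L ⊓ M = L := eq_of_le_rank inf_le_left (by omega)
    have e2 : L ⊓ M = M := eq_of_le_rank inf_le_right (by omega)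
    exact h (e1.symm.trans e2)
  exact ⟨by omega, (eq_of_le_rank (le_inf h1 h2) (by omega)).symm⟩

theorem C8.pairs (c : C8 S X j) {P : Submodule K V} (hP : P ∈ S) (hPX : P ≤ X) :
    ∑ F ∈ PL P X, ((DD S P F).card * (DD S P F).card - (DD S P F).card) = j * j - j := by
  rw [← c.DD_X hP hPX, ← offDiag_card]
  have hP1 := c.hS P hP
  rw [card_eq_sum_card_fiberwise (f := fun x : Submodule K V × Submodule K V => x.1 ⊔ x.2)
    (t := PL P X)]
  · apply sum_congr rfl
    intro F hF
    obtain ⟨f1, f2, f3⟩ := mem_PL.1 hF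
    rw [← offDiag_card]
    congr 1
    ext ⟨L, M⟩
    simp only [mem_offDiag, mem_filter, mem_DD hP1]
    constructor
    · rintro ⟨⟨a1, a2, a3, a4⟩, ⟨b1, b2, b3, b4⟩, hne⟩
      exact ⟨⟨⟨a1, a2.trans f2, a3, a4⟩, ⟨b1, b2.trans f2, b3, b4⟩, hne⟩,
        eq_of_le_rank (sup_le a2 b2) (by rw [(rank_two_lines hP1 a3 b3 a1 b1 hne).1, f3])⟩
    · rintro ⟨⟨⟨a1, a2, a3, a4⟩, ⟨b1, b2, b3, b4⟩, hne⟩, rfl⟩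
      exact ⟨⟨a1, le_sup_left, a3, a4⟩, ⟨b1, le_sup_right, b3, b4⟩, hne⟩
  · rintro ⟨L, M⟩ h
    simp only [coe_offDiag, Set.mem_offDiag, mem_coe, mem_DD hP1] at h
    obtain ⟨⟨a1, a2, a3, a4⟩, ⟨b1, b2, b3, b4⟩, hne⟩ := h
    exact mem_PL.2 ⟨a1.trans le_sup_left, sup_le a2 b2, (rank_two_lines hP1 a3 b3 a1 b1 hne).1⟩

/-- number of planes with `e` points through `P` -/
noncomputable def nn (S : Finset (Submodule K V)) (X : Submodule K V) (e : ℕ)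
    (P : Submodule K V) : ℕ := ((pla S X e).filter (fun F => P ≤ F)).card

theorem nn_eq (e : ℕ) (P : Submodule K V) :
    nn S X e P = ((PL P X).filter (fun F => s S F = e)).card := by
  unfold nn; congr 1; ext F; simp only [mem_filter, mem_pla, mem_PL]; tauto

theorem dc_pla (e : ℕ) :
    ∑ P ∈ S.filter (fun P => P ≤ X), nn S X e P = (pla S X e).card * e := by
  unfold nn
  rw [dc S _ X (fun F hF => (mem_pla.1 hF).1), sum_const_nat (m := e)]
  intro F hF; exact (mem_pla.1 hF).2.2

theorem C8.swap (c : C8 S X j) {P : Submodule K V} (hP : P ∈ S) (hPX : P ≤ X)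
    (g : Submodule K V → ℕ) :
    ∑ F ∈ PL P X, ∑ L ∈ pen P F, g L = 9 * ∑ L ∈ pen P X, g L := by
  have hP1 := c.hS P hP
  rw [Finset.sum_comm' (t' := pen P X) (s' := fun L => pen L X)]
  · rw [mul_sum]
    apply sum_congr rfl
    intro L hL
    rw [sum_const, card_pen c.hq (mem_pen.1 hL).2.1, c.hX, rank_of_mem_pen_pt hP1 hL, th_two,
      smul_eq_mul]
  · intro F L
    rw [mem_PL, mem_pen, mem_pen, mem_pen, hP1]
    constructor
    · rintro ⟨⟨a, b, d⟩, e, f, g⟩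
      exact ⟨⟨f, b, by omega⟩, e, f.trans b, g⟩
    · rintro ⟨⟨a, b, d⟩, e, f, g⟩
      exact ⟨⟨e.trans a, b, by omega⟩, e, a, g⟩

theorem C8.card_PL (c : C8 S X j) {P : Submodule K V} (hP : P ∈ S) (hPX : P ≤ X) :
    (PL P X).card = 73 := by
  have h := c.swap hP hPX (fun _ => 1)
  have hP1 := c.hS P hP
  have h2 : ∀ F ∈ PL P X, ∑ L ∈ pen P F, 1 = 9 := by
    intro F hF
    obtain ⟨f1, f2, f3⟩ := mem_PL.1 hF
    rw [sum_const, card_pen c.hq f1, f3, hP1, th_two]; rfl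
  rw [sum_congr rfl h2, sum_const, sum_const, card_pen c.hq hPX, c.hX, hP1, th_three] at h
  simp only [smul_eq_mul] at h; omega

theorem C8.sum_DD (c : C8 S X j) {P : Submodule K V} (hP : P ∈ S) (hPX : P ≤ X) :
    ∑ F ∈ PL P X, (DD S P F).card = 9 * j := by
  have h := c.swap hP hPX (fun L => if s S L = 4 then 1 else 0)
  simp only [← card_filter] at h
  have h2 := c.DD_X hP hPX
  unfold DD at *
  rw [h, h2]

theorem C8.not1 (c : C8 S X 1) : False := by
  have h : ∀ P ∈ S.filter (fun P => P ≤ X), nn S X 10 P = 64 := by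
    intro P hP
    obtain ⟨hP, hPX⟩ := mem_filter.1 hP
    rw [nn_eq, card_filter]
    have h1 := c.card_PL hP hPX
    have h2 := c.sum_DD hP hPX
    have h3 : ∑ F ∈ PL P X, ((if s S F = 10 then 1 else 0) + (DD S P F).card)
        = ∑ F ∈ PL P X, 1 := by
      apply sum_congr rfl
      intro F hF
      obtain ⟨f1, f2, f3⟩ := mem_PL.1 hF
      have h4 := c.DD_plane hP f1 f2 f3
      have h5 := card_le_card (DD_mono (S := S) (P := P) f2)
      rw [c.DD_X hP hPX] at h5
      split_ifs <;> omega
    rw [sum_add_distrib, h2, sum_const, h1] at h3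
    simp only [smul_eq_mul] at h3; omega
  have h2 := dc_pla (S := S) (X := X) 10
  rw [sum_congr rfl h, sum_const, smul_eq_mul] at h2
  have h3 : (S.filter (fun P => P ≤ X)).card = 76 := c.hs
  omega

theorem C8.pairs' (c : C8 S X j) (hj : j ≤ 3) {P : Submodule K V} (hP : P ∈ S) (hPX : P ≤ X) :
    2 * nn S X 14 P + 6 * nn S X 16 P = j * j - j := by
  rw [← c.pairs hP hPX, nn_eq, nn_eq, card_filter, card_filter, mul_sum, mul_sum,
    ← sum_add_distrib]
  apply sum_congr rfl
  intro F hF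
  obtain ⟨f1, f2, f3⟩ := mem_PL.1 hF
  have h4 := c.DD_plane hP f1 f2 f3
  have h5 := card_le_card (DD_mono (S := S) (P := P) f2)
  rw [c.DD_X hP hPX] at h5
  generalize (DD S P F).card = t at *
  rw [h4]
  have : t ≤ 3 := by omega
  interval_cases t <;> simp

theorem C8.count (c : C8 S X j) (hj : j ≤ 3) :
    2 * ((pla S X 14).card * 14) + 6 * ((pla S X 16).card * 16) = (74 + 2 * j) * (j * j - j) := by
  rw [← dc_pla, ← dc_pla, mul_sum, mul_sum, ← sum_add_distrib, sum_const_nat (m := j * j - j)]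
  · have : (S.filter (fun P => P ≤ X)).card = 74 + 2 * j := c.hs
    rw [this]
  · intro P hP
    obtain ⟨hP, hPX⟩ := mem_filter.1 hP
    exact c.pairs' hj hP hPX

theorem C8.not2 (c : C8 S X 2) : False := by
  have h := c.count (by norm_num)
  have h2 : nn S X 16 = 0 := by
    by_contra hh
    obtain ⟨P, hP⟩ := Function.ne_iff.1 hh
    obtain ⟨F, hF⟩ := card_pos.1 (Nat.pos_of_ne_zero hP)
    rw [mem_filter, mem_pla] at hF
    obtain ⟨⟨f1, f2, f3⟩, -⟩ := hF
    obtain ⟨Q, hQ, hQF⟩ := s_pos_iff.1 (show 0 < s S F by omega)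
    have h1 := c.pairs' (by norm_num) hQ (hQF.trans f1)
    have : 0 < nn S X 16 Q := card_pos.2 ⟨F, mem_filter.2 ⟨mem_pla.2 ⟨f1, f2, f3⟩, hQF⟩⟩
    omega
  have h3 := dc_pla (S := S) (X := X) 16
  rw [h2] at h3
  simp at h3
  rw [h3] at h
  simp at h
  omega

theorem C8.c3 (c : C8 S X 3) : (pla S X 14).card = 0 ∧ (pla S X 16).card = 5 := by
  have h := c.count (by norm_num)
  omega

theorem C8.n16 (c : C8 S X 3) {P : Submodule K V} (hP : P ∈ S) (hPX : P ≤ X) :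
    nn S X 16 P = 1 := by
  have h := c.pairs' (by norm_num) hP hPX
  have h1 : nn S X 14 P ≤ (pla S X 14).card := card_le_card (filter_subset _ _)
  rw [c.c3.1] at h1
  omega

theorem C8.uniq16 (c : C8 S X 3) {P F G : Submodule K V} (hP : P ∈ S) (hPX : P ≤ X)
    (hF : F ∈ pla S X 16) (hG : G ∈ pla S X 16) (hPF : P ≤ F) (hPG : P ≤ G) : F = G :=
  card_le_one.1 (c.n16 hP hPX).le _ (mem_filter.2 ⟨hF, hPF⟩) _ (mem_filter.2 ⟨hG, hPG⟩)

theorem C8.ex16 (c : C8 S X 3) {P : Submodule K V} (hP : P ∈ S) (hPX : P ≤ X) :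
    ∃ F ∈ pla S X 16, P ≤ F := by
  have : 0 < nn S X 16 P := by rw [c.n16 hP hPX]; norm_num
  obtain ⟨F, hF⟩ := card_pos.1 this
  exact ⟨F, (mem_filter.1 hF).1, (mem_filter.1 hF).2⟩

/-- planes on a 4-secant -/
theorem C8.on_sec (c : C8 S X 3) {l : Submodule K V} (hl : l ∈ sec S X) :
    (∀ W ∈ pen l X, s S W = 12 ∨ s S W = 16) ∧
    ((pen l X).filter (fun W => s S W = 16)).card = 1 ∧
    ((pen l X).filter (fun W => s S W = 12)).card = 8 := by
  obtain ⟨l1, l2, l3⟩ := mem_sec.1 hl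
  obtain ⟨P, hP, hPl⟩ := s_pos_iff.1 (show 0 < s S l by omega)
  have h0 : ∀ W ∈ pen l X, s S W = 12 ∨ s S W = 16 := by
    intro W hW
    obtain ⟨w1, w2, w3⟩ := mem_pen.1 hW
    rw [l2] at w3
    have h1 := c.DD_plane hP (hPl.trans w1) w2 w3
    have h5 := card_le_card (DD_mono (S := S) (P := P) w2)
    rw [c.DD_X hP (hPl.trans l1)] at h5
    have h6 : 0 < (DD S P W).card := card_pos.2 ⟨l, (mem_DD (c.hS P hP)).2 ⟨hPl, w1, l2, l3⟩⟩
    have h7 : s S W ≠ 14 := by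
      intro h
      have : 0 < (pla S X 14).card := card_pos.2 ⟨W, mem_pla.2 ⟨w2, w3, h⟩⟩
      rw [c.c3.1] at this; omega
    omega
  refine ⟨h0, ?_⟩
  have h1 := pencil_sum c.hS l1
  have h2 := card_pen c.hq l1
  rw [c.hX, l2, th_two] at h2
  rw [h2, l3, c.hs] at h1
  have h3 : ∑ W ∈ pen l X, s S W = ∑ W ∈ pen l X,
      (16 * (if s S W = 16 then 1 else 0) + 12 * (if s S W = 12 then 1 else 0)) := by
    apply sum_congr rfl
    intro W hW
    rcases h0 W hW with h | h <;> simp [h]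
  have h4 : ∑ W ∈ pen l X, 1 = ∑ W ∈ pen l X,
      ((if s S W = 16 then 1 else 0) + (if s S W = 12 then 1 else 0)) := by
    apply sum_congr rfl
    intro W hW
    rcases h0 W hW with h | h <;> simp [h]
  rw [sum_add_distrib, ← mul_sum, ← mul_sum, ← card_filter, ← card_filter] at h3
  rw [sum_add_distrib, ← card_filter, ← card_filter, sum_const, h2] at h4
  simp only [smul_eq_mul] at h4
  omega

/-- number of 4-secants in a plane -/
theorem C8.card_sec (c : C8 S X 3) {F : Submodule K V} (hF : F ≤ X) (hr : finrank K F = 3)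
    {t : ℕ} (ht : s S F = 10 + 2 * t) : 4 * (sec S F).card = s S F * t := by
  have h := dc S (sec S F) F (fun L hL => (mem_sec.1 hL).1)
  rw [sum_const_nat (s := sec S F) (m := 4) (fun L hL => (mem_sec.1 hL).2.2),
    sum_const_nat (m := t)] at h
  · unfold s; omega
  · intro P hP
    obtain ⟨hP, hPF⟩ := mem_filter.1 hP
    have h1 := c.DD_plane hP hPF hF hr
    have : (sec S F).filter (fun L => P ≤ L) = DD S P F := by
      ext L; rw [mem_filter, mem_sec, mem_DD (c.hS P hP)]; tauto
    rw [this]; omega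

end HC

open Submodule
set_option linter.unusedSectionVars false
set_option linter.unusedVariables false
namespace HC
open scoped Classical
open Finset Module

variable {K V : Type*} [Field K] [Finite K] [AddCommGroup V] [Module K V] [Finite V]
variable {S : Finset (Submodule K V)} {X : Submodule K V} {j : ℕ}

/-- 4-secants in `Y` through `N` -/
noncomputable def YY (S : Finset (Submodule K V)) (N Y : Submodule K V) :
    Finset (Submodule K V) := (sec S Y).filter (fun L => N ≤ L)

theorem mem_YY {N Y L : Submodule K V} :
    L ∈ YY S N Y ↔ (L ≤ Y ∧ finrank K L = 2 ∧ s S L = 4) ∧ N ≤ L := by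
  unfold YY; rw [mem_filter, mem_sec]

theorem YY_sub {N Y : Submodule K V} (hN : finrank K N = 1) : YY S N Y ⊆ pen N Y := by
  intro L hL
  obtain ⟨⟨a, b, c⟩, d⟩ := mem_YY.1 hL
  exact line_mem_pen hN b d a

theorem YY_sum {N Y : Submodule K V} : ∑ L ∈ YY S N Y, s S L = (YY S N Y).card * 4 :=
  sum_const_nat (fun L hL => (mem_YY.1 hL).1.2.2)

theorem YY_le (hS : IsPts S) {N F : Submodule K V} (hN : finrank K N = 1) (hNS : N ∉ S)
    (hNF : N ≤ F) (hs : s S F = 16) : (YY S N F).card ≤ 4 := by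
  have h := pencil_off hS hNF (s_pt_not_mem hS hN hNS)
  have h2 := sum_le_sum_of_subset (f := fun L => s S L) (YY_sub (S := S) (Y := F) hN)
  simp only [YY_sum] at h2; omega

theorem YY_eq (hS : IsPts S) {N F Q : Submodule K V} (hN : finrank K N = 1) (hNS : N ∉ S)
    (hNF : N ≤ F) (hs : s S F = 16) (h4 : (YY S N F).card = 4) (hQ : Q ∈ S) (hQF : Q ≤ F) :
    s S (Q ⊔ N) = 4 := by
  have h := pencil_off hS hNF (s_pt_not_mem hS hN hNS)
  have hQN : Q ≠ N := fun h => hNS (h ▸ hQ)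
  have hr := rank_line (hS Q hQ) hN hQN
  have hm := line_mem_pen hN hr le_sup_right (sup_le hQF hNF)
  by_contra hne
  have hm2 : Q ⊔ N ∉ YY S N F := fun hh => hne (mem_YY.1 hh).1.2.2
  have h2 := sum_le_sum_of_subset (f := fun L => s S L)
    (insert_subset hm (YY_sub (S := S) (Y := F) hN))
  rw [sum_insert hm2, YY_sum, h4] at h2
  have : 0 < s S (Q ⊔ N) := s_pos_iff.2 ⟨Q, hQ, le_sup_left⟩
  omega

theorem C8.inf16 (c : C8 S X 3) {l F G : Submodule K V} (hl : l ∈ sec S X) (hlF : l ≤ F)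
    (hF : F ∈ pla S X 16) (hG : G ∈ pla S X 16) (hne : G ≠ F) :
    finrank K ↥(l ⊓ G) = 1 ∧ l ⊓ G ∉ S := by
  obtain ⟨l1, l2, l3⟩ := mem_sec.1 hl
  obtain ⟨g1, g2, g3⟩ := mem_pla.1 hG
  have h1 := rank_sup_inf l G
  have h2 := rank_mono (sup_le l1 g1)
  rw [c.hX] at h2
  have h3 : ∀ P ∈ S, P ≤ l → ¬ P ≤ G := by
    intro P hP hPl hPG
    exact hne (c.uniq16 hP (hPl.trans l1) hG hF hPG (hPl.trans hlF))
  obtain ⟨P, hP, hPl⟩ := s_pos_iff.1 (show 0 < s S l by omega)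
  have h4 : finrank K ↥(l ⊓ G) < 2 := by
    by_contra hh
    have : l ⊓ G = l := eq_of_le_rank inf_le_left (by omega)
    exact h3 P hP hPl (hPl.trans (this ▸ inf_le_right))
  exact ⟨by omega, fun hh => h3 _ hh inf_le_left inf_le_right⟩

theorem C8.card12 (c : C8 S X 3) {F : Submodule K V} (hF : F ≤ X) (hr : finrank K F = 3)
    (hs : s S F = 12) : (sec S F).card = 3 := by
  have := c.card_sec hF hr (t := 1) (by omega); omega

theorem C8.card16 (c : C8 S X 3) {F : Submodule K V} (hF : F ∈ pla S X 16) :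
    (sec S F).card = 12 := by
  obtain ⟨g1, g2, g3⟩ := mem_pla.1 hF
  have := c.card_sec g1 g2 (t := 3) (by omega); omega

theorem C8.mainY (c : C8 S X 3) {l F G : Submodule K V} (hl : l ∈ sec S X) (hlF : l ≤ F)
    (hF : F ∈ pla S X 16) (hG : G ∈ pla S X 16) (hne : G ≠ F) :
    (YY S (l ⊓ G) G).card = 4 := by
  obtain ⟨l1, l2, l3⟩ := mem_sec.1 hl
  set B := (sec S X).filter (fun m => m ≠ l ∧ l ⊔ m ∈ (pen l X).filter (fun W => s S W = 12))
    with hB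
  have hBc : B.card = 16 := by
    rw [card_eq_sum_card_fiberwise (f := fun m => l ⊔ m)
      (t := (pen l X).filter (fun W => s S W = 12))]
    · rw [sum_const_nat (m := 2), (c.on_sec hl).2.2]
      intro W hW
      obtain ⟨hW1, hW2⟩ := mem_filter.1 hW
      obtain ⟨w1, w2, w3⟩ := mem_pen.1 hW1
      rw [l2] at w3
      have : B.filter (fun m => l ⊔ m = W) = (sec S W).erase l := by
        ext m
        simp only [hB, mem_filter, mem_erase, mem_sec]
        constructor
        · rintro ⟨⟨⟨a, b, d⟩, e, f⟩, rfl⟩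
          exact ⟨e, le_sup_right, b, d⟩
        · rintro ⟨a, b, d, e⟩
          have h1 : l ⊔ m = W := by
            apply eq_of_le_rank (sup_le w1 b)
            obtain ⟨Z, z1, z2, z3⟩ := meet_pos w1 b (by omega)
            rw [(rank_two_lines z1 l2 d z2 z3 a.symm).1, w3]
          exact ⟨⟨⟨b.trans w2, d, e⟩, a, h1 ▸ ⟨hW1, hW2⟩⟩, h1⟩
      rw [this, card_erase_of_mem (mem_sec.2 ⟨w1, l2, l3⟩), c.card12 w2 w3 hW2]
    · intro m hm
      exact (mem_filter.1 (mem_coe.1 hm)).2.2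
  have hsub : B ⊆ ((pla S X 16).erase F).biUnion (fun G => YY S (l ⊓ G) G) := by
    intro m hm
    simp only [hB, mem_filter, mem_sec] at hm
    obtain ⟨⟨m1, m2, m3⟩, m4, m5, m6⟩ := hm
    obtain ⟨w1, w2, w3⟩ := mem_pen.1 m5
    rw [l2] at w3
    obtain ⟨H, hH⟩ := card_pos.1 (show 0 < ((pen m X).filter (fun W => s S W = 16)).card by
      rw [(c.on_sec (mem_sec.2 ⟨m1, m2, m3⟩)).2.1]; norm_num)
    obtain ⟨h1, h2⟩ := mem_filter.1 hH
    obtain ⟨h3, h4, h5⟩ := mem_pen.1 h1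
    rw [m2] at h5
    have hH16 : H ∈ pla S X 16 := mem_pla.2 ⟨h4, h5, h2⟩
    have hHF : H ≠ F := by
      rintro rfl
      have : l ⊔ m = H := eq_of_le_rank (sup_le hlF h3) (by omega)
      rw [this] at m6; omega
    rw [mem_biUnion]
    refine ⟨H, mem_erase.2 ⟨hHF, hH16⟩, mem_YY.2 ⟨⟨h3, m2, m3⟩, ?_⟩⟩
    have h6 := (c.inf16 hl hlF hF hH16 hHF).1
    obtain ⟨Z, z1, z2, z3⟩ := meet_pos (le_sup_left : l ≤ l ⊔ m) le_sup_right (by omega)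
    have : Z = l ⊓ H := pt_eq z1 h6 (le_inf z2 (z3.trans h3))
    rw [← this]; exact z3
  have h1 := (card_le_card hsub).trans card_biUnion_le
  rw [hBc] at h1
  have hle : ∀ G ∈ (pla S X 16).erase F, (YY S (l ⊓ G) G).card ≤ 4 := by
    intro G hG
    obtain ⟨g1, g2⟩ := mem_erase.1 hG
    obtain ⟨a, b⟩ := c.inf16 hl hlF hF g2 g1
    exact YY_le c.hS a b inf_le_right (mem_pla.1 g2).2.2
  have hcard : ((pla S X 16).erase F).card = 4 := by
    rw [card_erase_of_mem hF, c.c3.2]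
  have hGm : G ∈ (pla S X 16).erase F := mem_erase.2 ⟨hne, hG⟩
  by_contra hcon
  have hlt : (YY S (l ⊓ G) G).card < 4 := lt_of_le_of_ne (hle G hGm) hcon
  have h2 := sum_lt_sum hle ⟨G, hGm, hlt⟩
  rw [sum_const, hcard, smul_eq_mul] at h2
  omega

theorem C8.symY (c : C8 S X 3) {l F G : Submodule K V} (hl : l ∈ sec S X) (hlF : l ≤ F)
    (hF : F ∈ pla S X 16) (hG : G ∈ pla S X 16) (hne : G ≠ F) :
    (YY S (l ⊓ G) F).card = 4 := by
  have h1 := c.mainY hl hlF hF hG hne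
  obtain ⟨m, hm⟩ := card_pos.1 (show 0 < (YY S (l ⊓ G) G).card by omega)
  obtain ⟨⟨m1, m2, m3⟩, m4⟩ := mem_YY.1 hm
  have hmX : m ∈ sec S X := mem_sec.2 ⟨m1.trans (mem_pla.1 hG).1, m2, m3⟩
  have h2 := c.mainY hmX m1 hG hF hne.symm
  have h3 := (c.inf16 hl hlF hF hG hne).1
  have h4 := (c.inf16 hmX m1 hG hF hne.symm).1
  rw [pt_eq h3 h4 (le_inf m4 (inf_le_left.trans hlF))]
  exact h2

theorem C8.uniqN (c : C8 S X 3) {l F N N' : Submodule K V} (hl : l ∈ sec S X) (hlF : l ≤ F)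
    (hF : F ∈ pla S X 16) (hN : finrank K N = 1) (hN' : finrank K N' = 1) (hNl : N ≤ l)
    (hNl' : N' ≤ l) (hNS : N ∉ S) (hNS' : N' ∉ S)
    (h : (YY S N F).card = 4) (h' : (YY S N' F).card = 4) : N = N' := by
  obtain ⟨l1, l2, l3⟩ := mem_sec.1 hl
  obtain ⟨f1, f2, f3⟩ := mem_pla.1 hF
  by_contra hne
  have hlm : l ∈ sec S F := mem_sec.2 ⟨hlF, l2, l3⟩
  have h1 : ((sec S F).erase l).card = 11 := by rw [card_erase_of_mem hlm, c.card16 hF]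
  have key : ∀ m ∈ (sec S F).erase l, ∀ Z : Submodule K V, finrank K Z = 1 → Z ≤ l →
      (l ⊓ m = Z ↔ Z ≤ m) := by
    intro m hm Z hZ hZl
    obtain ⟨a, b⟩ := mem_erase.1 hm
    obtain ⟨m1, m2, m3⟩ := mem_sec.1 b
    constructor
    · rintro rfl; exact inf_le_right
    · intro hZm
      exact (rank_two_lines hZ l2 m2 hZl hZm a.symm).2
  rw [card_eq_sum_card_fiberwise (f := fun m => l ⊓ m) (t := ptsOf l)] at h1
  · have h2 : ∑ Z ∈ S.filter (fun P => P ≤ l) ∪ {N, N'},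
        (((sec S F).erase l).filter (fun m => l ⊓ m = Z)).card ≤ 11 := by
      rw [← h1]
      apply sum_le_sum_of_subset
      intro Y hY
      simp only [mem_union, mem_filter, mem_insert, mem_singleton] at hY
      rw [mem_ptsOf]
      rcases hY with h | rfl | rfl
      · exact ⟨c.hS Y h.1, h.2⟩
      · exact ⟨hN, hNl⟩
      · exact ⟨hN', hNl'⟩
    have hYY : ∀ Z : Submodule K V, finrank K Z = 1 → Z ≤ l →
        (((sec S F).erase l).filter (fun m => l ⊓ m = Z)).card = (YY S Z F).card - 1 := by
      intro Z hZ hZl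
      have : ((sec S F).erase l).filter (fun m => l ⊓ m = Z) = (YY S Z F).erase l := by
        ext m
        rw [mem_filter]
        constructor
        · rintro ⟨a, b⟩
          have := (key m a Z hZ hZl).1 b
          obtain ⟨a1, a2⟩ := mem_erase.1 a
          exact mem_erase.2 ⟨a1, mem_filter.2 ⟨a2, this⟩⟩
        · intro a
          obtain ⟨a1, a2⟩ := mem_erase.1 a
          obtain ⟨a2, a3⟩ := mem_filter.1 a2
          have a4 := mem_erase.2 ⟨a1, a2⟩
          exact ⟨a4, (key m a4 Z hZ hZl).2 a3⟩
      rw [this, card_erase_of_mem (mem_YY.2 ⟨⟨hlF, l2, l3⟩, hZl⟩)]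
    rw [sum_union, sum_pair hne, hYY N hN hNl, hYY N' hN' hNl', h, h', sum_const_nat (m := 2)] at h2
    · have : (S.filter (fun P => P ≤ l)).card = 4 := l3
      omega
    · intro Z hZ
      obtain ⟨hZ, hZl⟩ := mem_filter.1 hZ
      rw [hYY Z (c.hS Z hZ) hZl]
      have h3 := c.DD_plane hZ (hZl.trans hlF) f1 f2
      have : YY S Z F = DD S Z F := by
        ext m; rw [mem_YY, mem_DD (c.hS Z hZ)]; tauto
      rw [this]; omega
    · rw [Finset.disjoint_right]
      intro Y hY
      simp only [mem_insert, mem_singleton] at hY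
      rcases hY with rfl | rfl <;> simp [*]
  · intro m hm
    obtain ⟨a, b⟩ := mem_erase.1 (mem_coe.1 hm)
    obtain ⟨m1, m2, m3⟩ := mem_sec.1 b
    obtain ⟨Z, z1, z2, z3⟩ := meet_pos hlF m1 (by omega)
    have e := (key m (mem_coe.1 hm) Z z1 z2).2 z3
    rw [mem_coe, mem_ptsOf]
    show finrank K ↥(l ⊓ m) = 1 ∧ l ⊓ m ≤ l
    rw [e]
    exact ⟨z1, z2⟩

theorem C8.not3 (c : C8 S X 3) : False := by
  obtain ⟨F, hF⟩ := card_pos.1 (show 0 < (pla S X 16).card by rw [c.c3.2]; norm_num)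
  obtain ⟨f1, f2, f3⟩ := mem_pla.1 hF
  obtain ⟨l, hl⟩ := card_pos.1 (show 0 < (sec S F).card by rw [c.card16 hF]; norm_num)
  obtain ⟨lF, l2, l3⟩ := mem_sec.1 hl
  have hlX : l ∈ sec S X := mem_sec.2 ⟨lF.trans f1, l2, l3⟩
  obtain ⟨G, hG⟩ := card_pos.1 (show 0 < ((pla S X 16).erase F).card by
    rw [card_erase_of_mem hF, c.c3.2]; norm_num)
  obtain ⟨g1, g2⟩ := mem_erase.1 hG
  obtain ⟨hN, hNS⟩ := c.inf16 hlX lF hF g2 g1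
  have hNF := c.symY hlX lF hF g2 g1
  set N := l ⊓ G with hNdef
  have hNl : N ≤ l := inf_le_left
  have hall : ∀ H ∈ pla S X 16, N ≤ H ∧ (YY S N H).card = 4 := by
    intro H hH
    by_cases hHF : H = F
    · rw [hHF]; exact ⟨hNl.trans lF, hNF⟩
    · obtain ⟨a, b⟩ := c.inf16 hlX lF hF hH hHF
      have e := c.uniqN hlX lF hF hN a hNl inf_le_left hNS b hNF (c.symY hlX lF hF hH hHF)
      rw [e]
      exact ⟨inf_le_right, c.mainY hlX lF hF hH hHF⟩
  have hcone : ∀ Q ∈ S, Q ≤ X → s S (Q ⊔ N) = 4 := by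
    intro Q hQ hQX
    obtain ⟨H, hH, hQH⟩ := c.ex16 hQ hQX
    exact YY_eq c.hS hN hNS (hall H hH).1 (mem_pla.1 hH).2.2 (hall H hH).2 hQ hQH
  have hNX : N ≤ X := hNl.trans (lF.trans f1)
  have hcount : ∀ Y ≤ X, N ≤ Y → s S Y = (YY S N Y).card * 4 := by
    intro Y hY hNY
    rw [pencil_off c.hS hNY (s_pt_not_mem c.hS hN hNS), ← YY_sum]
    symm
    apply sum_subset (YY_sub hN)
    intro L hL hL2
    by_contra h0
    obtain ⟨Q, hQ, hQL⟩ := s_pos_iff.1 (Nat.pos_of_ne_zero h0)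
    obtain ⟨n1, n2, -⟩ := mem_pen.1 hL
    have hLr := rank_of_mem_pen_pt hN hL
    have e := line_eq (c.hS Q hQ) hN (fun h => hNS (h ▸ hQ)) hLr hQL n1
    have := hcone Q hQ (hQL.trans (n2.trans hY))
    rw [e] at this
    exact hL2 (mem_YY.2 ⟨⟨n2, hLr, this⟩, n1⟩)
  have h20 := hcount X le_rfl hNX
  rw [c.hs] at h20
  have hdc := Finset.sum_card_bipartiteAbove_eq_sum_card_bipartiteBelow
    (s := YY S N X) (t := (pla S X 12).filter (fun F => N ≤ F)) (fun P F : Submodule K V => P ≤ F)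
  unfold bipartiteAbove bipartiteBelow at hdc
  rw [sum_const_nat (m := 8), sum_const_nat (m := 3)] at hdc
  · omega
  · intro H hH
    obtain ⟨h1, h2⟩ := mem_filter.1 hH
    obtain ⟨h3, h4, h5⟩ := mem_pla.1 h1
    have := hcount H h3 h2
    have e : (YY S N X).filter (fun m => m ≤ H) = YY S N H := by
      ext m; rw [mem_filter, mem_YY, mem_YY]
      constructor
      · rintro ⟨⟨⟨a, b, c⟩, d⟩, e⟩; exact ⟨⟨e, b, c⟩, d⟩
      · rintro ⟨⟨a, b, c⟩, d⟩; exact ⟨⟨⟨a.trans h3, b, c⟩, d⟩, a⟩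
    rw [e]; omega
  · intro m hm
    obtain ⟨⟨m1, m2, m3⟩, m4⟩ := mem_YY.1 hm
    rw [← (c.on_sec (mem_sec.2 ⟨m1, m2, m3⟩)).2.2]
    congr 1
    ext H
    simp only [mem_filter, mem_pla, mem_pen, m2]
    constructor
    · rintro ⟨⟨⟨a, b, c⟩, d⟩, e⟩; exact ⟨⟨e, a, b⟩, c⟩
    · rintro ⟨⟨a, b, c⟩, d⟩; exact ⟨⟨⟨b, c, d⟩, m4.trans a⟩, a⟩

theorem base4 {q : ℕ} (hq48 : q = 4 ∨ q = 8) (hq : Nat.card K = q) (hS : IsPts S)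
    {P : Submodule K V} (hX : finrank K X = 4) (hE : Ev S 2 X) (hP : P ∈ S) (hPX : P ≤ X) :
    q * (q + 2) ≤ s S X ∧ (s S X = q * (q + 2) → ∃ N : Submodule K V,
      finrank K N = 1 ∧ N ≤ X ∧ N ∉ S ∧ ∀ Q ∈ S, Q ≤ X → s S (Q ⊔ N) = q) := by
  by_cases hle : s S X ≤ q * (q + 2)
  swap
  · exact ⟨by omega, fun h => absurd h.le hle⟩
  have hnt := not_t0 hq48 hq hS hX hE hP hPX
  have hex := solid_exc hq hS hX hE hP hPX
  by_cases hsec : ∃ l ≤ X, finrank K l = 2 ∧ s S l = q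
  · obtain ⟨l, l1, l2, l3⟩ := hsec
    have := vertex_of_qsec (by rcases hq48 with rfl | rfl <;> norm_num) hq hS hX hE hle l1 l2 l3
    exact ⟨this.1.ge, fun _ => this.2⟩
  exfalso
  push Not at hsec
  have hlin : ∀ Q ∈ S, ∀ L ≤ X, Q ≤ L → finrank K L = 2 → Even (s S L) ∧ 2 ≤ s S L ∧
      s S L < q ∧ s S X ≥ q * q + q + s S L := by
    intro Q hQ L hL hQL hLr
    have hm := line_mem_pen (hS Q hQ) hLr hQL hL
    have h1 := two_le_line hS hE hQ hm
    have h2 := line_le_exc (S := S) hm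
    have h3 := solid_exc hq hS hX hE hQ (hQL.trans hL)
    have h4 := hsec L hL hLr
    have e : q * (q + 2) = q * q + 2 * q := by ring
    refine ⟨h1.2, h1.1, ?_, ?_⟩ <;> omega
  rcases hq48 with rfl | rfl
  · have hall : ∀ L ∈ pen P X, s S L - 2 = 0 := by
      intro L hL
      obtain ⟨a, b, e⟩ := mem_pen.1 hL
      have := hlin P hP L b a (rank_of_mem_pen_pt (hS P hP) hL)
      obtain ⟨c, hc⟩ := this.1
      omega
    rw [sum_eq_zero hall] at hex
    omega
  · have h6 : ∀ L ≤ X, finrank K L = 2 → s S L ≤ 4 := by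
      intro L hL hLr
      rcases Nat.eq_zero_or_pos (s S L) with h | h
      · omega
      · obtain ⟨Q, hQ, hQL⟩ := s_pos_iff.1 h
        have := hlin Q hQ L hL hQL hLr
        obtain ⟨c, hc⟩ := this.1
        by_contra hh
        exact no_six hq hS hX hE (by omega) hL hLr (by omega)
    obtain ⟨t, ht⟩ := Ev.up hq (by decide) hS hE (by norm_num) (show 2 ≤ 4 by norm_num) X le_rfl hX
    obtain ⟨j, hj⟩ : ∃ j, s S X = 74 + 2 * j := ⟨t - 37, by omega⟩
    have c : C8 S X j := ⟨hq, hS, hX, hE, h6, hj⟩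
    have : j = 0 ∨ j = 1 ∨ j = 2 ∨ j = 3 := by omega
    rcases this with rfl | rfl | rfl | rfl
    · omega
    · exact c.not1
    · exact c.not2
    · exact c.not3
end HC

open Submodule
set_option linter.unusedSectionVars false
set_option linter.unusedVariables false
namespace HC
open scoped Classical
open Finset Module

variable {K V : Type*} [Field K] [Finite K] [AddCommGroup V] [Module K V] [Finite V]
variable {S : Finset (Submodule K V)} {X : Submodule K V} {q : ℕ}

theorem pow_le_th (q e : ℕ) : q ^ e ≤ th q (e + 1) := by rw [th_succ]; omega

theorem hyp_plane (hq : Nat.card K = q) (hS : IsPts S) {e : ℕ} {P : Submodule K V}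
    (hX : finrank K X = e + 3) (hE : Ev S 2 X) (hP : P ∈ S) (hPX : P ≤ X)
    (hle : s S X ≤ (q + 2) * q ^ e) :
    ∃ E : Submodule K V, finrank K E = 3 ∧ P ≤ E ∧ E ≤ X ∧ s S E = q + 2 := by
  have h1 : ∃ l ∈ pen P X, s S l = 2 := by
    by_contra hh
    push Not at hh
    have h2 := exc hq hS hE hP hPX
    have h3 : ∀ L ∈ pen P X, 2 ≤ s S L - 2 := by
      intro L hL
      have := two_le_line hS hE hP hL
      have h4 := hh L hL
      obtain ⟨a, ha⟩ := this.2
      omega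
    have h4 := card_nsmul_le_sum (pen P X) (fun L => s S L - 2) 2 h3
    rw [card_pen hq hPX, hX, hS P hP, smul_eq_mul] at h4
    rw [hX] at h2
    simp only [show e + 3 - 1 = e + 1 + 1 by omega] at h2 h4
    have h5 : th q (e+1+1) = th q (e+1) + q ^ (e + 1) := th_succ q (e+1)
    have h6 := pow_le_th q e
    have : (q + 2) * q ^ e = q ^ (e+1) + 2 * q ^ e := by ring
    omega
  obtain ⟨l, hl, hl2⟩ := h1
  obtain ⟨a, b, c⟩ := mem_pen.1 hl
  have hlr := rank_of_mem_pen_pt (hS P hP) hl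
  by_contra hh
  push Not at hh
  have h2 := pencil_sum hS b
  have h3 : ∀ F ∈ pen l X, q + 3 ≤ s S F := by
    intro F hF
    obtain ⟨f1, f2, f3⟩ := mem_pen.1 hF
    rw [hlr] at f3
    have h4 := plane_exc hq hS f3 (hE.mono f2) hP (a.trans f1)
    have h5 := hh F f3 (a.trans f1) f2
    omega
  have h4 := card_nsmul_le_sum (pen l X) (fun L => s S L) (q + 3) h3
  rw [card_pen hq b, hX, hlr, smul_eq_mul, show e + 3 - 2 = e + 1 by omega] at h4
  rw [card_pen hq b, hX, hlr, hl2, show e + 3 - 2 = e + 1 by omega] at h2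
  have hl4 : ∀ F ∈ pen l X, q + 4 ≤ s S F := by
    intro F hF
    obtain ⟨f1, f2, f3⟩ := mem_pen.1 hF
    rw [hlr] at f3
    have h5 := h3 F hF
    have h6 := plane_exc hq hS f3 (hE.mono f2) hP (a.trans f1)
    have h7 : Even (∑ L ∈ pen P F, (s S L - 2)) := by
      apply even_sum
      intro L hL
      obtain ⟨u, hu⟩ := (two_le_line hS (hE.mono f2) hP hL).2
      exact ⟨u - 1, by omega⟩
    obtain ⟨u, hu⟩ := h7
    omega
  have h4 := card_nsmul_le_sum (pen l X) (fun L => s S L) (q + 4) hl4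
  rw [card_pen hq b, hX, hlr, smul_eq_mul, show e + 3 - 2 = e + 1 by omega] at h4
  have h6 := pow_le_th q e
  nlinarith

theorem even_min (hq48 : q = 4 ∨ q = 8) (hq : Nat.card K = q) (hS : IsPts S) {e : ℕ}
    {P : Submodule K V}
    (hX : finrank K X = e + 3) (hE : Ev S 2 X) (hP : P ∈ S) (hPX : P ≤ X) :
    (q + 2) * q ^ e ≤ s S X ∧ (s S X = (q + 2) * q ^ e →
    ∃ E : Submodule K V, finrank K E = 3 ∧ P ≤ E ∧ E ≤ X ∧ s S E = q + 2 ∧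
      ∀ W ∈ pen E X, s S W = q * (q + 2)) := by
  by_cases hle : s S X ≤ (q + 2) * q ^ e
  swap
  · exact ⟨by omega, fun h => absurd h.le hle⟩
  obtain ⟨E, e1, e2, e3, e4⟩ := hyp_plane hq hS hX hE hP hPX hle
  have h1 := pencil_sum hS e3
  rw [card_pen hq e3, hX, e1, e4, Nat.add_sub_cancel] at h1
  have h2 : ∀ W ∈ pen E X, q * (q + 2) ≤ s S W := by
    intro W hW
    obtain ⟨w1, w2, w3⟩ := mem_pen.1 hW
    exact (base4 hq48 hq hS (by omega) (hE.mono w2) hP (e2.trans w1)).1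
  have h3 := card_nsmul_le_sum (pen E X) (fun L => s S L) _ h2
  rw [card_pen hq e3, hX, e1, smul_eq_mul, Nat.add_sub_cancel] at h3
  have h4 : th q e * (q - 1) + 1 = q ^ e := th_mul q e (one_lt_q hq).le
  have h5 : th q e * (q * (q + 2)) + (q + 2) = (q + 2) * q ^ e + th q e * (q + 2) := by
    rw [← h4]
    obtain ⟨m, rfl⟩ : ∃ m, q = m + 1 := ⟨q - 1, by have := one_lt_q hq; omega⟩
    simp only [Nat.add_sub_cancel]
    ring
  refine ⟨by omega, fun heq => ⟨E, e1, e2, e3, e4, ?_⟩⟩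
  by_contra hcon
  push Not at hcon
  obtain ⟨W, hW, hne⟩ := hcon
  have h6 := sum_lt_sum h2 ⟨W, hW, lt_of_le_of_ne (h2 W hW) hne.symm⟩
  rw [sum_const, card_pen hq e3, hX, e1, smul_eq_mul, Nat.add_sub_cancel] at h6
  omega

theorem s_of_pencil (hq : Nat.card K = q) (hS : IsPts S) {e : ℕ} {E Y : Submodule K V}
    (hY : finrank K Y = e + 3) (hE : finrank K E = 3) (hEY : E ≤ Y) (hs : s S E = q + 2)
    (h : ∀ W ∈ pen E Y, s S W = q * (q + 2)) : s S Y = (q + 2) * q ^ e := by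
  have h1 := pencil_sum hS hEY
  rw [sum_const_nat h, card_pen hq hEY, hY, hE, hs, Nat.add_sub_cancel] at h1
  have h4 : th q e * (q - 1) + 1 = q ^ e := th_mul q e (one_lt_q hq).le
  have h5 : th q e * (q * (q + 2)) + (q + 2) = (q + 2) * q ^ e + th q e * (q + 2) := by
    rw [← h4]
    obtain ⟨m, rfl⟩ : ∃ m, q = m + 1 := ⟨q - 1, by have := one_lt_q hq; omega⟩
    simp only [Nat.add_sub_cancel]
    ring
  omega

/-- vertex -/
def Vx (q : ℕ) (S : Finset (Submodule K V)) (X N : Submodule K V) : Prop :=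
  finrank K N = 1 ∧ N ≤ X ∧ N ∉ S ∧ ∀ Q ∈ S, Q ≤ X → s S (Q ⊔ N) = q

theorem Vx.lines (hq3 : 3 ≤ q) (hq : Nat.card K = q) (hS : IsPts S) {W N : Submodule K V}
    (hW : finrank K W = 4) (hE : Ev S 2 W) (hs : s S W = q * (q + 2)) (hN : Vx q S W N)
    {P L : Submodule K V} (hP : P ∈ S) (hPL : P ≤ L) (hL : L ≤ W) (hLr : finrank K L = 2) :
    s S L = 2 ∨ s S L = q := by
  obtain ⟨n1, n2, n3, n4⟩ := hN
  have hPN : P ≠ N := fun h => n3 (h ▸ hP)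
  by_cases h : L = P ⊔ N
  · right; rw [h]; exact n4 P hP (hPL.trans hL)
  · left
    have h1 := solid_exc hq hS hW hE hP (hPL.trans hL)
    have hm := line_mem_pen (hS P hP) hLr hPL hL
    have hm2 := line_mem_pen (hS P hP) (rank_line (hS P hP) n1 hPN) le_sup_left
      (sup_le (hPL.trans hL) n2)
    have h2 := lines_le_exc (S := S) hm hm2 h
    rw [n4 P hP (hPL.trans hL)] at h2
    have h3 := (two_le_line hS hE hP hm).1
    have e : q * (q + 2) = q * q + 2 * q := by ring
    omega

theorem hyp_lines (hq : Nat.card K = q) (hS : IsPts S) {E L : Submodule K V}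
    (hE3 : finrank K E = 3) (hE : Ev S 2 E) (hs : s S E = q + 2) (hL : L ≤ E)
    (hLr : finrank K L = 2) : s S L ≤ 2 := by
  rcases Nat.eq_zero_or_pos (s S L) with h | h
  · omega
  · obtain ⟨P, hP, hPL⟩ := s_pos_iff.1 h
    have h1 := plane_exc hq hS hE3 hE hP (hPL.trans hL)
    have h2 := line_le_exc (S := S) (line_mem_pen (hS P hP) hLr hPL hL)
    omega

/-- the situation in dimension 5 -/
structure D5 (q : ℕ) (S : Finset (Submodule K V)) (Y : Submodule K V) : Prop where
  hq48 : q = 4 ∨ q = 8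
  hq : Nat.card K = q
  hS : IsPts S
  hY : finrank K Y = 5
  hE : Ev S 2 Y
  hs : s S Y = (q + 2) * q ^ 2

variable {Y : Submodule K V}

theorem D5.hq3 (c : D5 q S Y) : 4 ≤ q := by rcases c.hq48 with h | h <;> omega

theorem D5.lines (c : D5 q S Y) {P L : Submodule K V} (hP : P ∈ S) (hPL : P ≤ L) (hL : L ≤ Y)
    (hLr : finrank K L = 2) : s S L = 2 ∨ s S L = q := by
  obtain ⟨E, e1, e2, e3, e4, e5⟩ := (even_min c.hq48 c.hq c.hS (e := 2) c.hY c.hE hP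
    (hPL.trans hL)).2 c.hs
  obtain ⟨W, w1, w2, w3⟩ := exists_between (sup_le e3 hL) 4 (by
    have := rank_sup_inf E L
    have := rank_mono (le_inf e2 hPL)
    have := c.hS P hP
    omega) (by rw [c.hY]; norm_num)
  have hW : W ∈ pen E Y := mem_pen.2 ⟨le_sup_left.trans w1, w2, by omega⟩
  have hWs := e5 W hW
  obtain ⟨N, hN⟩ := (base4 c.hq48 c.hq c.hS w3 (c.hE.mono w2) hP
    (e2.trans (le_sup_left.trans w1))).2 hWs
  exact Vx.lines (by have := c.hq3; omega) c.hq c.hS w3 (c.hE.mono w2) hWs hN hP hPL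
    (le_sup_right.trans w1) hLr

/-- `q`-secants on `P` -/
noncomputable def Dq (q : ℕ) (S : Finset (Submodule K V)) (P Y : Submodule K V) :
    Finset (Submodule K V) := (pen P Y).filter (fun L => s S L = q)

theorem D5.card_Dq (c : D5 q S Y) {P : Submodule K V} (hP : P ∈ S) (hPY : P ≤ Y) :
    (Dq q S P Y).card = q + 1 := by
  have h1 := exc c.hq c.hS c.hE hP hPY
  have h2 : ∑ L ∈ pen P Y, (s S L - 2) = (q - 2) * (Dq q S P Y).card := by
    unfold Dq
    rw [card_filter, mul_sum]
    apply sum_congr rfl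
    intro L hL
    have h3 := c.lines hP (mem_pen.1 hL).1 (mem_pen.1 hL).2.1 (rank_of_mem_pen_pt (c.hS P hP) hL)
    have := c.hq3
    split_ifs with h <;> omega
  rw [h2, c.hs, c.hY, show 5 - 1 = 3 + 1 by norm_num, th_succ, th_three] at h1
  have := c.hq3
  obtain ⟨m, rfl⟩ : ∃ m, q = m + 2 := ⟨q - 2, by omega⟩
  simp only [Nat.add_sub_cancel] at h1
  have hm : 0 < m := by omega
  apply Nat.eq_of_mul_eq_mul_left hm
  nlinarith

theorem D5.hyp (c : D5 q S Y) {P H : Submodule K V} (hP : P ∈ S) (hPH : P ≤ H) (hH : H ≤ Y)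
    (hr : finrank K H = 4) : ∃ L ∈ Dq q S P Y, L ≤ H := by
  have h1 := solid_exc c.hq c.hS hr (c.hE.mono hH) hP hPH
  have h2 := (even_min c.hq48 c.hq c.hS (e := 1) hr (c.hE.mono hH) hP hPH).1
  have := c.hq3
  have e : (q + 2) * q ^ 1 = q * q + 2 * q := by ring
  obtain ⟨L, hL, hL0⟩ := exists_ne_zero_of_sum_ne_zero
    (show ∑ L ∈ pen P H, (s S L - 2) ≠ 0 by omega)
  refine ⟨L, mem_filter.2 ⟨pen_sub hH hL, ?_⟩, (mem_pen.1 hL).2.1⟩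
  have h3 := c.lines hP (mem_pen.1 hL).1 ((mem_pen.1 hL).2.1.trans hH)
    (rank_of_mem_pen_pt (c.hS P hP) hL)
  omega

theorem D5.span (c : D5 q S Y) {P l0 l1 m : Submodule K V} (hP : P ∈ S) (hPY : P ≤ Y)
    (h0 : l0 ∈ Dq q S P Y) (h1 : l1 ∈ Dq q S P Y) (hne : l0 ≠ l1)
    (hm : m ∈ pen P (l0 ⊔ l1)) : m ∈ Dq q S P Y := by
  have hP1 := c.hS P hP
  obtain ⟨a0, b0⟩ := mem_filter.1 h0
  obtain ⟨a1, b1⟩ := mem_filter.1 h1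
  obtain ⟨m1, m2, m3⟩ := mem_pen.1 hm
  have hmr := rank_of_mem_pen_pt hP1 hm
  have hr0 := rank_of_mem_pen_pt hP1 a0
  have hr1 := rank_of_mem_pen_pt hP1 a1
  have hal := (rank_two_lines hP1 hr0 hr1 (mem_pen.1 a0).1 (mem_pen.1 a1).1 hne).1
  have halY : l0 ⊔ l1 ≤ Y := sup_le (mem_pen.1 a0).2.1 (mem_pen.1 a1).2.1
  have hmY := m2.trans halY
  have hDc := c.card_Dq hP hPY
  by_contra hmD
  have hml : ∀ l ∈ Dq q S P Y, m ≠ l := by rintro l hl rfl; exact hmD hl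
  have hsup : ∀ l ∈ Dq q S P Y, finrank K ↥(m ⊔ l) = 3 ∧ m ⊔ l ≤ Y := by
    intro l hl
    obtain ⟨a, b⟩ := mem_filter.1 hl
    exact ⟨(rank_two_lines hP1 hmr (rank_of_mem_pen_pt hP1 a) m1 (mem_pen.1 a).1 (hml l hl)).1,
      sup_le hmY (mem_pen.1 a).2.1⟩
  -- a plane on `m` missing `D`
  obtain ⟨b, hb, hbD⟩ : ∃ b ∈ pen m Y, b ∉ (Dq q S P Y).image (fun l => m ⊔ l) := by
    apply exists_mem_notMem_of_card_lt_card
    apply lt_of_le_of_lt card_image_le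
    rw [hDc, card_pen c.hq hmY, c.hY, hmr, th_three]
    have := c.hq3
    nlinarith
  obtain ⟨b1', b2, b3⟩ := mem_pen.1 hb
  rw [hmr] at b3
  have hbl : ∀ l ∈ Dq q S P Y, ¬ l ≤ b := by
    intro l hl hlb
    exact hbD (mem_image.2 ⟨l, hl, eq_of_le_rank (sup_le b1' hlb) (by
      rw [(hsup l hl).1, b3])⟩)
  have hg01 : b ⊔ l0 = b ⊔ l1 := by
    have key : ∀ l ∈ Dq q S P Y, l ≤ l0 ⊔ l1 → b ⊔ l = b ⊔ (l0 ⊔ l1) := by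
      intro l hl hle
      have : m ⊔ l = l0 ⊔ l1 := eq_of_le_rank (sup_le m2 hle) (by rw [(hsup l hl).1, hal])
      rw [← this, ← sup_assoc, sup_eq_left.2 b1']
    rw [key l0 h0 le_sup_left, key l1 h1 le_sup_right]
  have hrk : ∀ l ∈ Dq q S P Y, finrank K ↥(b ⊔ l) = 4 := by
    intro l hl
    obtain ⟨a, _⟩ := mem_filter.1 hl
    have h1 := rank_sup_inf b l
    have h2 := rank_mono (le_inf (m1.trans b1') (mem_pen.1 a).1)
    have h3 := rank_of_mem_pen_pt hP1 a
    have h4 : finrank K ↥(b ⊓ l) < 2 := by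
      by_contra hh
      have : b ⊓ l = l := eq_of_le_rank inf_le_right (by omega)
      exact hbl l hl (this ▸ inf_le_left)
    omega
  obtain ⟨H, hH, hHD⟩ : ∃ H ∈ pen b Y, H ∉ (Dq q S P Y).image (fun l => b ⊔ l) := by
    apply exists_mem_notMem_of_card_lt_card
    have e : (Dq q S P Y).image (fun l => b ⊔ l) = ((Dq q S P Y).erase l1).image (fun l => b ⊔ l) := by
      ext Z
      simp only [mem_image, mem_erase]
      constructor
      · rintro ⟨l, hl, rfl⟩
        by_cases h : l = l1
        · subst h; exact ⟨l0, ⟨hne, h0⟩, hg01⟩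
        · exact ⟨l, ⟨h, hl⟩, rfl⟩
      · rintro ⟨l, hl, rfl⟩; exact ⟨l, hl.2, rfl⟩
    rw [e]
    apply lt_of_le_of_lt card_image_le
    rw [card_erase_of_mem h1, hDc, card_pen c.hq b2, c.hY, b3, th_two]
    omega
  obtain ⟨H1, H2, H3⟩ := mem_pen.1 hH
  obtain ⟨l, hl, hlH⟩ := c.hyp hP (m1.trans (b1'.trans H1)) H2 (by omega)
  exact hHD (mem_image.2 ⟨l, hl, eq_of_le_rank (sup_le H1 hlH) (by rw [hrk l hl]; omega)⟩)

theorem pen_le {P A B : Submodule K V} (hP : finrank K P = 1) (hA : P ≤ A)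
    (hPB : P ≤ B) (h : pen P A ⊆ pen P B) : A ≤ B := by
  by_contra hh
  obtain ⟨R, r1, r2, r3⟩ := exists_pt_not_le hh
  have hne : P ≠ R := by rintro rfl; exact r3 hPB
  have := h (line_mem_pen hP (rank_line hP r1 hne) le_sup_left (sup_le hA r2))
  exact r3 (le_sup_right.trans (mem_pen.1 this).2.1)

theorem D5.plane (c : D5 q S Y) {P : Submodule K V} (hP : P ∈ S) (hPY : P ≤ Y) :
    ∃ A : Submodule K V, finrank K A = 3 ∧ P ≤ A ∧ A ≤ Y ∧ s S A = q ^ 2 ∧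
      Dq q S P Y = pen P A ∧ ∀ Z ∈ S, Z ≤ A → Dq q S Z Y = pen Z A := by
  have hP1 := c.hS P hP
  have hDc := c.card_Dq hP hPY
  have hq3 := c.hq3
  obtain ⟨l0, h0, l1, h1, hne⟩ := one_lt_card.1 (show 1 < (Dq q S P Y).card by omega)
  obtain ⟨a0, b0⟩ := mem_filter.1 h0
  obtain ⟨a1, b1⟩ := mem_filter.1 h1
  have hr0 := rank_of_mem_pen_pt hP1 a0
  have hr1 := rank_of_mem_pen_pt hP1 a1
  have hal := (rank_two_lines hP1 hr0 hr1 (mem_pen.1 a0).1 (mem_pen.1 a1).1 hne).1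
  have halY : l0 ⊔ l1 ≤ Y := sup_le (mem_pen.1 a0).2.1 (mem_pen.1 a1).2.1
  have hPA : P ≤ l0 ⊔ l1 := (mem_pen.1 a0).1.trans le_sup_left
  have hD : Dq q S P Y = pen P (l0 ⊔ l1) := by
    symm
    apply eq_of_subset_of_card_le
    · intro m hm; exact c.span hP hPY h0 h1 hne hm
    · rw [hDc, card_pen c.hq hPA, hal, hP1, th_two]
  have hs : s S (l0 ⊔ l1) = q ^ 2 := by
    have h := pencil_on c.hq c.hS hP hPA
    have hc : ∑ W ∈ Dq q S P Y, s S W = (Dq q S P Y).card * q :=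
      sum_const_nat (fun L hL => (mem_filter.1 hL).2)
    rw [hal, th_two, ← hD, hc, hDc] at h
    nlinarith
  refine ⟨l0 ⊔ l1, hal, hPA, halY, hs, hD, ?_⟩
  intro Z hZ hZA
  have hZ1 := c.hS Z hZ
  symm
  apply eq_of_subset_of_card_le
  · intro L hL
    refine mem_filter.2 ⟨pen_sub halY hL, ?_⟩
    by_contra hLq
    have hle : ∀ M ∈ pen Z (l0 ⊔ l1), s S M ≤ q := by
      intro M hM
      have := c.lines hZ (mem_pen.1 hM).1 ((mem_pen.1 hM).2.1.trans halY)
        (rank_of_mem_pen_pt hZ1 hM)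
      omega
    have h2 := sum_lt_sum hle ⟨L, hL, lt_of_le_of_ne (hle L hL) hLq⟩
    have h3 := pencil_on c.hq c.hS hZ hZA
    rw [hs] at h3
    rw [sum_const, card_pen c.hq hZA, hal, hZ1, th_two, smul_eq_mul] at h2
    rw [hal, th_two] at h3
    nlinarith
  · rw [c.card_Dq hZ (hZA.trans halY), card_pen c.hq hZA, hal, hZ1, th_two]

theorem D5.vertex (c : D5 q S Y) {E W N : Submodule K V} (hE3 : finrank K E = 3) (hEW : E ≤ W)
    (hWY : W ≤ Y) (hEs : s S E = q + 2) (hN : Vx q S W N) : Vx q S Y N := by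
  obtain ⟨n1, n2, n3, n4⟩ := hN
  have hq3 := c.hq3
  refine ⟨n1, n2.trans hWY, n3, ?_⟩
  have hex : ∀ o : Submodule K V, ∃ A : Submodule K V, o ∈ S → o ≤ E →
     (finrank K A = 3 ∧ o ≤ A ∧ A ≤ Y ∧ s S A = q ^ 2 ∧
      Dq q S o Y = pen o A ∧ ∀ Z ∈ S, Z ≤ A → Dq q S Z Y = pen Z A) := by
    intro o
    by_cases ho : o ∈ S ∧ o ≤ E
    · obtain ⟨A, hA⟩ := c.plane ho.1 (ho.2.trans (hEW.trans hWY))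
      exact ⟨A, fun _ _ => hA⟩
    · exact ⟨⊥, fun h1 h2 => absurd ⟨h1, h2⟩ ho⟩
  choose A hA using hex
  have hNA : ∀ o ∈ S, o ≤ E → N ≤ A o := by
    intro o ho hoE
    obtain ⟨a1, a2, a3, a4, a5, a6⟩ := hA o ho hoE
    have hne : o ≠ N := fun h => n3 (h ▸ ho)
    have : o ⊔ N ∈ Dq q S o Y := mem_filter.2 ⟨line_mem_pen (c.hS o ho)
      (rank_line (c.hS o ho) n1 hne) le_sup_left
      (sup_le (hoE.trans (hEW.trans hWY)) (n2.trans hWY)), n4 o ho (hoE.trans hEW)⟩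
    rw [a5] at this
    exact le_sup_right.trans (mem_pen.1 this).2.1
  have hdis : ∀ o ∈ S.filter (fun P => P ≤ E), ∀ o' ∈ S.filter (fun P => P ≤ E), o ≠ o' →
      Disjoint (S.filter (fun P => P ≤ A o)) (S.filter (fun P => P ≤ A o')) := by
    intro o ho o' ho' hne
    obtain ⟨ho, hoE⟩ := mem_filter.1 ho
    obtain ⟨ho', hoE'⟩ := mem_filter.1 ho'
    rw [Finset.disjoint_left]
    intro Z hZ hZ'
    obtain ⟨hZ, hZA⟩ := mem_filter.1 hZ
    obtain ⟨_, hZA'⟩ := mem_filter.1 hZ'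
    obtain ⟨a1, a2, a3, a4, a5, a6⟩ := hA o ho hoE
    obtain ⟨b1, b2, b3, b4, b5, b6⟩ := hA o' ho' hoE'
    have h1 : pen Z (A o') = pen Z (A o) := by rw [← a6 Z hZ hZA, ← b6 Z hZ hZA']
    have h2 : A o' ≤ A o := pen_le (c.hS Z hZ) hZA' hZA h1.le
    have h3 : o ⊔ o' ∈ pen o (A o) := line_mem_pen (c.hS o ho)
      (rank_line (c.hS o ho) (c.hS o' ho') hne) le_sup_left (sup_le a2 (b2.trans h2))
    rw [← a5] at h3
    have h4 := (mem_filter.1 h3).2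
    have h5 := hyp_lines c.hq c.hS hE3 (c.hE.mono (hEW.trans hWY)) hEs (sup_le hoE hoE')
      (rank_line (c.hS o ho) (c.hS o' ho') hne)
    omega
  have hcov : (S.filter (fun P => P ≤ E)).biUnion (fun o => S.filter (fun P => P ≤ A o)) =
      S.filter (fun P => P ≤ Y) := by
    apply eq_of_subset_of_card_le
    · intro Z hZ
      obtain ⟨o, ho, hZ⟩ := mem_biUnion.1 hZ
      obtain ⟨ho, hoE⟩ := mem_filter.1 ho
      obtain ⟨hZ, hZA⟩ := mem_filter.1 hZ
      exact mem_filter.2 ⟨hZ, hZA.trans (hA o ho hoE).2.2.1⟩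
    · rw [card_biUnion hdis, sum_const_nat (m := q ^ 2)]
      · have h1 : (S.filter (fun P => P ≤ E)).card = q + 2 := hEs
        have h2 : (S.filter (fun P => P ≤ Y)).card = (q + 2) * q ^ 2 := c.hs
        rw [h1, h2]
      · intro o ho
        obtain ⟨ho, hoE⟩ := mem_filter.1 ho
        exact (hA o ho hoE).2.2.2.1
  intro Q hQ hQY
  have h1 : Q ∈ S.filter (fun P => P ≤ Y) := mem_filter.2 ⟨hQ, hQY⟩
  rw [← hcov] at h1
  obtain ⟨o, ho, hZ⟩ := mem_biUnion.1 h1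
  obtain ⟨ho, hoE⟩ := mem_filter.1 ho
  obtain ⟨hZ, hZA⟩ := mem_filter.1 hZ
  obtain ⟨a1, a2, a3, a4, a5, a6⟩ := hA o ho hoE
  have h2 : Q ⊔ N ∈ pen Q (A o) := line_mem_pen (c.hS Q hQ)
    (rank_line (c.hS Q hQ) n1 (fun h => n3 (h ▸ hQ))) le_sup_left (sup_le hZA (hNA o ho hoE))
  rw [← a6 Q hQ hZA] at h2
  exact (mem_filter.1 h2).2

theorem span_smul {c : K} (hc : c ≠ 0) (x : V) : span K {c • x} = span K {x} :=
  span_singleton_smul_eq (IsUnit.mk0 c hc) x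

/-- the translations preserving `S` -/
def rad (S : Finset (Submodule K V)) (X : Submodule K V) : Submodule K V where
  carrier := {v | v ∈ X ∧ ∀ x ∈ X, span K {x + v} ∈ S ↔ span K {x} ∈ S}
  zero_mem' := ⟨X.zero_mem, fun x _ => by rw [add_zero]⟩
  add_mem' := by
    rintro a b ⟨ha, ha2⟩ ⟨hb, hb2⟩
    refine ⟨X.add_mem ha hb, fun x hx => ?_⟩
    rw [← add_assoc, hb2 _ (X.add_mem hx ha), ha2 x hx]
  smul_mem' := by
    rintro c v ⟨hv, hv2⟩
    refine ⟨X.smul_mem c hv, fun x hx => ?_⟩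
    by_cases hc : c = 0
    · simp [hc]
    · rw [← span_smul (inv_ne_zero hc) (x + c • v), smul_add, inv_smul_smul₀ hc,
        hv2 _ (X.smul_mem _ hx), span_smul (inv_ne_zero hc)]

theorem mem_rad {v : V} : v ∈ rad S X ↔
    v ∈ X ∧ ∀ x ∈ X, span K {x + v} ∈ S ↔ span K {x} ∈ S := Iff.rfl

theorem Vx.trans1 (hq : Nat.card K = q) (hS : IsPts S) {N : Submodule K V} (hN : Vx q S X N)
    {v x : V} (hv : v ∈ N) (hx : x ∈ X) (h : span K {x} ∈ S) : span K {x + v} ∈ S := by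
  obtain ⟨n1, n2, n3, n4⟩ := hN
  have hQ1 := hS _ h
  have hs := n4 _ h (span_le_iff.2 hx)
  have hne : span K {x} ≠ N := fun e => n3 (e ▸ h)
  by_contra hcon
  have hxN : x ∉ N := fun hxN => hne (pt_eq hQ1 n1 (span_le_iff.2 hxN))
  have hxv : x + v ∉ N := fun hh => hxN (by simpa using N.sub_mem hh hv)
  have h0 : x + v ≠ 0 := fun hh => hxv (hh ▸ N.zero_mem)
  have h1 : (S.filter (fun P => P ≤ span K {x} ⊔ N) ∪ {span K {x + v}, N}).card ≤
      (ptsOf (span K {x} ⊔ N)).card := by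
    apply card_le_card
    intro Y hY
    simp only [mem_union, mem_filter, mem_insert, mem_singleton] at hY
    rw [mem_ptsOf]
    rcases hY with h | rfl | rfl
    · exact ⟨hS Y h.1, h.2⟩
    · exact ⟨rank_span h0, span_le_iff.2 (Submodule.add_mem _
        (mem_sup_left (mem_span_singleton_self x)) (mem_sup_right hv))⟩
    · exact ⟨n1, le_sup_right⟩
  rw [card_union_of_disjoint, card_pair, card_ptsOf hq, rank_line hQ1 n1 hne, th_two] at h1
  · have : (S.filter (fun P => P ≤ span K {x} ⊔ N)).card = q := hs
    omega
  · rintro e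
    exact hxv (e ▸ mem_span_singleton_self _)
  · rw [Finset.disjoint_right]
    intro Y hY
    simp only [mem_insert, mem_singleton] at hY
    rcases hY with rfl | rfl <;> simp [*]

theorem Vx.trans (hq : Nat.card K = q) (hS : IsPts S) {N : Submodule K V} (hN : Vx q S X N)
    {v x : V} (hv : v ∈ N) (hx : x ∈ X) : span K {x + v} ∈ S ↔ span K {x} ∈ S := by
  constructor
  · intro h
    have := hN.trans1 hq hS (N.neg_mem hv) (X.add_mem hx (hN.2.1 hv)) h
    simpa using this
  · exact hN.trans1 hq hS hv hx

theorem even_rad (hq48 : q = 4 ∨ q = 8) (hq : Nat.card K = q) (hS : IsPts S) {e : ℕ}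
    {P : Submodule K V}
    (hX : finrank K X = e + 3) (hE : Ev S 2 X) (hP : P ∈ S) (hPX : P ≤ X)
    (hs : s S X = (q + 2) * q ^ e) : e ≤ finrank K (rad S X) := by
  obtain ⟨E, e1, e2, e3, e4, e5⟩ := (even_min hq48 hq hS hX hE hP hPX).2 hs
  have h : ∀ W ∈ pen E X, W ≤ E ⊔ rad S X := by
    intro W hW
    obtain ⟨w1, w2, w3⟩ := mem_pen.1 hW
    obtain ⟨N, hN⟩ : ∃ N, Vx q S W N := (base4 hq48 hq hS (by omega) (hE.mono w2) hP
      (e2.trans w1)).2 (e5 W hW)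
    have hNr : N ≤ rad S X := by
      intro v hv
      refine ⟨w2 (hN.2.1 hv), fun x hx => ?_⟩
      by_cases hxW : x ∈ W
      · exact hN.trans hq hS hv hxW
      · have hx0 : x ≠ 0 := fun h => hxW (h ▸ W.zero_mem)
        have hY : finrank K ↥(W ⊔ span K {x}) = 5 := by
          rw [rank_sup_pt (rank_span hx0) (by rwa [span_le_iff])]; omega
        have hYX : W ⊔ span K {x} ≤ X := sup_le w2 (span_le_iff.2 hx)
        have c : D5 q S (W ⊔ span K {x}) := ⟨hq48, hq, hS, hY, hE.mono hYX,
          s_of_pencil hq hS (e := 2) hY e1 (w1.trans le_sup_left) e4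
            (fun W hW => e5 W (pen_sub hYX hW))⟩
        exact (c.vertex e1 w1 le_sup_left e4 hN).trans hq hS hv
          (mem_sup_right (mem_span_singleton_self x))
    have hNE : ¬ N ≤ E := by
      intro hNE
      obtain ⟨n1, n2, n3, n4⟩ := hN
      have h1 := hyp_lines hq hS e1 (hE.mono e3) e4 (sup_le e2 hNE)
        (rank_line (hS P hP) n1 (fun h => n3 (h ▸ hP)))
      rw [n4 P hP (e2.trans w1)] at h1
      rcases hq48 with h | h <;> omega
    rw [← sup_eq_of_mem_pen hN.1 hNE hW hN.2.1]
    exact sup_le_sup_left hNr _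
  have h2 : X ≤ E ⊔ rad S X := by
    by_contra hh
    obtain ⟨R, r1, r2, r3⟩ := exists_pt_not_le hh
    have hRE : ¬ R ≤ E := fun h => r3 (h.trans le_sup_left)
    exact r3 (le_sup_right.trans (h _ (sup_mem_pen e3 r1 r2 hRE)))
  have h3 := rank_mono h2
  have h4 := rank_sup_inf E (rad S X)
  omega
end HC

open Submodule
set_option linter.unusedSectionVars false
set_option linter.unusedVariables false
namespace HC
open scoped Classical
open Finset Module
variable {K V : Type*} [Field K] [Finite K] [AddCommGroup V] [Module K V] [Finite V]

/-- relative complement -/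
theorem exists_compl {A X : Submodule K V} (h : A ≤ X) : ∃ C : Submodule K V, C ≤ X ∧ C ⊓ A = ⊥ ∧ A ⊔ C = X := by
  obtain ⟨C, hC⟩ := Submodule.exists_isCompl A
  refine ⟨C ⊓ X, inf_le_right, ?_, ?_⟩
  · rw [inf_right_comm, inf_comm C A, hC.inf_eq_bot, bot_inf_eq]
  · rw [← sup_inf_assoc_of_le C h, hC.sup_eq_top, top_inf_eq]

theorem rank_inf_bot {A B : Submodule K V} (h : A ⊓ B = ⊥) : finrank K ↥(A ⊔ B) = finrank K A + finrank K B := by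
  have := rank_sup_inf A B
  rw [h, finrank_bot] at this; omega

/-- projection of `S` from the point `R` to `H` modulo two -/
noncomputable def prj (S : Finset (Submodule K V)) (R H : Submodule K V) : Finset (Submodule K V) :=
  univ.filter (fun P => finrank K P = 1 ∧ P ≤ H ∧ Odd (s S (P ⊔ R)))

theorem mem_prj {S : Finset (Submodule K V)} {R H P : Submodule K V} :
    P ∈ prj S R H ↔ finrank K P = 1 ∧ P ≤ H ∧ Odd (s S (P ⊔ R)) := by simp [prj]

theorem prj_pts (S : Finset (Submodule K V)) (R H : Submodule K V) : IsPts (prj S R H) :=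
  fun P hP => (mem_prj.1 hP).1

theorem pt_not_le {R H : Submodule K V} (hR : finrank K R = 1) (hRH : R ⊓ H = ⊥) : ¬ R ≤ H := by
  intro h
  rw [inf_eq_left.2 h] at hRH
  rw [hRH, finrank_bot] at hR; omega

theorem sup_inf_prj {R H W : Submodule K V} (hRH : R ⊓ H = ⊥) (hW : W ≤ H) : (W ⊔ R) ⊓ H = W := by
  rw [sup_inf_assoc_of_le R hW, hRH, sup_bot_eq]

theorem prj_count {S : Finset (Submodule K V)} (hS : IsPts S) {R H W : Submodule K V}
    (hR : finrank K R = 1) (hRS : R ∉ S) (hRH : R ⊓ H = ⊥) (hW : W ≤ H) :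
    s S (W ⊔ R) = ∑ P ∈ ptsOf W, s S (P ⊔ R) := by
  rw [pencil_off hS (le_sup_right : R ≤ W ⊔ R) (s_pt_not_mem hS hR hRS)]
  symm
  have hRn := pt_not_le hR hRH
  apply sum_bij (fun P _ => P ⊔ R)
  · intro P hP
    obtain ⟨h1, h2⟩ := mem_ptsOf.1 hP
    rw [mem_pen, hR]
    refine ⟨le_sup_right, sup_le_sup_right h2 R, ?_⟩
    rw [rank_sup_pt hR, h1]
    intro h; exact hRn (h.trans (h2.trans hW))
  · intro P hP Q hQ h
    obtain ⟨h1, h2⟩ := mem_ptsOf.1 hP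
    obtain ⟨h3, h4⟩ := mem_ptsOf.1 hQ
    rw [← sup_inf_prj hRH (h2.trans hW), ← sup_inf_prj hRH (h4.trans hW)]
    exact congrArg (· ⊓ H) h
  · intro L hL
    obtain ⟨h1, h2, h3⟩ := mem_pen.1 hL
    have hsup : L ⊓ W ⊔ R = L := by
      rw [inf_comm, sup_comm, ← sup_inf_assoc_of_le W h1, sup_comm, inf_eq_right.2 h2]
    refine ⟨L ⊓ W, mem_ptsOf.2 ⟨?_, inf_le_right⟩, hsup⟩
    have := rank_sup_pt (U := L ⊓ W) hR (fun h => hRn (h.trans (inf_le_right.trans hW)))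
    rw [hsup] at this; omega
  · intros; rfl

theorem s_prj {S : Finset (Submodule K V)} {R H W : Submodule K V} (hW : W ≤ H) :
    s (prj S R H) W = ((ptsOf W).filter (fun P => Odd (s S (P ⊔ R)))).card := by
  unfold s
  congr 1
  ext P
  rw [mem_filter, mem_filter, mem_prj, mem_ptsOf]
  constructor
  · rintro ⟨⟨a, b, c⟩, d⟩; exact ⟨⟨a, d⟩, c⟩
  · rintro ⟨⟨a, b⟩, c⟩; exact ⟨⟨a, b.trans hW, c⟩, b⟩

theorem prj_le {S : Finset (Submodule K V)} (hS : IsPts S) {R H W : Submodule K V}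
    (hR : finrank K R = 1) (hRS : R ∉ S) (hRH : R ⊓ H = ⊥) (hW : W ≤ H) :
    s (prj S R H) W ≤ s S (W ⊔ R) := by
  rw [prj_count hS hR hRS hRH hW, s_prj hW, card_filter]
  apply sum_le_sum
  intro P _
  split_ifs with h
  · exact h.pos
  · exact Nat.zero_le _

theorem prj_parity {S : Finset (Submodule K V)} (hS : IsPts S) {R H W : Submodule K V}
    (hR : finrank K R = 1) (hRS : R ∉ S) (hRH : R ⊓ H = ⊥) (hW : W ≤ H) :
    Even (s (prj S R H) W) ↔ Even (s S (W ⊔ R)) := by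
  rw [prj_count hS hR hRS hRH hW, s_prj hW, Finset.even_sum_iff_even_card_odd]

theorem prj_eq {S : Finset (Submodule K V)} (hS : IsPts S) {R H W P : Submodule K V}
    (hR : finrank K R = 1) (hRS : R ∉ S) (hRH : R ⊓ H = ⊥) (hW : W ≤ H)
    (h : s (prj S R H) W = s S (W ⊔ R)) (hP : finrank K P = 1) (hPW : P ≤ W) : s S (P ⊔ R) ≤ 1 := by
  rw [prj_count hS hR hRS hRH hW, s_prj hW, card_filter] at h
  have := (sum_eq_sum_iff_of_le (fun P _ => by
    split_ifs with h
    · exact h.pos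
    · exact Nat.zero_le _)).1 h P (mem_ptsOf.2 ⟨hP, hPW⟩)
  rw [← this]; split_ifs <;> simp

theorem prj_ev {S : Finset (Submodule K V)} (hS : IsPts S) {R H X : Submodule K V} {r : ℕ}
    (hR : finrank K R = 1) (hRS : R ∉ S) (hRH : R ⊓ H = ⊥) (hX : H ⊔ R = X) (hE : Ev S (r+1) X) :
    Ev (prj S R H) r H := by
  intro W hW hr
  rw [prj_parity hS hR hRS hRH hW]
  apply hE _ (hX ▸ sup_le_sup_right hW R)
  rw [rank_sup_pt hR (fun h => pt_not_le hR hRH (h.trans hW)), hr]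

theorem exists_hyper {R X : Submodule K V} (hR : finrank K R = 1) (hRX : R ≤ X) :
    ∃ H : Submodule K V, R ⊓ H = ⊥ ∧ H ⊔ R = X ∧ finrank K X = finrank K H + 1 := by
  obtain ⟨C, h1, h2, h3⟩ := exists_compl hRX
  refine ⟨C, by rw [inf_comm]; exact h2, by rw [sup_comm]; exact h3, ?_⟩
  rw [← h3, rank_inf_bot (by rw [inf_comm]; exact h2), hR]; omega

/-- a line through `R` and an element of `X` in terms of the projection -/
theorem line_prj {R H X L : Submodule K V} (hR : finrank K R = 1) (hRH : R ⊓ H = ⊥)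
    (hX : H ⊔ R = X) (hL : L ∈ pen R X) :
    ∃ P : Submodule K V, finrank K P = 1 ∧ P ≤ H ∧ P ⊔ R = L := by
  obtain ⟨h1, h2, h3⟩ := mem_pen.1 hL
  have hsup : L ⊓ H ⊔ R = L := by
    rw [inf_comm, sup_comm, ← sup_inf_assoc_of_le H h1, sup_comm, hX, inf_eq_right.2 h2]
  refine ⟨L ⊓ H, ?_, inf_le_right, hsup⟩
  have := rank_sup_pt (U := L ⊓ H) hR (fun h => pt_not_le hR hRH (h.trans inf_le_right))
  rw [hsup] at this; omega

/-- all lines through `R` are even -/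
def Good (S : Finset (Submodule K V)) (X R : Submodule K V) : Prop := ∀ L ∈ pen R X, Even (s S L)
/-- all lines through `R` have at most one point -/
def Bad (S : Finset (Submodule K V)) (X R : Submodule K V) : Prop := ∀ L ∈ pen R X, s S L ≤ 1

theorem th_ge (q e : ℕ) : q ^ e ≤ th q (e+1) := by rw [th_succ]; omega

theorem th_mono {q a b : ℕ} (h : a ≤ b) : th q a ≤ th q b :=
  sum_le_sum_of_subset (range_mono h)

/-- all points off `S` are good, and there is a full line -/
theorem all_good_full {q e r : ℕ} (hq4 : 4 ≤ q) (hev : Even q) (hq : Nat.card K = q)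
    {S : Finset (Submodule K V)} (hS : IsPts S)
    {X L : Submodule K V} (hX : finrank K X = e + 1 + r) (hE : Ev S r X)
    (hr : 1 ≤ r)
    (hg : ∀ R : Submodule K V, finrank K R = 1 → R ≤ X → R ∉ S → Good S X R)
    (hLX : L ≤ X) (hL : finrank K L = 2) (hLf : q < s S L) : (q+2) * q^e < s S X := by
  -- maximal full subspace
  have hfin : {M : Submodule K V | L ≤ M ∧ M ≤ X ∧ ptsOf M ⊆ S}.Finite := Set.toFinite _
  have hLfull : ptsOf L ⊆ S := by
    intro P hP
    by_contra hPS
    have h1 := card_ptsOf hq L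
    rw [hL, th_two] at h1
    have : (S.filter (fun P => P ≤ L)) ⊆ (ptsOf L).erase P := by
      intro Q hQ
      rw [mem_filter] at hQ
      rw [mem_erase]
      exact ⟨fun h => hPS (h ▸ hQ.1), mem_ptsOf.2 ⟨hS Q hQ.1, hQ.2⟩⟩
    have h2 := card_le_card this
    rw [card_erase_of_mem hP] at h2
    unfold s at hLf
    omega
  obtain ⟨M, hM⟩ := hfin.exists_maximal ⟨L, le_refl _, hLX, hLfull⟩
  obtain ⟨⟨hLM, hMX, hMS⟩, hmax⟩ := hM
  have hj2 : 2 ≤ finrank K M := hL ▸ rank_mono hLM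
  have hjr : finrank K M < r := by
    by_contra hcon
    obtain ⟨Z, -, hZM, hZ⟩ := exists_between (bot_le : (⊥ : Submodule K V) ≤ M) r (by simp) (by omega)
    have h1 := hE Z (hZM.trans hMX) hZ
    have h2 : s S Z = th q r := by
      rw [← hZ, ← card_ptsOf hq]
      unfold s
      congr 1
      ext P
      rw [mem_filter, mem_ptsOf]
      exact ⟨fun h => ⟨hS P h.1, h.2⟩, fun h => ⟨hMS (mem_ptsOf.2 ⟨h.1, h.2.trans hZM⟩), h.2⟩⟩
    rw [h2] at h1
    obtain ⟨r', rfl⟩ : ∃ r', r = r' + 1 := ⟨r - 1, by omega⟩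
    exact (Nat.not_even_iff_odd.2 (th_odd hev r')) h1
  have hW : ∀ W ∈ pen M X, q + 1 ≤ dd S M W := by
    intro W hW
    obtain ⟨h1, h2, h3⟩ := mem_pen.1 hW
    have : ∃ R : Submodule K V, finrank K R = 1 ∧ R ≤ W ∧ R ∉ S := by
      by_contra hcon
      push Not at hcon
      have := rank_mono (hmax ⟨hLM.trans h1, h2, fun P hP => hcon P (mem_ptsOf.1 hP).1 (mem_ptsOf.1 hP).2⟩ h1)
      omega
    obtain ⟨R, hR, hRW, hRS⟩ := this
    have hRM : ¬ R ≤ M := fun h => hRS (hMS (mem_ptsOf.2 ⟨hR, h⟩))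
    have hne : ∀ P ∈ ptsOf M, ∃ Q ∈ S, Q ≤ P ⊔ R ∧ ¬ Q ≤ P := by
      intro P hP
      obtain ⟨hP1, hPM⟩ := mem_ptsOf.1 hP
      apply exists_of_lt_s
      rw [s_pt_mem hS (hMS hP)]
      have hPR : P ≠ R := fun h => hRM (h ▸ hPM)
      have := hg R hR (hRW.trans h2) hRS (P ⊔ R) (mem_pen.2 ⟨le_sup_right,
        sup_le (hPM.trans hMX) (hRW.trans h2), by rw [rank_line hP1 hR hPR, hR]⟩)
      have h5 : 0 < s S (P ⊔ R) := s_pos_iff.2 ⟨P, hMS hP, le_sup_left⟩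
      obtain ⟨t, ht⟩ := this
      omega
    choose! f hf1 hf2 hf3 using hne
    have hkey : ∀ P ∈ ptsOf M, P ⊔ R = f P ⊔ R ∧ ¬ f P ≤ M := by
      intro P hP
      obtain ⟨hP1, hPM⟩ := mem_ptsOf.1 hP
      have hPR : P ≠ R := fun h => hRM (h ▸ hPM)
      have hfR : f P ≠ R := fun h => hRS (h ▸ hf1 P hP)
      have hlin := rank_line hP1 hR hPR
      refine ⟨(line_eq (hS _ (hf1 P hP)) hR hfR hlin (hf2 P hP) le_sup_right).symm, ?_⟩
      intro h
      have h6 := line_eq hP1 (hS _ (hf1 P hP)) (fun h => hf3 P hP h.symm.le) hlin le_sup_left (hf2 P hP)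
      exact hRM (le_sup_right.trans (h6.symm.le.trans (sup_le hPM h)))
    have hinj : Set.InjOn f (ptsOf M : Set (Submodule K V)) := by
      intro P hP Q hQ h
      have hP' := mem_coe.1 hP
      have hQ' := mem_coe.1 hQ
      obtain ⟨hP1, hPM⟩ := mem_ptsOf.1 hP'
      obtain ⟨hQ1, hQM⟩ := mem_ptsOf.1 hQ'
      by_contra hne
      have hPR : P ≠ R := fun h => hRM (h ▸ hPM)
      have e1 : P ⊔ R = Q ⊔ R := by rw [(hkey P hP').1, (hkey Q hQ').1, h]
      have := line_eq hP1 hQ1 hne (rank_line hP1 hR hPR) le_sup_left (e1 ▸ le_sup_left)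
      exact hRM (le_sup_right.trans (this.symm.le.trans (sup_le hPM hQM)))
    have h7 : (ptsOf M).card ≤ dd S M W := by
      rw [← card_image_of_injOn hinj]
      apply card_le_card
      intro Q hQ
      obtain ⟨P, hP, rfl⟩ := mem_image.1 hQ
      rw [mem_filter]
      exact ⟨hf1 P hP, (hf2 P hP).trans (sup_le ((mem_ptsOf.1 hP).2.trans h1) hRW), (hkey P hP).2⟩
    rw [card_ptsOf hq] at h7
    calc q + 1 = th q 2 := (th_two q).symm
      _ ≤ _ := th_mono hj2
      _ ≤ _ := h7
  have h8 : (pen M X).card * (q+1) ≤ dd S M X := by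
    rw [pencil hS hMX, ← smul_eq_mul]
    exact card_nsmul_le_sum _ _ _ hW
  rw [card_pen hq hMX] at h8
  have h9 : q ^ (e+1) ≤ th q (finrank K X - finrank K M) :=
    (th_ge q (e+1)).trans (th_mono (by omega))
  have h10 := s_eq S hMX
  have h11 : q ^ (e+1) * (q+1) ≤ s S X := by nlinarith
  have h12 : 0 < q ^ e := by positivity
  have : (q+2) * q^e < q ^ (e+1) * (q+1) := by
    rw [pow_succ, mul_assoc, mul_comm]
    exact Nat.mul_lt_mul_of_pos_left (by nlinarith) h12
  omega

theorem prj_dich {q e r : ℕ} (hq : Nat.card K = q)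
    {S : Finset (Submodule K V)} (hS : IsPts S)
    {X R : Submodule K V} (hR : finrank K R = 1) (hRX : R ≤ X) (hRS : R ∉ S)
    {H : Submodule K V} (h1 : R ⊓ H = ⊥) (h2 : H ⊔ R = X) (he : prj S R H = ∅) : Good S X R := by
  intro L hL
  obtain ⟨P, hP, hPH, hPL⟩ := line_prj hR h1 h2 hL
  rw [← Nat.not_odd_iff_even]
  intro ho
  have : P ∈ prj S R H := mem_prj.2 ⟨hP, hPH, hPL ▸ ho⟩
  rw [he] at this; simp at this

theorem prj_bad {S : Finset (Submodule K V)} (hS : IsPts S) {R H X W : Submodule K V}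
    (hR : finrank K R = 1) (hRS : R ∉ S) (hRH : R ⊓ H = ⊥) (hX : H ⊔ R = X) (hb : Bad S X R) (hW : W ≤ H) :
    s (prj S R H) W = s S (W ⊔ R) := by
  rw [prj_count hS hR hRS hRH hW, s_prj hW, card_filter]
  apply sum_congr rfl
  intro P hP
  obtain ⟨hP1, hPW⟩ := mem_ptsOf.1 hP
  have := hb (P ⊔ R) (mem_pen.2 ⟨le_sup_right, hX ▸ sup_le_sup_right (hPW.trans hW) R, by
    rw [rank_sup_pt hR (fun h => pt_not_le hR hRH (h.trans (hPW.trans hW))), hP1, hR]⟩)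
  interval_cases s S (P ⊔ R) <;> simp

theorem contain1 {q : ℕ} (hq48 : q = 4 ∨ q = 8) (hq : Nat.card K = q) (e : ℕ) (r : ℕ) (hr : 2 ≤ r) :
    ∀ (S : Finset (Submodule K V)) (hS : IsPts S)
    (X : Submodule K V) (hX : finrank K X = e + 1 + r) (hE : Ev S r X) (P : Submodule K V)
    (hP : P ∈ S) (hPX : P ≤ X), (q+2) * q^e ≤ s S X ∧ (s S X = (q+2)*q^e →
      (∀ L ≤ X, finrank K L = 2 → s S L ≤ q) ∧
      (∀ R ≤ X, finrank K R = 1 → R ∉ S → Good S X R ∨ Bad S X R)) := by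
  have hq4 : 4 ≤ q := by omega
  have hev : Even q := by rcases hq48 with rfl | rfl <;> decide
  induction r, hr using Nat.le_induction with
  | base =>
    intro S hS X hX hE P hP hPX
    refine ⟨(even_min hq48 hq hS (by omega) hE hP hPX).1, fun _ => ⟨?_, ?_⟩⟩
    · intro L hL hL2
      have := s_le_th hq hS L
      rw [hL2, th_two] at this
      obtain ⟨t, ht⟩ := hE L hL hL2
      obtain ⟨u, hu⟩ := hev
      omega
    · intro R hR hR1 hRS
      left
      intro L hL
      exact hE L (mem_pen.1 hL).2.1 (rank_of_mem_pen_pt hR1 hL)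
  | succ r hr ih =>
    intro S hS X hX hE P hP hPX
    have hdich : ∀ R : Submodule K V, finrank K R = 1 → R ≤ X → R ∉ S → Good S X R ∨
        ((q+2) * q^e ≤ s S X ∧ (s S X = (q+2)*q^e → 
          (∀ L ≤ X, finrank K L = 2 → s S L ≤ q) ∧ Bad S X R)) := by
      intro R hR hRX hRS
      obtain ⟨H, h1, h2, h3⟩ := exists_hyper hR hRX
      rcases (prj S R H).eq_empty_or_nonempty with he | ⟨Q, hQ⟩
      · left; exact prj_dich (e := e) (r := r) hq hS hR hRX hRS h1 h2 he
      · right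
        have hle := prj_le hS hR hRS h1 (le_refl H)
        rw [h2] at hle
        obtain ⟨i1, i2⟩ := ih (prj S R H) (prj_pts S R H) H (by omega) (prj_ev hS hR hRS h1 h2 hE) Q hQ
          (mem_prj.1 hQ).2.1
        refine ⟨i1.trans hle, fun heq => ?_⟩
        have heq2 : s (prj S R H) H = s S X := by omega
        have hbad : Bad S X R := by
          intro L hL
          obtain ⟨P, hP, hPH, hPL⟩ := line_prj hR h1 h2 hL
          rw [← hPL]
          exact prj_eq hS hR hRS h1 (le_refl H) (by rw [h2]; exact heq2) hP hPH
        refine ⟨?_, hbad⟩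
        intro L hLX hL2
        by_cases hRL : R ≤ L
        · have := hbad L (mem_pen.2 ⟨hRL, hLX, by omega⟩)
          omega
        · have hRX' : L ⊔ R ≤ X := sup_le hLX hRX
          have hsup : (L ⊔ R) ⊓ H ⊔ R = L ⊔ R := by
            rw [inf_comm, sup_comm, ← sup_inf_assoc_of_le H (le_sup_right : R ≤ L ⊔ R), sup_comm R H, h2,
              inf_eq_right.2 hRX']
          have hr3 := rank_sup_pt hR hRL
          have hr4 := rank_sup_pt (U := (L ⊔ R) ⊓ H) hR (fun h => pt_not_le hR h1 (h.trans inf_le_right))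
          rw [hsup] at hr4
          have i3 := (i2 (by omega)).1 ((L ⊔ R) ⊓ H) inf_le_right (by omega)
          have i4 := prj_bad hS hR hRS h1 h2 hbad (W := (L ⊔ R) ⊓ H) inf_le_right
          rw [hsup] at i4
          have := s_mono (S := S) (le_sup_left : L ≤ L ⊔ R)
          omega
    by_cases hall : ∀ R : Submodule K V, finrank K R = 1 → R ≤ X → R ∉ S → Good S X R
    · have hlt : (q+2) * q^e < s S X := by
        by_cases hfull : ∃ L ≤ X, finrank K L = 2 ∧ q < s S L
        · obtain ⟨L, hLX, hL2, hLf⟩ := hfull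
          exact all_good_full hq4 hev hq hS (by omega) hE (by omega) hall hLX hL2 hLf
        · push Not at hfull
          have hE2 : Ev S 2 X := by
            intro L hL hL2
            obtain ⟨R, hR1, hRL, hRS⟩ := exists_not_mem hq hS (W := L)
              (by rw [hL2, th_two]; have := hfull L hL hL2; omega)
            exact hall R hR1 (hRL.trans hL) hRS L (mem_pen.2 ⟨hRL, hL, by omega⟩)
          have h5 := (even_min hq48 hq hS (e := e + (r-1)) (by omega) hE2 hP hPX).1
          have h6 : q ^ e < q ^ (e + (r-1)) := Nat.pow_lt_pow_right (by omega) (by omega)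
          have h7 : (q+2) * q^e < (q+2) * q ^ (e + (r-1)) := Nat.mul_lt_mul_of_pos_left h6 (by omega)
          omega
      exact ⟨hlt.le, fun h => by omega⟩
    · push Not at hall
      obtain ⟨R, hR, hRX, hRS, hng⟩ := hall
      obtain ⟨j1, j2⟩ := (hdich R hR hRX hRS).resolve_left hng
      refine ⟨j1, fun heq => ⟨(j2 heq).1, ?_⟩⟩
      intro R' hR' hR1' hRS'
      rcases hdich R' hR1' hR' hRS' with h | h
      · exact Or.inl h
      · exact Or.inr (h.2 heq).2

theorem dim_ge {r N : ℕ} {S : Finset (Submodule K V)} (hS : IsPts S) {X A P : Submodule K V}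
    (hE : Ev S r X) (hr : 1 ≤ r) (hAX : A ≤ X) (hA : ∀ Q ∈ S, Q ≤ X → Q ≤ A) (hP : P ∈ S) (hPA : P ≤ A) :
    finrank K X + 2 ≤ finrank K A + r := by
  by_contra hcon
  obtain ⟨C, h1, h2, h3⟩ := exists_compl hAX
  have h4 := rank_inf_bot (show A ⊓ C = ⊥ by rw [inf_comm]; exact h2)
  rw [h3] at h4
  obtain ⟨C', -, h5, h6⟩ := exists_between (bot_le : (⊥ : Submodule K V) ≤ C) (r-1) (by simp) (by omega)
  have hZA : (P ⊔ C') ⊓ A = P := by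
    rw [sup_inf_assoc_of_le C' hPA]
    have : C' ⊓ A = ⊥ := le_bot_iff.1 ((inf_le_inf_right A h5).trans h2.le)
    rw [this, sup_bot_eq]
  have hPC : P ⊓ C' = ⊥ := by
    rw [inf_comm]; exact le_bot_iff.1 ((inf_le_inf h5 hPA).trans h2.le)
  have h7 := rank_inf_bot hPC
  rw [hS P hP, h6] at h7
  have hZX : P ⊔ C' ≤ X := sup_le (hPA.trans hAX) (h5.trans h1)
  have h8 := hE _ hZX (by omega)
  have h9 : s S (P ⊔ C') = s S P := by
    unfold s
    congr 1
    ext Q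
    rw [mem_filter, mem_filter]
    constructor
    · rintro ⟨a, b⟩
      exact ⟨a, hZA ▸ le_inf b (hA Q a (b.trans hZX))⟩
    · rintro ⟨a, b⟩
      exact ⟨a, b.trans le_sup_left⟩
  rw [h9, s_pt_mem hS hP] at h8
  exact absurd h8 (by decide)

theorem extend {q : ℕ} (hq : Nat.card K = q) {S : Finset (Submodule K V)} (hS : IsPts S)
    {X A P0 X0 : Submodule K V}
    (hsec : ∀ L ≤ X, finrank K L = 2 → 2 ≤ s S L → Even (s S L))
    (hgb : ∀ R ≤ X, finrank K R = 1 → R ∉ S → Good S X R ∨ Bad S X R)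
    (hAX : A ≤ X) (hE : Ev S 2 A) (hA2 : 2 ≤ finrank K A) (hP : P0 ∈ S) (hPA : P0 ≤ A)
    (hX0 : X0 ∈ S) (hX0X : X0 ≤ X) (hX0A : ¬ X0 ≤ A) : Ev S 2 (A ⊔ X0) := by
  have hX1 := hS X0 hX0
  have hP1 := hS P0 hP
  have hWX : A ⊔ X0 ≤ X := sup_le hAX hX0X
  have hWr := rank_sup_pt hX1 hX0A
  have hlines : ∀ m ∈ pen X0 (A ⊔ X0), 2 ≤ s S m := by
    intro m hm
    obtain ⟨m1, m2, m3⟩ := mem_pen.1 hm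
    have hev : Even (s S m) := by
      -- meet with A
      have hmA : ¬ m ≤ A := fun h => hX0A (m1.trans h)
      have hsup : A ⊔ m = A ⊔ X0 := by
        apply le_antisymm (sup_le le_sup_left m2)
        exact sup_le le_sup_left (m1.trans le_sup_right)
      have hr := rank_sup_inf A m
      rw [hsup] at hr
      have hz1 : finrank K ↥(A ⊓ m) = 1 := by omega
      by_cases hzS : A ⊓ m ∈ S
      · apply hsec m (m2.trans hWX) (by omega)
        exact two_le_s hX0 hzS (fun h => hX0A (h.le.trans inf_le_left)) m1 inf_le_right
      · have hzX : A ⊓ m ≤ X := inf_le_left.trans hAX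
        have hzP : A ⊓ m ≠ P0 := fun h => hzS (h ▸ hP)
        have hlr := rank_line hz1 hP1 hzP
        rcases hgb _ hzX hz1 hzS with hg | hb
        · exact hg m (mem_pen.2 ⟨inf_le_right, m2.trans hWX, by omega⟩)
        · exfalso
          have b1 := hb (A ⊓ m ⊔ P0) (mem_pen.2 ⟨le_sup_left, sup_le hzX (hPA.trans hAX), by omega⟩)
          have b2 := hE (A ⊓ m ⊔ P0) (sup_le inf_le_left hPA) hlr
          have b3 : 0 < s S (A ⊓ m ⊔ P0) := s_pos_iff.2 ⟨P0, hP, le_sup_right⟩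
          obtain ⟨t, ht⟩ := b2
          omega
    have : 0 < s S m := s_pos_iff.2 ⟨X0, hX0, m1⟩
    obtain ⟨t, ht⟩ := hev
    omega
  have hcnt : 1 + th q (finrank K A) ≤ s S (A ⊔ X0) := by
    have h1 := pencil_on hq hS hX0 (le_sup_right : X0 ≤ A ⊔ X0)
    have h2 := card_nsmul_le_sum (pen X0 (A ⊔ X0)) (fun W => s S W) 2 hlines
    rw [card_pen hq le_sup_right, hWr, hX1, smul_eq_mul] at h2
    rw [hWr] at h1
    simp only [Nat.add_sub_cancel] at h1 h2
    omega
  intro L hL hL2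
  by_cases h2 : 2 ≤ s S L
  · exact hsec L (hL.trans hWX) hL2 h2
  by_cases h0 : s S L = 0
  · rw [h0]; exact Even.zero
  exfalso
  have h1 : s S L = 1 := by omega
  have hq1 := one_lt_q hq
  obtain ⟨R, hR1, hRL, hRS⟩ := exists_not_mem hq hS (W := L) (by rw [hL2, th_two]; omega)
  have hLp : L ∈ pen R X := mem_pen.2 ⟨hRL, hL.trans hWX, by omega⟩
  rcases hgb R (hRL.trans (hL.trans hWX)) hR1 hRS with hg | hb
  · have := hg L hLp
    rw [h1] at this
    exact absurd this (by decide)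
  · have h3 := pencil_off hS (hRL.trans hL) (s_pt_not_mem hS hR1 hRS)
    have h4 := sum_le_card_nsmul (pen R (A ⊔ X0)) (fun W => s S W) 1 (fun m hm => hb m (pen_sub hWX hm))
    rw [card_pen hq (hRL.trans hL), hWr, hR1, smul_eq_mul] at h4
    simp only [Nat.add_sub_cancel] at h4
    omega

theorem contain {q : ℕ} (hq48 : q = 4 ∨ q = 8) (hq : Nat.card K = q) {e : ℕ} {r : ℕ} (hr : 2 ≤ r)
    {S : Finset (Submodule K V)} (hS : IsPts S)
    {X : Submodule K V} (hX : finrank K X = e + 1 + r) (hE : Ev S r X) (hSX : ∀ P ∈ S, P ≤ X)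
    (hs : s S X = (q+2)*q^e) : finrank K ↥(S.sup id) = e + 3 ∧ Ev S 2 (S.sup id) := by
  have hq4 : 4 ≤ q := by omega
  have hqe : 0 < q ^ e := by positivity
  have h2s : 1 < s S X := by rw [hs]; nlinarith
  obtain ⟨P, hP', Q, hQ', hPQ⟩ := one_lt_card.1 h2s
  have hP := (mem_filter.1 hP').1
  have hQ := (mem_filter.1 hQ').1
  have hPX := (mem_filter.1 hP').2
  have hQX := (mem_filter.1 hQ').2
  obtain ⟨hnf, hgb⟩ := (contain1 hq48 hq e r hr S hS X hX hE P hP hPX).2 hs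
  have hsec : ∀ L ≤ X, finrank K L = 2 → 2 ≤ s S L → Even (s S L) := by
    intro L hL hL2 h2
    obtain ⟨R, hR1, hRL, hRS⟩ := exists_not_mem hq hS (W := L)
              (by rw [hL2, th_two]; have := hnf L hL hL2; omega)
    have hLp : L ∈ pen R X := mem_pen.2 ⟨hRL, hL, by omega⟩
    rcases hgb R (hRL.trans hL) hR1 hRS with hg | hb
    · exact hg L hLp
    · have := hb L hLp; omega
  have hl2 := rank_line (hS P hP) (hS Q hQ) hPQ
  have hlX : P ⊔ Q ≤ X := sup_le hPX hQX
  have hfin : {A : Submodule K V | P ⊔ Q ≤ A ∧ A ≤ X ∧ Ev S 2 A}.Finite := Set.toFinite _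
  obtain ⟨A, ⟨hPA, hAX, hAE⟩, hmax⟩ := hfin.exists_maximal ⟨P ⊔ Q, le_refl _, hlX, by
    intro L hL hL2
    rw [eq_of_le_rank hL (by omega)]
    exact hsec _ hlX hl2 (two_le_s hP hQ hPQ le_sup_left le_sup_right)⟩
  have hSA : ∀ Z ∈ S, Z ≤ A := by
    intro Z hZ
    by_contra hZA
    have h1 := extend hq hS hsec hgb hAX hAE (hl2 ▸ rank_mono hPA) hP (le_sup_left.trans hPA) hZ (hSX Z hZ) hZA
    exact hZA (le_sup_right.trans (hmax ⟨hPA.trans le_sup_left, sup_le hAX (hSX Z hZ), h1⟩ le_sup_left))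
  have hUA : S.sup id ≤ A := Finset.sup_le hSA
  have hUE := hAE.mono hUA
  have hSU : ∀ Z ∈ S, Z ≤ S.sup id := fun Z hZ => Finset.le_sup (f := id) hZ
  have hUX := hUA.trans hAX
  have h1 := dim_ge (N := 0) hS hE (by omega) hUX (fun Z hZ _ => hSU Z hZ) hP (hSU P hP)
  have h2 := (even_min hq48 hq hS (X := S.sup id) (e := finrank K ↥(S.sup id) - 3) (by omega) hUE hP (hSU P hP)).1
  have h3 : s S (S.sup id) ≤ s S X := s_mono hUX
  refine ⟨?_, hUE⟩
  have h4 : q ^ (finrank K ↥(S.sup id) - 3) ≤ q ^ e :=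
    Nat.le_of_mul_le_mul_left (h2.trans (h3.trans hs.le)) (by omega)
  have := (Nat.pow_le_pow_iff_right (by omega : 1 < q)).1 h4
  omega
end HC

open Submodule
set_option linter.unusedSectionVars false
set_option linter.unusedVariables false
namespace HC
open scoped Classical
open Finset Module
variable {K V : Type*} [Field K] [Finite K] [AddCommGroup V] [Module K V] [Finite V]

theorem exists_phi {U T : Submodule K V} {e : ℕ} (hU : finrank K U = e + 3) (hT : finrank K T = e)
    (hTU : T ≤ U) : ∃ φ : V →ₗ[K] (Fin 3 → K), (∀ u ∈ U, φ u = 0 ↔ u ∈ T) ∧ ∀ y, ∃ u ∈ U, φ u = y := by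
  set T' : Submodule K U := T.comap U.subtype
  have hT' : finrank K T' = e := by
    rw [← hT]; exact (Submodule.comapSubtypeEquivOfLe hTU).finrank_eq
  have hQ := Submodule.finrank_quotient_add_finrank T'
  have hf : finrank K (U ⧸ T') = finrank K (Fin 3 → K) := by
    rw [finrank_fin_fun]; omega
  let eqv := LinearEquiv.ofFinrankEq _ _ hf
  obtain ⟨g, hg⟩ := LinearMap.exists_extend (p := U) (eqv.toLinearMap ∘ₗ T'.mkQ)
  have hg' : ∀ u : U, g u = eqv (T'.mkQ u) := fun u => LinearMap.congr_fun hg u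
  refine ⟨g, ?_, ?_⟩
  · intro u hu
    rw [hg' ⟨u, hu⟩, LinearEquiv.map_eq_zero_iff, Submodule.mkQ_apply, Submodule.Quotient.mk_eq_zero]
    rfl
  · intro y
    obtain ⟨u, hu⟩ := T'.mkQ_surjective (eqv.symm y)
    exact ⟨u, u.2, by rw [hg', hu, LinearEquiv.apply_symm_apply]⟩

/-- a projection of `U` onto a plane with kernel `T` -/
structure Dat (U T : Submodule K V) (e : ℕ) (φ : V →ₗ[K] (Fin 3 → K)) : Prop where
  hU : finrank K U = e + 3
  hT : finrank K T = e
  hTU : T ≤ U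
  ker : ∀ u ∈ U, φ u = 0 ↔ u ∈ T
  sur : ∀ y, ∃ u ∈ U, φ u = y

variable {U T : Submodule K V} {e : ℕ} {φ : V →ₗ[K] (Fin 3 → K)}

/-- the cylinder over `O` -/
noncomputable def pull (U : Submodule K V) (φ : V →ₗ[K] (Fin 3 → K))
    (O : Finset (Submodule K (Fin 3 → K))) : Finset (Submodule K V) :=
  univ.filter (fun P => finrank K P = 1 ∧ P ≤ U ∧ P.map φ ∈ O)

theorem mem_pull {O : Finset (Submodule K (Fin 3 → K))} {P : Submodule K V} :
    P ∈ pull U φ O ↔ finrank K P = 1 ∧ P ≤ U ∧ P.map φ ∈ O := by simp [pull]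

theorem pull_pts (O : Finset (Submodule K (Fin 3 → K))) : IsPts (pull U φ O) :=
  fun P hP => (mem_pull.1 hP).1

theorem map_inf_comap1 (W : Submodule K V) (Q : Submodule K (Fin 3 → K)) :
    (W ⊓ Q.comap φ).map φ = W.map φ ⊓ Q := by
  ext y
  constructor
  · rintro ⟨x, ⟨h1, h2⟩, rfl⟩
    exact ⟨Submodule.mem_map_of_mem h1, h2⟩
  · rintro ⟨⟨x, h1, rfl⟩, h2⟩
    exact ⟨x, ⟨h1, h2⟩, rfl⟩

theorem map_span1 (x : V) : (span K {x}).map φ = span K {φ x} := by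
  rw [Submodule.map_span, Set.image_singleton]

theorem ne_zero_of_mem {W : Type*} [AddCommGroup W] [Module K W] [Finite W]
    {S : Finset (Submodule K W)} (hS : IsPts S) {x : W} (h : span K {x} ∈ S) : x ≠ 0 := by
  rintro rfl
  have := hS _ h
  rw [Submodule.span_zero_singleton, finrank_bot] at this
  omega

theorem span_mem_pull {O : Finset (Submodule K (Fin 3 → K))} (hO : IsPts O) {x : V} (hx : x ∈ U) :
    span K {x} ∈ pull U φ O ↔ span K {φ x} ∈ O := by
  rw [mem_pull, map_span1]
  constructor
  · exact fun h => h.2.2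
  · intro h
    refine ⟨rank_span ?_, span_le_iff.2 hx, h⟩
    rintro rfl
    rw [map_zero] at h
    exact ne_zero_of_mem hO h rfl

theorem Dat.rank_map (D : Dat U T e φ) {W : Submodule K V} (hW : W ≤ U) :
    finrank K (W.map φ) + finrank K ↥(W ⊓ T) = finrank K W := by
  have h := (φ.domRestrict W).finrank_range_add_finrank_ker
  have h1 : LinearMap.range (φ.domRestrict W) = W.map φ := LinearMap.range_domRestrict _ _
  have h2 : (LinearMap.ker (φ.domRestrict W)).map W.subtype = W ⊓ T := by
    ext x
    simp only [Submodule.mem_map, LinearMap.mem_ker, Submodule.mem_inf]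
    constructor
    · rintro ⟨y, hy, rfl⟩
      exact ⟨y.2, (D.ker _ (hW y.2)).1 hy⟩
    · rintro ⟨a, b⟩
      exact ⟨⟨x, a⟩, (D.ker _ (hW a)).2 b, rfl⟩
  rw [h1] at h
  rw [← h2, LinearEquiv.finrank_eq (Submodule.equivMapOfInjective W.subtype W.injective_subtype _).symm]
  exact h

theorem Dat.map_pt (D : Dat U T e φ) {P Q : Submodule K V} (hP : finrank K P = 1) (hPU : P ≤ U) :
    finrank K (P.map φ) = 1 ↔ ¬ P ≤ T := by
  have h := D.rank_map hPU
  constructor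
  · intro h1 h2
    rw [inf_eq_left.2 h2] at h; omega
  · intro h1
    have := inf_pt hP h1
    rw [inf_comm] at this; omega

theorem card_off {q : ℕ} (hq : Nat.card K = q) {A B : Submodule K V} (hAB : A ≤ B)
    (h : finrank K B = finrank K A + 1) :
    ((ptsOf B).filter (fun P => ¬ P ≤ A)).card = q ^ finrank K A := by
  have h1 := card_filter_add_card_filter_not (s := ptsOf B) (fun P => P ≤ A)
  have h2 : (ptsOf B).filter (fun P => P ≤ A) = ptsOf A := by
    ext P
    rw [mem_filter, mem_ptsOf, mem_ptsOf]
    exact ⟨fun h => ⟨h.1.1, h.2⟩, fun h => ⟨⟨h.1, h.2.trans hAB⟩, h.2⟩⟩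
  rw [h2, card_ptsOf hq, card_ptsOf hq, h, th_succ] at h1
  omega

theorem Dat.count (D : Dat U T e φ) {q : ℕ} (hq : Nat.card K = q)
    {O : Finset (Submodule K (Fin 3 → K))} (hO : IsPts O) {W : Submodule K V} (hW : W ≤ U) :
    s (pull U φ O) W = s O (W.map φ) * q ^ finrank K ↥(W ⊓ T) := by
  unfold s
  rw [card_eq_sum_card_fiberwise (f := fun P => P.map φ)
    (t := O.filter (fun P => P ≤ W.map φ))]
  · rw [sum_const_nat]
    intro Q hQ
    obtain ⟨hQO, hQW⟩ := mem_filter.1 hQ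
    have hQ1 := hO Q hQO
    have hle : W ⊓ Q.comap φ ≤ U := inf_le_left.trans hW
    have hmap : (W ⊓ Q.comap φ).map φ = Q := by
      rw [map_inf_comap1, inf_eq_right.2 hQW]
    have hinf : W ⊓ Q.comap φ ⊓ T = W ⊓ T := by
      apply le_antisymm (inf_le_inf_right _ inf_le_left)
      refine le_inf (le_inf inf_le_left ?_) inf_le_right
      intro x hx
      rw [Submodule.mem_comap, (D.ker x (hW hx.1)).2 hx.2]
      exact Q.zero_mem
    have hr := D.rank_map hle
    rw [hmap, hinf, hQ1] at hr
    rw [← card_off hq (A := W ⊓ T) (B := W ⊓ Q.comap φ) (hinf ▸ inf_le_left) (by omega)]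
    congr 1
    ext P
    simp only [mem_filter, mem_ptsOf, mem_pull]
    constructor
    · rintro ⟨⟨⟨p1, p2, p3⟩, p4⟩, p5⟩
      refine ⟨⟨p1, le_inf p4 (Submodule.map_le_iff_le_comap.1 p5.le)⟩, fun h => ?_⟩
      exact (D.map_pt (Q := P) p1 p2).1 (by rw [p5, hQ1]) (h.trans inf_le_right)
    · rintro ⟨⟨p1, p2⟩, p3⟩
      have p4 : P ≤ W := p2.trans inf_le_left
      have p5 : P.map φ = Q := by
        apply pt_eq ((D.map_pt (Q := P) p1 (p4.trans hW)).2 (fun h => p3 (le_inf p4 h))) hQ1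
        exact Submodule.map_le_iff_le_comap.2 (p2.trans inf_le_right)
      exact ⟨⟨⟨p1, p4.trans hW, p5 ▸ hQO⟩, p4⟩, p5⟩
  · intro P hP
    rw [mem_coe, mem_filter, mem_pull] at hP
    rw [mem_coe, mem_filter]
    exact ⟨hP.1.2.2, Submodule.map_mono hP.2⟩

/-- hyperovals -/
def IsH3 (q : ℕ) (O : Finset (Submodule K (Fin 3 → K))) : Prop :=
  IsPts O ∧ Ev O 2 ⊤ ∧ s O ⊤ = q + 2

/-- the minimal sets -/
def IsB (q e r : ℕ) (S : Finset (Submodule K V)) : Prop :=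
  IsPts S ∧ Ev S r ⊤ ∧ s S ⊤ = (q + 2) * q ^ e

theorem s_inf {S : Finset (Submodule K V)} (h : ∀ P ∈ S, P ≤ U) (Z : Submodule K V) :
    s S Z = s S (Z ⊓ U) := by
  unfold s
  congr 1
  ext P
  rw [mem_filter, mem_filter]
  exact ⟨fun a => ⟨a.1, le_inf a.2 (h P a.1)⟩, fun a => ⟨a.1, a.2.trans inf_le_left⟩⟩

theorem pull_le {O : Finset (Submodule K (Fin 3 → K))} : ∀ P ∈ pull U φ O, P ≤ U :=
  fun P hP => (mem_pull.1 hP).2.1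

theorem Dat.pull_B (D : Dat U T e φ) {q r : ℕ} (hq : Nat.card K = q) (hev : Even q) (hr : 2 ≤ r)
    (hV : finrank K V = e + 1 + r)
    {O : Finset (Submodule K (Fin 3 → K))} (hO : IsH3 q O) : IsB q e r (pull U φ O) := by
  obtain ⟨o1, o2, o3⟩ := hO
  refine ⟨pull_pts O, ?_, ?_⟩
  · intro Z _ hZ
    rw [s_inf pull_le, D.count hq o1 inf_le_right]
    have h1 := rank_sup_inf Z U
    have h2 : finrank K ↥(Z ⊔ U) ≤ finrank K V := Submodule.finrank_le _
    have h3 := D.rank_map (W := Z ⊓ U) inf_le_right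
    have hU := D.hU
    by_cases ht : finrank K ↥(Z ⊓ U ⊓ T) = 0
    · rw [ht, pow_zero, mul_one]
      exact Ev.up hq hev o1 o2 (by omega) (show 2 ≤ finrank K ↥((Z ⊓ U).map φ) by omega) _ le_top rfl
    · exact (hev.pow_of_ne_zero ht).mul_left _
  · rw [s_inf pull_le, top_inf_eq, D.count hq o1 le_rfl, inf_eq_right.2 D.hTU, D.hT]
    have : U.map φ = ⊤ := by
      rw [eq_top_iff]
      intro y _
      obtain ⟨u, hu, rfl⟩ := D.sur y
      exact Submodule.mem_map_of_mem hu
    rw [this, o3]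

theorem nonempty_of_s {S : Finset (Submodule K V)} {W : Submodule K V} (h : 0 < s S W) : ∃ P, P ∈ S := by
  obtain ⟨P, hP, _⟩ := s_pos_iff.1 h
  exact ⟨P, hP⟩

theorem Dat.pull_sup (D : Dat U T e φ) {q r : ℕ} (hq : Nat.card K = q) (hev : Even q) (hr : 2 ≤ r)
    (hV : finrank K V = e + 1 + r)
    {O : Finset (Submodule K (Fin 3 → K))} (hO : IsH3 q O) : (pull U φ O).sup id = U := by
  obtain ⟨b1, b2, b3⟩ := D.pull_B hq hev hr hV hO
  have hq1 := one_lt_q hq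
  obtain ⟨P, hP⟩ := nonempty_of_s (show 0 < s (pull U φ O) ⊤ by rw [b3]; positivity)
  have hsup : ∀ Z ∈ pull U φ O, Z ≤ (pull U φ O).sup id := fun Z hZ => Finset.le_sup (f := id) hZ
  have h := dim_ge (N := 0) b1 b2 (by omega) (le_top : (pull U φ O).sup id ≤ ⊤)
    (fun Q hQ _ => hsup Q hQ) hP (hsup P hP)
  rw [finrank_top, hV] at h
  exact eq_of_le_rank (Finset.sup_le pull_le) (by rw [D.hU]; omega)

theorem H3_line {q : ℕ} (hq : Nat.card K = q) {O : Finset (Submodule K (Fin 3 → K))} (hO : IsH3 q O)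
    {L : Submodule K (Fin 3 → K)} (hL : finrank K L = 2) : s O L ≤ 2 := by
  obtain ⟨o1, o2, o3⟩ := hO
  by_contra hcon
  obtain ⟨P, hP, hPL⟩ := s_pos_iff.1 (show 0 < s O L by omega)
  have h := exc hq o1 o2 hP le_top
  rw [o3, finrank_top, finrank_fin_fun, show 3 - 1 = 2 from rfl, th_two] at h
  have h2 := single_le_sum (f := fun L => s O L - 2) (fun _ _ => Nat.zero_le _)
    (mem_pen.2 ⟨hPL, le_top, by rw [o1 P hP, hL]⟩ : L ∈ pen P ⊤)
  omega

theorem span_unit {W : Type*} [AddCommGroup W] [Module K W] {c : K} (hc : c ≠ 0) (x : W) :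
    span K {c • x} = span K {x} := Submodule.span_singleton_smul_eq (IsUnit.mk0 c hc) x

theorem Dat.pull_rad (D : Dat U T e φ) {q : ℕ} (hq : Nat.card K = q) (hq4 : 4 ≤ q)
    {O : Finset (Submodule K (Fin 3 → K))} (hO : IsH3 q O) : rad (pull U φ O) U = T := by
  have o1 := hO.1
  apply le_antisymm
  · intro v hv
    have hvU := (mem_rad.1 hv).1
    rw [← D.ker v hvU]
    by_contra hy
    obtain ⟨Q, hQ⟩ := nonempty_of_s (show 0 < s O ⊤ by rw [hO.2.2]; omega)
    obtain ⟨z, hz, rfl⟩ := exists_span (o1 Q hQ)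
    obtain ⟨u, hu, rfl⟩ := D.sur z
    have hmem : ∀ c : K, span K {φ u + c • φ v} ∈ O := by
      intro c
      have h1 := (mem_rad.1 (Submodule.smul_mem _ c hv)).2 u hu
      rw [span_mem_pull o1 (U.add_mem hu (U.smul_mem c hvU)), span_mem_pull o1 hu, map_add, map_smul] at h1
      exact h1.2 hQ
    have hind : ∀ a b : K, a • φ u + b • φ v = 0 → a = 0 := by
      intro a b h
      by_contra ha
      have : φ u + (a⁻¹ * b) • φ v = 0 := by
        have := congrArg (fun w => a⁻¹ • w) h
        simp only [smul_add, smul_smul, inv_mul_cancel₀ ha, one_smul, smul_zero] at this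
        exact this
      have h2 := hmem (a⁻¹ * b)
      rw [this] at h2
      exact ne_zero_of_mem o1 h2 rfl
    set L := span K {φ u} ⊔ span K {φ v} with hL
    have hne : span K {φ u} ≠ span K {φ v} := by
      intro h
      obtain ⟨c, hc⟩ := Submodule.mem_span_singleton.1 (h ▸ mem_span_singleton_self (φ u) : φ u ∈ span K {φ v})
      exact one_ne_zero (hind 1 (-c) (by rw [one_smul, neg_smul, hc]; abel))
    have hL2 : finrank K L = 2 := rank_line (rank_span hz) (rank_span hy) hne
    have h3 := H3_line hq hO hL2
    have hinj : Function.Injective (fun c : K => span K {φ u + c • φ v}) := by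
      intro c c' h
      simp only at h
      obtain ⟨a, ha⟩ := Submodule.mem_span_singleton.1 (h ▸ mem_span_singleton_self (φ u + c • φ v) :
        φ u + c • φ v ∈ span K {φ u + c' • φ v})
      have h4 : (a - 1) • φ u + (a * c' - c) • φ v = 0 := by
        rw [smul_add, smul_smul] at ha
        rw [sub_smul, sub_smul, one_smul, sub_add_sub_comm, ha, sub_self]
      have h5 := hind _ _ h4
      rw [h5, zero_smul, zero_add] at h4
      have h6 := (smul_eq_zero.1 h4).resolve_right hy
      rw [sub_eq_zero.1 h5, one_mul] at h6
      exact (sub_eq_zero.1 h6).symm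
    have h7 : q ≤ s O L := by
      have := Fintype.ofFinite K
      rw [← hq, Nat.card_eq_fintype_card, ← card_univ, ← card_image_of_injective _ hinj]
      apply card_le_card
      intro P hP
      obtain ⟨c, -, rfl⟩ := mem_image.1 hP
      rw [mem_filter]
      refine ⟨hmem c, span_le_iff.2 (L.add_mem ?_ (L.smul_mem c ?_))⟩
      · exact (le_sup_left : _ ≤ L) (mem_span_singleton_self _)
      · exact (le_sup_right : _ ≤ L) (mem_span_singleton_self _)
    omega
  · intro v hv
    have hvU := D.hTU hv
    refine mem_rad.2 ⟨hvU, fun x hx => ?_⟩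
    rw [span_mem_pull o1 (U.add_mem hx hvU), span_mem_pull o1 hx, map_add, (D.ker v hvU).2 hv, add_zero]

theorem Dat.pull_inj (D : Dat U T e φ) {O O' : Finset (Submodule K (Fin 3 → K))} (hO : IsPts O)
    (hO' : IsPts O') (h : pull U φ O = pull U φ O') : O = O' := by
  have : ∀ y, span K {y} ∈ O ↔ span K {y} ∈ O' := by
    intro y
    obtain ⟨u, hu, rfl⟩ := D.sur y
    rw [← span_mem_pull hO hu, h, span_mem_pull hO' hu]
  ext Q
  constructor
  · intro hQ
    obtain ⟨x, -, rfl⟩ := exists_span (hO Q hQ)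
    exact (this x).1 hQ
  · intro hQ
    obtain ⟨x, -, rfl⟩ := exists_span (hO' Q hQ)
    exact (this x).2 hQ

theorem Dat.surj (D : Dat U T e φ) {q : ℕ} (hq : Nat.card K = q) {S : Finset (Submodule K V)}
    (hS : IsPts S) (hSU : ∀ P ∈ S, P ≤ U) (hE : Ev S 2 U) (hs : s S U = (q+2) * q^e)
    (hT : T ≤ rad S U) : ∃ O, IsH3 q O ∧ pull U φ O = S := by
  set O : Finset (Submodule K (Fin 3 → K)) := S.image (fun P => P.map φ) with hOd
  have hST : ∀ x ∈ T, span K {x} ∉ S := by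
    intro x hx h
    have h1 := (mem_rad.1 (hT hx)).2 0 U.zero_mem
    rw [zero_add] at h1
    exact ne_zero_of_mem hS (h1.1 h) rfl
  have hO : IsPts O := by
    intro Q hQ
    obtain ⟨P, hP, rfl⟩ := mem_image.1 hQ
    obtain ⟨x, hx, rfl⟩ := exists_span (hS P hP)
    rw [D.map_pt (Q := U) (hS _ hP) (hSU _ hP), span_le_iff]
    exact fun h => hST x h hP
  have hmem : ∀ x ∈ U, span K {φ x} ∈ O ↔ span K {x} ∈ S := by
    intro x hx
    constructor
    · intro h
      obtain ⟨P, hP, hPx⟩ := mem_image.1 h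
      obtain ⟨u, hu, rfl⟩ := exists_span (hS P hP)
      have huU := span_le_iff.1 (hSU _ hP)
      rw [map_span1] at hPx
      obtain ⟨c, hc⟩ := Submodule.mem_span_singleton.1 (hPx ▸ mem_span_singleton_self (φ x) :
        φ x ∈ span K {φ u})
      have hc0 : c ≠ 0 := by
        rintro rfl
        rw [zero_smul] at hc
        exact ne_zero_of_mem hO h hc.symm
      have hxT : x - c • u ∈ T := by
        rw [← D.ker _ (U.sub_mem hx (U.smul_mem c huU)), map_sub, map_smul, hc, sub_self]
      have h1 := (mem_rad.1 (hT hxT)).2 (c • u) (U.smul_mem c huU)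
      rw [add_sub_cancel, span_unit hc0] at h1
      exact h1.2 hP
    · intro h
      rw [← map_span1]
      exact mem_image_of_mem _ h
  have hpull : pull U φ O = S := by
    ext P
    constructor
    · intro h
      obtain ⟨x, hx, rfl⟩ := exists_span (pull_pts O P h)
      have hxU := span_le_iff.1 (pull_le _ h)
      exact (hmem x hxU).1 ((span_mem_pull hO hxU).1 h)
    · intro h
      obtain ⟨x, hx, rfl⟩ := exists_span (hS P h)
      have hxU := span_le_iff.1 (hSU _ h)
      exact (span_mem_pull hO hxU).2 ((hmem x hxU).2 h)
  have hq1 := one_lt_q hq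
  have hUtop : U.map φ = ⊤ := by
    rw [eq_top_iff]
    intro y _
    obtain ⟨u, hu, rfl⟩ := D.sur y
    exact Submodule.mem_map_of_mem hu
  refine ⟨O, ⟨hO, ?_, ?_⟩, hpull⟩
  · intro L _ hL
    have hB : T ≤ U ⊓ L.comap φ := by
      intro x hx
      refine ⟨D.hTU hx, ?_⟩
      change φ x ∈ L
      rw [(D.ker x (D.hTU hx)).2 hx]; exact L.zero_mem
    obtain ⟨W, w1, w2, w3⟩ := exists_compl hB
    have hWU : W ≤ U := w1.trans inf_le_left
    have hmapB : (U ⊓ L.comap φ).map φ = L := by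
      rw [map_inf_comap1, hUtop, top_inf_eq]
    have hmapW : W.map φ = L := by
      rw [← w3, Submodule.map_sup] at hmapB
      have : T.map φ = ⊥ := by
        rw [eq_bot_iff]
        rintro _ ⟨x, hx, rfl⟩
        exact (D.ker x (D.hTU hx)).2 hx
      rwa [this, bot_sup_eq] at hmapB
    have h1 := D.count hq hO hWU
    have h2 := D.rank_map hWU
    rw [w2, finrank_bot, pow_zero, mul_one, hmapW, hpull] at h1
    rw [w2, finrank_bot, hmapW, hL] at h2
    rw [← h1]
    exact hE W hWU (by omega)
  · have h1 := D.count hq hO (le_refl U)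
    rw [inf_eq_right.2 D.hTU, D.hT, hUtop, hpull, hs] at h1
    exact (Nat.mul_right_cancel (by positivity) h1).symm

/-- the rank of the radical -/
theorem B_data {q r : ℕ} (hq48 : q = 4 ∨ q = 8) (hq : Nat.card K = q) (hr : 2 ≤ r)
    (hV : finrank K V = e + 1 + r) {S : Finset (Submodule K V)} (hB : IsB q e r S) :
    finrank K ↥(S.sup id) = e + 3 ∧ Ev S 2 (S.sup id) ∧ s S (S.sup id) = (q+2) * q ^ e ∧
      finrank K (rad S (S.sup id)) = e := by
  obtain ⟨b1, b2, b3⟩ := hB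
  have hq4 : 4 ≤ q := by omega
  obtain ⟨c1, c2⟩ := contain hq48 hq hr b1 (X := ⊤) (by rw [finrank_top, hV]) b2 (fun _ _ => le_top) b3
  have hSU : ∀ Z ∈ S, Z ≤ S.sup id := fun Z hZ => Finset.le_sup (f := id) hZ
  have c3 : s S (S.sup id) = (q+2) * q ^ e := by
    rw [← b3, s_inf hSU ⊤, top_inf_eq]
  obtain ⟨P, hP⟩ := nonempty_of_s (show 0 < s S ⊤ by rw [b3]; positivity)
  have c4 := even_rad hq48 hq b1 c1 c2 hP (hSU P hP) c3
  obtain ⟨T, -, t1, t2⟩ := exists_between (bot_le : ⊥ ≤ rad S (S.sup id)) e (by simp) c4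
  have hTU : T ≤ S.sup id := t1.trans (fun v hv => (mem_rad.1 hv).1)
  obtain ⟨φ, f1, f2⟩ := exists_phi c1 t2 hTU
  have D : Dat (S.sup id) T e φ := ⟨c1, t2, hTU, f1, f2⟩
  obtain ⟨O, hO, hOS⟩ := D.surj hq b1 hSU c2 c3 t1
  refine ⟨c1, c2, c3, ?_⟩
  have := D.pull_rad hq hq4 hO
  rw [hOS] at this
  rw [this, t2]

theorem card_fiber {q r : ℕ} (hq48 : q = 4 ∨ q = 8) (hq : Nat.card K = q) (hr : 2 ≤ r)
    (hV : finrank K V = e + 1 + r) {U T : Submodule K V} (hU : finrank K U = e + 3)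
    (hT : finrank K T = e) (hTU : T ≤ U) :
    (univ.filter (fun S : Finset (Submodule K V) =>
      IsB q e r S ∧ S.sup id = U ∧ rad S (S.sup id) = T)).card =
    (univ.filter (fun O : Finset (Submodule K (Fin 3 → K)) => IsH3 q O)).card := by
  have hq4 : 4 ≤ q := by omega
  have hev : Even q := by rcases hq48 with rfl | rfl <;> decide
  obtain ⟨φ, f1, f2⟩ := exists_phi hU hT hTU
  have D : Dat U T e φ := ⟨hU, hT, hTU, f1, f2⟩
  symm
  apply card_bij (fun O _ => pull U φ O)
  · intro O hO
    have hO := (mem_filter.1 hO).2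
    rw [mem_filter]
    have h1 := D.pull_sup hq hev hr hV hO
    exact ⟨mem_univ _, D.pull_B hq hev hr hV hO, h1, by rw [h1]; exact D.pull_rad hq hq4 hO⟩
  · intro O hO O' hO' h
    exact D.pull_inj (mem_filter.1 hO).2.1 (mem_filter.1 hO').2.1 h
  · intro S hS
    obtain ⟨-, hB, rfl, hrad⟩ := mem_filter.1 hS
    obtain ⟨d1, d2, d3, d4⟩ := B_data hq48 hq hr hV hB
    obtain ⟨O, hO, hOS⟩ := D.surj hq hB.1 (fun Z hZ => Finset.le_sup (f := id) hZ) d2 d3 hrad.ge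
    exact ⟨O, mem_filter.2 ⟨mem_univ _, hO⟩, hOS⟩

/-- the flags -/
noncomputable def flags (K V : Type*) [Field K] [Finite K] [AddCommGroup V] [Module K V] [Finite V] (e : ℕ) :
    Finset (Submodule K V × Submodule K V) :=
  univ.filter (fun p => finrank K p.1 = e + 3 ∧ finrank K p.2 = e ∧ p.2 ≤ p.1)

theorem card_B {q r : ℕ} (hq48 : q = 4 ∨ q = 8) (hq : Nat.card K = q) (hr : 2 ≤ r)
    (hV : finrank K V = e + 1 + r) :
    (univ.filter (fun S : Finset (Submodule K V) => IsB q e r S)).card =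
    (flags K V e).card * (univ.filter (fun O : Finset (Submodule K (Fin 3 → K)) => IsH3 q O)).card := by
  rw [card_eq_sum_card_fiberwise (f := fun S => (S.sup id, rad S (S.sup id))) (t := flags K V e)]
  · apply sum_const_nat
    rintro ⟨U, T⟩ hp
    obtain ⟨-, h1, h2, h3⟩ := mem_filter.1 hp
    rw [← card_fiber hq48 hq hr hV h1 h2 h3, filter_filter]
    congr 1
    ext S
    simp only [mem_filter, mem_univ, true_and, Prod.mk.injEq]
  · intro S hS
    rw [mem_coe, mem_filter] at hS
    obtain ⟨d1, d2, d3, d4⟩ := B_data hq48 hq hr hV hS.2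
    rw [mem_coe, flags, mem_filter]
    exact ⟨mem_univ _, d1, d4, fun v hv => (mem_rad.1 hv).1⟩
end HC

open Submodule
set_option linter.unusedSectionVars false
set_option linter.unusedVariables false
namespace HC
open scoped Classical
open Finset Module
variable {K V : Type*} [Field K] [Finite K] [AddCommGroup V] [Module K V] [Finite V]

/-- number of `b`-dimensional subspaces -/
noncomputable def gc (K V : Type*) [Field K] [AddCommGroup V] [Module K V] (b : ℕ) : ℕ :=
  Nat.card {W : Submodule K V // finrank K W = b}

theorem gc_congr {W : Type*} [AddCommGroup W] [Module K W] (f : V ≃ₗ[K] W) (b : ℕ) :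
    gc K V b = gc K W b := by
  apply Nat.card_congr
  refine Equiv.subtypeEquiv (Submodule.orderIsoMapComap f).toEquiv ?_
  intro U
  have : finrank K (U.map (f : V →ₗ[K] W)) = finrank K U := LinearEquiv.finrank_map_eq f U
  change _ ↔ finrank K (U.map (f : V →ₗ[K] W)) = b
  rw [this]

theorem gc_fin {a : ℕ} (h : finrank K V = a) (b : ℕ) : gc K V b = gc K (Fin a → K) b :=
  gc_congr (LinearEquiv.ofFinrankEq _ _ (by rw [h, finrank_fin_fun])) b

theorem gc_dual {a b c : ℕ} (h : finrank K V = a) (hb : b + c = a) : gc K V b = gc K V c := by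
  have hd : finrank K (Dual K V) = finrank K V := Subspace.dual_finrank_eq
  have h1 : gc K V b = gc K (Dual K V) c := by
    apply Nat.card_congr
    refine Equiv.subtypeEquiv ((Subspace.orderIsoFiniteDimensional (K := K) (V := V)).toEquiv.trans OrderDual.ofDual) ?_
    intro U
    have h2 := Subspace.finrank_add_finrank_dualAnnihilator_eq U
    change _ ↔ finrank K (U.dualAnnihilator) = c
    omega
  have : Finite (Dual K V) := Module.finite_of_finite K
  rw [h1]
  exact gc_congr (LinearEquiv.ofFinrankEq _ _ hd) c

theorem card_flags {N e c : ℕ} (hV : finrank K V = N) (hc : e + 3 + c = N) :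
    (flags K V e).card = gc K (Fin N → K) c * gc K (Fin (e+3) → K) 3 := by
  unfold flags
  rw [card_eq_sum_card_fiberwise (f := fun p => p.1)
    (t := univ.filter (fun U : Submodule K V => finrank K U = e + 3))]
  · rw [sum_const_nat (m := gc K (Fin (e+3) → K) 3)]
    · congr 1
      rw [← gc_fin hV, ← gc_dual hV hc, gc, Nat.card_eq_fintype_card, Fintype.card_subtype]
    · intro U hU
      have hU := (mem_filter.1 hU).2
      have h3 : finrank K (Fin (e+3) → K) = e + 3 := finrank_fin_fun K
      rw [← gc_dual (b := e) (c := 3) h3 rfl, ← gc_fin hU, gc, Nat.card_eq_fintype_card, Fintype.card_subtype]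
      symm
      apply card_bij (fun (W : Submodule K U) _ => (U, W.map U.subtype))
      · intro W hW
        have hW := (mem_filter.1 hW).2
        simp only [mem_filter, mem_univ, true_and, and_true]
        refine ⟨hU, ?_, Submodule.map_subtype_le _ _⟩
        rw [← hW]
        exact (LinearEquiv.finrank_eq (Submodule.equivMapOfInjective U.subtype U.injective_subtype W)).symm
      · intro W _ W' _ h
        exact Submodule.map_injective_of_injective U.injective_subtype (Prod.mk.inj h).2
      · rintro ⟨U', T⟩ hp
        simp only [mem_filter, mem_univ, true_and] at hp
        obtain ⟨⟨h1, h2, h3⟩, rfl⟩ := hp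
        refine ⟨T.comap U'.subtype, mem_filter.2 ⟨mem_univ _, ?_⟩, ?_⟩
        · rw [← h2]; exact (Submodule.comapSubtypeEquivOfLe h3).finrank_eq
        · rw [Submodule.map_comap_subtype, inf_eq_right.2 h3]
  · intro p hp
    rw [mem_coe, mem_filter] at hp ⊢
    exact ⟨mem_univ _, hp.2.1⟩
end HC

open Submodule
set_option linter.unusedSectionVars false
set_option linter.unusedVariables false
namespace HC
open scoped Classical
open Finset Module
variable {K : Type*} [Field K] [Finite K] {n : ℕ}

/-- the support of a codeword -/
noncomputable def toS (c : PGPoint K n → ZMod 2) : Finset (Submodule K (Fin (n+1) → K)) :=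
  univ.filter (fun W => ∃ h : finrank K W = 1, c ⟨W, h⟩ ≠ 0)

theorem mem_toS {c : PGPoint K n → ZMod 2} {W : Submodule K (Fin (n+1) → K)} :
    W ∈ toS c ↔ ∃ h : finrank K W = 1, c ⟨W, h⟩ ≠ 0 := by simp [toS]

theorem toS_pts (c : PGPoint K n → ZMod 2) : IsPts (toS c) := fun _ hP => (mem_toS.1 hP).1

theorem toS_inj : Function.Injective (toS : (PGPoint K n → ZMod 2) → _) := by
  intro c c' h
  funext ⟨W, hW⟩
  have h1 : W ∈ toS c ↔ W ∈ toS c' := by rw [h]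
  rw [mem_toS, mem_toS] at h1
  simp only [hW, exists_true_left] at h1
  generalize c ⟨W, hW⟩ = a at *
  generalize c' ⟨W, hW⟩ = b at *
  revert a b
  decide

theorem toS_surj {S : Finset (Submodule K (Fin (n+1) → K))} (hS : IsPts S) :
    ∃ c : PGPoint K n → ZMod 2, toS c = S := by
  refine ⟨fun P => if P.1 ∈ S then 1 else 0, ?_⟩
  ext W
  rw [mem_toS]
  constructor
  · rintro ⟨h, h2⟩
    by_contra h3
    simp [h3] at h2
  · intro h
    exact ⟨hS W h, by simp [h]⟩

instance : Finite (PGPoint K n) := by unfold PGPoint; infer_instance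

theorem toS_zero {c : PGPoint K n → ZMod 2} : c ≠ 0 ↔ ∃ P, P ∈ toS c := by
  rw [Function.ne_iff]
  constructor
  · rintro ⟨P, hP⟩
    exact ⟨P.1, mem_toS.2 ⟨P.2, hP⟩⟩
  · rintro ⟨P, hP⟩
    obtain ⟨h, h2⟩ := mem_toS.1 hP
    exact ⟨⟨P, h⟩, h2⟩

theorem s_toS (c : PGPoint K n → ZMod 2) (W : Submodule K (Fin (n+1) → K)) :
    s (toS c) W = {P : PGPoint K n | c P ≠ 0 ∧ P ∈ pts W}.ncard := by
  have h : ((Subtype.val : PGPoint K n → Submodule K (Fin (n+1) → K)) '' {P : PGPoint K n | c P ≠ 0 ∧ P ∈ pts W}) =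
    ((toS c).filter (fun P => P ≤ W) : Finset (Submodule K (Fin (n+1) → K))) := by
    ext Q
    rw [mem_coe, mem_filter, mem_toS]
    constructor
    · rintro ⟨P, ⟨h1, h2⟩, rfl⟩
      exact ⟨⟨P.2, h1⟩, h2⟩
    · rintro ⟨⟨h1, h2⟩, h3⟩
      exact ⟨⟨Q, h1⟩, ⟨h2, h3⟩, rfl⟩
  unfold s
  rw [← Set.ncard_coe_finset, ← h, Set.ncard_image_of_injective _ Subtype.val_injective]
  rfl

theorem wt_eq (c : PGPoint K n → ZMod 2) : wt c = s (toS c) ⊤ := by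
  rw [s_toS, wt]
  congr 1
  ext P
  exact ⟨fun h => ⟨h, (le_top : P.1 ≤ ⊤)⟩, fun h => h.1⟩

theorem sum_par (c : PGPoint K n → ZMod 2) (W : Submodule K (Fin (n+1) → K)) :
    ∑ᶠ P ∈ pts W, c P = (s (toS c) W : ZMod 2) := by
  have hF := Fintype.ofFinite (PGPoint K n)
  rw [s_toS, finsum_mem_eq_finite_toFinset_sum _ (Set.toFinite _)]
  have h1 : ∀ P : PGPoint K n, c P = if c P ≠ 0 then 1 else 0 := by
    intro P
    generalize c P = a
    revert a; decide
  rw [sum_congr rfl (fun P _ => h1 P), ← sum_filter, sum_const, nsmul_eq_mul, mul_one, ← Set.ncard_coe_finset]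
  congr 2
  ext P
  simp [and_comm]

theorem dual_iff {k : ℕ} (c : PGPoint K n → ZMod 2) : InDualCode 2 k c ↔ Ev (toS c) (k+1) ⊤ := by
  constructor
  · intro h W _ hW
    have := h (pts W) ⟨W, hW, rfl⟩
    rw [sum_par, ZMod.natCast_eq_zero_iff_even] at this
    exact this
  · rintro h σ ⟨W, hW, rfl⟩
    rw [sum_par, ZMod.natCast_eq_zero_iff_even]
    exact h W le_top hW

theorem main {q δ : ℕ} (hq48 : q = 4 ∨ q = 8) (hq : Nat.card K = q)
    (hδ : (univ.filter (fun O : Finset (Submodule K (Fin 3 → K)) => IsH3 q O)).card = δ) (hδ0 : 0 < δ)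
    (n k : ℕ) (hn : 3 ≤ n) (hk1 : 1 ≤ k) (hk2 : k ≤ n - 2) :
    Nat.card {c : PGPoint K n → ZMod 2 //
        c ≠ 0 ∧ InDualCode 2 k c ∧
        ∀ c' : PGPoint K n → ZMod 2, c' ≠ 0 → InDualCode 2 k c' → wt c ≤ wt c'} =
      gaussBinom K (n + 1) (k - 1) * gaussBinom K (n - k + 2) 3 * δ := by
  obtain ⟨e, he⟩ : ∃ e, n = e + 1 + k := ⟨n - k - 1, by omega⟩
  have hV : finrank K (Fin (n+1) → K) = e + 1 + (k+1) := by rw [finrank_fin_fun]; omega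
  have hr : 2 ≤ k + 1 := by omega
  have hB := card_B (K := K) (V := Fin (n+1) → K) hq48 hq hr hV
  have hfl := card_flags (K := K) (V := Fin (n+1) → K) (N := n+1) (e := e) (c := k-1) (by rw [hV]; omega) (by omega)
  have hq4 : 4 ≤ q := by omega
  have e1 : n - k + 2 = e + 3 := by omega
  have hg : gaussBinom K (n + 1) (k - 1) * gaussBinom K (n - k + 2) 3 = (flags K (Fin (n+1) → K) e).card := by
    rw [hfl, e1]; rfl
  rw [hg, ← hδ, ← hB]
  -- existence
  have hflpos : 0 < (flags K (Fin (n+1) → K) e).card := by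
    obtain ⟨U, -, -, hU⟩ := exists_between (bot_le : (⊥ : Submodule K (Fin (n+1) → K)) ≤ ⊤) (e+3) (by simp)
      (by rw [finrank_top, hV]; omega)
    obtain ⟨T, -, hTU, hT⟩ := exists_between (bot_le : (⊥ : Submodule K (Fin (n+1) → K)) ≤ U) e (by simp)
      (by omega)
    exact card_pos.2 ⟨(U, T), by rw [flags, mem_filter]; exact ⟨mem_univ _, hU, hT, hTU⟩⟩
  have hpos : 0 < (univ.filter (fun S : Finset (Submodule K (Fin (n+1) → K)) => IsB q e (k+1) S)).card := by
    rw [hB, hδ]; positivity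
  obtain ⟨S0, hS0⟩ := card_pos.1 hpos
  have hS0 := (mem_filter.1 hS0).2
  obtain ⟨c0, rfl⟩ := toS_surj hS0.1
  have hc0 : c0 ≠ 0 := toS_zero.2 (nonempty_of_s (show 0 < s (toS c0) ⊤ by rw [hS0.2.2]; positivity))
  have hlow : ∀ c : PGPoint K n → ZMod 2, c ≠ 0 → InDualCode 2 k c → (q+2) * q ^ e ≤ wt c := by
    intro c h1 h2
    obtain ⟨P, hP⟩ := toS_zero.1 h1
    rw [wt_eq]
    exact (contain1 hq48 hq e (k+1) hr (toS c) (toS_pts c) ⊤ (by rw [finrank_top, hV]) ((dual_iff c).1 h2) P hP le_top).1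
  have hiff : ∀ c : PGPoint K n → ZMod 2, (c ≠ 0 ∧ InDualCode 2 k c ∧
        ∀ c' : PGPoint K n → ZMod 2, c' ≠ 0 → InDualCode 2 k c' → wt c ≤ wt c') ↔ IsB q e (k+1) (toS c) := by
    intro c
    constructor
    · rintro ⟨h1, h2, h3⟩
      refine ⟨toS_pts c, (dual_iff c).1 h2, ?_⟩
      have h4 := h3 c0 hc0 ((dual_iff c0).2 hS0.2.1)
      have h5 := hlow c h1 h2
      rw [wt_eq c0, hS0.2.2] at h4
      rw [← wt_eq]; omega
    · intro h
      have h1 : c ≠ 0 := toS_zero.2 (nonempty_of_s (show 0 < s (toS c) ⊤ by rw [h.2.2]; positivity))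
      refine ⟨h1, (dual_iff c).2 h.2.1, fun c' h2 h3 => ?_⟩
      rw [wt_eq c, h.2.2]
      exact hlow c' h2 h3
  rw [← Fintype.card_subtype, ← Nat.card_eq_fintype_card]
  apply Nat.card_congr
  refine Equiv.ofBijective (fun c => ⟨toS c.1, (hiff c.1).1 c.2⟩) ⟨?_, ?_⟩
  · intro c c' h
    exact Subtype.ext (toS_inj (congrArg Subtype.val h))
  · rintro ⟨S, hS⟩
    obtain ⟨c, rfl⟩ := toS_surj hS.1
    exact ⟨⟨c, (hiff c).2 hS⟩, rfl⟩
end HC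

open Submodule
set_option linter.unusedSectionVars false
set_option linter.unusedVariables false
namespace HC
open scoped Classical
open Finset Module

section NN
variable {K : Type*} [Field K] [Finite K]

/-- the hyperovals -/
noncomputable def H3 (K : Type*) [Field K] [Finite K] (q : ℕ) : Finset (Finset (Submodule K (Fin 3 → K))) :=
  univ.filter (fun O => IsH3 q O)

theorem mem_H3 {q : ℕ} {O : Finset (Submodule K (Fin 3 → K))} : O ∈ H3 K q ↔ IsH3 q O := by simp [H3]

/-- number of hyperovals containing `A` -/
noncomputable def NN (q : ℕ) (A : Finset (Submodule K (Fin 3 → K))) : ℕ :=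
  ((H3 K q).filter (fun O => A ⊆ O)).card

theorem s_top {V : Type*} [AddCommGroup V] [Module K V] [Finite V] (S : Finset (Submodule K V)) :
    s S ⊤ = S.card := by
  unfold s
  congr 1
  ext P; simp

theorem NN_step {q : ℕ} (A : Finset (Submodule K (Fin 3 → K))) :
    ∑ P ∈ ptsOf (⊤ : Submodule K (Fin 3 → K)) \ A, NN q (insert P A) = (q + 2 - A.card) * NN q A := by
  have h1 : ∀ P, NN q (insert P A) = ∑ O ∈ (H3 K q).filter (fun O => A ⊆ O), if P ∈ O then 1 else 0 := by
    intro P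
    rw [← card_filter, NN, filter_filter]
    congr 1
    ext O
    simp only [mem_filter, insert_subset_iff]
    tauto
  rw [sum_congr rfl (fun P _ => h1 P), sum_comm, mul_comm]
  apply sum_const_nat
  intro O hO
  obtain ⟨hO, hA⟩ := mem_filter.1 hO
  rw [mem_H3] at hO
  rw [← card_filter, ← hO.2.2, s_top, ← card_sdiff_of_subset hA]
  congr 1
  ext P
  simp only [mem_filter, mem_sdiff, mem_ptsOf]
  constructor
  · rintro ⟨⟨_, h⟩, h2⟩; exact ⟨h2, h⟩
  · rintro ⟨h, h2⟩; exact ⟨⟨⟨hO.1 P h, le_top⟩, h2⟩, h⟩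

theorem three_le_s {V : Type*} [AddCommGroup V] [Module K V] [Finite V] {S : Finset (Submodule K V)}
    {P Q R L : Submodule K V} (hP : P ∈ S) (hQ : Q ∈ S) (hR : R ∈ S) (h1 : P ≠ Q) (h2 : P ≠ R) (h3 : Q ≠ R)
    (l1 : P ≤ L) (l2 : Q ≤ L) (l3 : R ≤ L) : 3 ≤ s S L := by
  rw [← show ({P, Q, R} : Finset (Submodule K V)).card = 3 from card_eq_three.2 ⟨P, Q, R, h1, h2, h3, rfl⟩]
  apply card_le_card
  intro Z hZ
  simp only [mem_insert, mem_singleton] at hZ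
  rw [mem_filter]
  rcases hZ with rfl | rfl | rfl
  · exact ⟨hP, l1⟩
  · exact ⟨hQ, l2⟩
  · exact ⟨hR, l3⟩

theorem H3_count {q M : ℕ} (hq : Nat.card K = q)
    (hM : ∀ P0 P1 P2 : Submodule K (Fin 3 → K), finrank K P0 = 1 → finrank K P1 = 1 → finrank K P2 = 1 →
      P0 ≠ P1 → ¬ P2 ≤ P0 ⊔ P1 → NN q {P2, P1, P0} = M) :
    (q + 2) * (H3 K q).card = (q * q + q + 1) * (q ^ 2 * M) := by
  have hq1 := one_lt_q hq
  have h3 : finrank K (⊤ : Submodule K (Fin 3 → K)) = 3 := by rw [finrank_top, finrank_fin_fun]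
  have hpts : (ptsOf (⊤ : Submodule K (Fin 3 → K))).card = q * q + q + 1 := by
    rw [card_ptsOf hq, h3, th_three]
  have s2 : ∀ P0 P1 : Submodule K (Fin 3 → K), finrank K P0 = 1 → finrank K P1 = 1 → P0 ≠ P1 →
      NN q {P1, P0} = q * M := by
    intro P0 P1 p0 p1 hne
    have h := NN_step (q := q) ({P1, P0} : Finset (Submodule K (Fin 3 → K)))
    rw [card_pair hne.symm, Nat.add_sub_cancel] at h
    have hsub : (ptsOf (⊤ : Submodule K (Fin 3 → K))).filter (fun P => ¬ P ≤ P0 ⊔ P1) ⊆ ptsOf ⊤ \ {P1, P0} := by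
      intro P hP
      obtain ⟨a, b⟩ := mem_filter.1 hP
      rw [mem_sdiff, mem_insert, mem_singleton]
      refine ⟨a, ?_⟩
      rintro (rfl | rfl)
      · exact b le_sup_right
      · exact b le_sup_left
    rw [← sum_subset hsub, sum_const_nat (m := M), card_off hq le_top (by rw [h3, rank_line p0 p1 hne]),
      rank_line p0 p1 hne] at h
    · apply Nat.mul_left_cancel (show 0 < q by omega)
      rw [← h]; ring
    · intro P hP
      obtain ⟨a, b⟩ := mem_filter.1 hP
      exact hM P0 P1 P p0 p1 (mem_ptsOf.1 a).1 hne b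
    · intro P hP hn
      rw [mem_sdiff, mem_insert, mem_singleton] at hP
      obtain ⟨a, b⟩ := hP
      push Not at b
      rw [mem_filter] at hn
      have hle : P ≤ P0 ⊔ P1 := by
        by_contra h; exact hn ⟨a, h⟩
      rw [NN, card_eq_zero, filter_eq_empty_iff]
      intro O hO hA
      rw [mem_H3] at hO
      have t1 := three_le_s (L := P0 ⊔ P1) (hA (show P ∈ _ by simp)) (hA (show P1 ∈ _ by simp)) (hA (show P0 ∈ _ by simp))
        b.1 b.2 hne.symm hle le_sup_right le_sup_left
      have t2 := H3_line hq hO (rank_line p0 p1 hne)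
      omega
  have s1 : ∀ P0 : Submodule K (Fin 3 → K), finrank K P0 = 1 → NN q {P0} = q ^ 2 * M := by
    intro P0 p0
    have h := NN_step (q := q) ({P0} : Finset (Submodule K (Fin 3 → K)))
    rw [card_singleton, sum_const_nat (m := q * M), card_sdiff_of_subset
      (singleton_subset_iff.2 (mem_ptsOf.2 ⟨p0, le_top⟩)), hpts, card_singleton] at h
    · apply Nat.mul_left_cancel (show 0 < q + 1 by omega)
      rw [show q + 2 - 1 = q + 1 by omega] at h
      rw [← h, Nat.add_sub_cancel]; ring
    · intro P hP
      rw [mem_sdiff, mem_singleton] at hP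
      exact s2 P0 P p0 (mem_ptsOf.1 hP.1).1 (Ne.symm hP.2)
  have h := NN_step (q := q) (∅ : Finset (Submodule K (Fin 3 → K)))
  rw [card_empty, Nat.sub_zero, sdiff_empty, sum_const_nat (m := q ^ 2 * M), hpts] at h
  · rw [h]
    congr 2
    simp
  · intro P hP
    rw [insert_empty_eq]
    exact s1 P (mem_ptsOf.1 hP).1
end NN

/-- o-polynomials fixing `0` -/
def Cond {K : Type*} [Field K] (f : K → K) : Prop :=
  f 0 = 0 ∧ (∀ a b, a ≠ b → f a ≠ f b) ∧
    ∀ a b c, a ≠ b → a ≠ c → b ≠ c → (b - a) * (f c - f a) ≠ (c - a) * (f b - f a)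

section par
variable {K : Type*} [Field K] [Finite K]

/-- a basis -/
structure Bas (b0 b1 b2 : Fin 3 → K) : Prop where
  ind : ∀ x y z : K, x • b0 + y • b1 + z • b2 = 0 → x = 0 ∧ y = 0 ∧ z = 0
  sp : ∀ v, ∃ x y z : K, v = x • b0 + y • b1 + z • b2

variable {b0 b1 b2 : Fin 3 → K}

theorem Bas.inj (B : Bas b0 b1 b2) {x y z x' y' z' : K}
    (h : x • b0 + y • b1 + z • b2 = x' • b0 + y' • b1 + z' • b2) : x = x' ∧ y = y' ∧ z = z' := by
  have h1 := B.ind (x - x') (y - y') (z - z') (by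
    have := sub_eq_zero.2 h
    rw [← this, sub_smul, sub_smul, sub_smul]; abel)
  exact ⟨sub_eq_zero.1 h1.1, sub_eq_zero.1 h1.2.1, sub_eq_zero.1 h1.2.2⟩

/-- affine point -/
def ap (b0 b1 b2 : Fin 3 → K) (t y : K) : Submodule K (Fin 3 → K) := span K {b0 + t • b1 + y • b2}

theorem Bas.ap_inj (B : Bas b0 b1 b2) {t y t' y' : K} (h : ap b0 b1 b2 t y = ap b0 b1 b2 t' y') :
    t = t' ∧ y = y' := by
  obtain ⟨c, hc⟩ := Submodule.mem_span_singleton.1 (h ▸ mem_span_singleton_self _ :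
    b0 + t • b1 + y • b2 ∈ ap b0 b1 b2 t' y')
  have := B.inj (x := c) (y := c * t') (z := c * y') (x' := 1) (y' := t) (z' := y) (by
    rw [one_smul, ← hc, smul_add, smul_add, smul_smul, smul_smul])
  obtain ⟨rfl, h2, h3⟩ := this
  rw [one_mul] at h2 h3
  exact ⟨h2.symm, h3.symm⟩

theorem Bas.ap_ne1 (B : Bas b0 b1 b2) {t y : K} : ap b0 b1 b2 t y ≠ span K {b1} := by
  intro h
  obtain ⟨c, hc⟩ := Submodule.mem_span_singleton.1 (h ▸ mem_span_singleton_self _ :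
    b0 + t • b1 + y • b2 ∈ span K {b1})
  have := B.inj (x := 0) (y := c) (z := 0) (x' := 1) (y' := t) (z' := y) (by
    rw [one_smul, ← hc, zero_smul, zero_smul, zero_add, add_zero])
  exact zero_ne_one this.1

theorem Bas.ap_ne2 (B : Bas b0 b1 b2) {t y : K} : ap b0 b1 b2 t y ≠ span K {b2} := by
  intro h
  obtain ⟨c, hc⟩ := Submodule.mem_span_singleton.1 (h ▸ mem_span_singleton_self _ :
    b0 + t • b1 + y • b2 ∈ span K {b2})
  have := B.inj (x := 0) (y := 0) (z := c) (x' := 1) (y' := t) (z' := y) (by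
    rw [one_smul, ← hc, zero_smul, zero_smul, zero_add, zero_add])
  exact zero_ne_one this.1

theorem Bas.ne12 (B : Bas b0 b1 b2) : span K {b1} ≠ span K {b2} := by
  intro h
  obtain ⟨c, hc⟩ := Submodule.mem_span_singleton.1 (h ▸ mem_span_singleton_self _ : b1 ∈ span K {b2})
  have := B.inj (x := 0) (y := 0) (z := c) (x' := 0) (y' := 1) (z' := 0) (by
    rw [one_smul, ← hc, zero_smul, zero_smul, zero_smul]; abel)
  exact zero_ne_one this.2.1

theorem Bas.b1_ne (B : Bas b0 b1 b2) : b1 ≠ 0 := by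
  rintro rfl
  exact one_ne_zero (B.ind 0 1 0 (by simp)).2.1

theorem Bas.b2_ne (B : Bas b0 b1 b2) : b2 ≠ 0 := by
  rintro rfl
  exact one_ne_zero (B.ind 0 0 1 (by simp)).2.2

theorem Bas.ap_pt (B : Bas b0 b1 b2) (t y : K) : finrank K (ap b0 b1 b2 t y) = 1 := by
  apply rank_span
  intro h
  exact one_ne_zero (B.ind 1 t y (by rw [one_smul]; exact h)).1

/-- the set of affine points -/
noncomputable def apset (b0 b1 b2 : Fin 3 → K) (f : K → K) : Finset (Submodule K (Fin 3 → K)) :=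
  univ.filter (fun P => ∃ t, P = ap b0 b1 b2 t (f t))

/-- the hyperoval of `f` -/
noncomputable def Of (b0 b1 b2 : Fin 3 → K) (f : K → K) : Finset (Submodule K (Fin 3 → K)) :=
  insert (span K {b1}) (insert (span K {b2}) (apset b0 b1 b2 f))

theorem mem_apset {f : K → K} {P : Submodule K (Fin 3 → K)} :
    P ∈ apset b0 b1 b2 f ↔ ∃ t, P = ap b0 b1 b2 t (f t) := by simp [apset]

theorem Bas.card_apset (B : Bas b0 b1 b2) {q : ℕ} (hq : Nat.card K = q) (f : K → K) :
    (apset b0 b1 b2 f).card = q := by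
  have := Fintype.ofFinite K
  have h : apset b0 b1 b2 f = univ.image (fun t => ap b0 b1 b2 t (f t)) := by
    ext P
    rw [mem_apset, mem_image]
    exact ⟨fun ⟨t, ht⟩ => ⟨t, mem_univ _, ht.symm⟩, fun ⟨t, _, ht⟩ => ⟨t, ht.symm⟩⟩
  rw [h, card_image_of_injective _ (fun t t' h => (B.ap_inj h).1), card_univ, ← Nat.card_eq_fintype_card, hq]

theorem Bas.card_Of (B : Bas b0 b1 b2) {q : ℕ} (hq : Nat.card K = q) (f : K → K) :
    (Of b0 b1 b2 f).card = q + 2 := by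
  rw [Of, card_insert_of_notMem, card_insert_of_notMem, B.card_apset hq]
  · rw [mem_apset]; rintro ⟨t, ht⟩; exact B.ap_ne2 ht.symm
  · rw [mem_insert, mem_apset]
    rintro (h | ⟨t, ht⟩)
    · exact B.ne12 h
    · exact B.ap_ne1 ht.symm

theorem arc_H3 {q : ℕ} (hq : Nat.card K = q) {O : Finset (Submodule K (Fin 3 → K))} (hO : IsPts O)
    (hc : O.card = q + 2) (hL : ∀ L : Submodule K (Fin 3 → K), finrank K L = 2 → s O L ≤ 2) : IsH3 q O := by
  refine ⟨hO, ?_, by rw [s_top, hc]⟩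
  intro L _ hL2
  rcases Nat.eq_zero_or_pos (s O L) with h | h
  · rw [h]; exact Even.zero
  obtain ⟨P, hP, hPL⟩ := s_pos_iff.1 h
  have h1 := pencil_on hq hO hP le_top
  rw [finrank_top, finrank_fin_fun, show 3 - 1 = 2 from rfl, th_two, s_top, hc] at h1
  have hle : ∀ m ∈ pen P ⊤, s O m ≤ 2 := fun m hm => hL m (rank_of_mem_pen_pt (hO P hP) hm)
  have hcard : (pen P (⊤ : Submodule K (Fin 3 → K))).card = q + 1 := by
    rw [card_pen hq le_top, finrank_top, finrank_fin_fun, hO P hP, show 3 - 1 = 2 from rfl, th_two]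
  have h2 : ∑ m ∈ pen P ⊤, s O m = ∑ m ∈ pen P (⊤ : Submodule K (Fin 3 → K)), 2 := by
    rw [sum_const, hcard, smul_eq_mul]; omega
  have h3 := (sum_eq_sum_iff_of_le hle).1 h2 L (mem_pen.2 ⟨hPL, le_top, by rw [hL2, hO P hP]⟩)
  rw [h3]; exact even_two

theorem Bas.Of_H3 (B : Bas b0 b1 b2) {q : ℕ} (hq : Nat.card K = q) {f : K → K} (hf : Cond f) :
    IsH3 q (Of b0 b1 b2 f) := by
  have := Fintype.ofFinite K
  apply arc_H3 hq
  · intro P hP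
    rw [Of, mem_insert, mem_insert, mem_apset] at hP
    rcases hP with rfl | rfl | ⟨t, rfl⟩
    · exact rank_span B.b1_ne
    · exact rank_span B.b2_ne
    · exact B.ap_pt _ _
  · exact B.card_Of hq f
  · intro L hL
    have hlt : L < ⊤ := by
      rw [lt_top_iff_ne_top]
      rintro rfl
      rw [finrank_top, finrank_fin_fun] at hL; omega
    obtain ⟨g, hg0, hg⟩ := Submodule.exists_le_ker_of_lt_top L hlt
    -- the solutions
    set A : Finset K := univ.filter (fun t => g b0 + t * g b1 + f t * g b2 = 0) with hA
    have hsub : (Of b0 b1 b2 f).filter (fun P => P ≤ L) ⊆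
        (if g b1 = 0 then {span K {b1}} else ∅) ∪ (if g b2 = 0 then {span K {b2}} else ∅) ∪
          A.image (fun t => ap b0 b1 b2 t (f t)) := by
      intro P hP
      obtain ⟨h1, h2⟩ := mem_filter.1 hP
      rw [Of, mem_insert, mem_insert, mem_apset] at h1
      rw [mem_union, mem_union]
      rcases h1 with rfl | rfl | ⟨t, rfl⟩
      · have h3 : g b1 = 0 := hg (span_le_iff.1 h2)
        left; left; rw [if_pos h3]; simp
      · have h3 : g b2 = 0 := hg (span_le_iff.1 h2)
        left; right; rw [if_pos h3]; simp
      · right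
        rw [mem_image]
        refine ⟨t, ?_, rfl⟩
        rw [hA, mem_filter]
        refine ⟨mem_univ _, ?_⟩
        have h3 : g (b0 + t • b1 + f t • b2) = 0 := hg (span_le_iff.1 h2)
        rwa [map_add, map_add, map_smul, map_smul, smul_eq_mul, smul_eq_mul] at h3
    have h1 := card_le_card hsub
    have h2 := (card_union_le ((if g b1 = 0 then {span K {b1}} else ∅) ∪ (if g b2 = 0 then {span K {b2}} else ∅))
      (A.image (fun t => ap b0 b1 b2 t (f t))))
    have h3 := card_union_le (if g b1 = 0 then ({span K {b1}} : Finset (Submodule K (Fin 3 → K))) else ∅) (if g b2 = 0 then {span K {b2}} else ∅)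
    have h4 : (A.image (fun t => ap b0 b1 b2 t (f t))).card ≤ A.card := card_image_le
    unfold s
    obtain ⟨f0, f1, f2⟩ := hf
    have hmem : ∀ t, t ∈ A ↔ g b0 + t * g b1 + f t * g b2 = 0 := by intro t; rw [hA, mem_filter]; simp
    by_cases c1 : g b1 = 0
    · by_cases c2 : g b2 = 0
      · have : A = ∅ := by
          rw [eq_empty_iff_forall_notMem]
          intro t ht
          rw [hmem, c1, c2, mul_zero, mul_zero, add_zero, add_zero] at ht
          apply hg0
          apply LinearMap.ext
          intro v
          obtain ⟨x, y, z, rfl⟩ := B.sp v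
          simp [c1, c2, ht]
        simp only [c1, c2, if_true, card_singleton, this, card_empty] at h1 h2 h3 h4
        omega
      · have : A.card ≤ 1 := by
          rw [card_le_one]
          intro t ht t' ht'
          rw [hmem, c1] at ht ht'
          by_contra hne
          apply f1 t t' hne
          apply mul_right_cancel₀ c2
          linear_combination ht - ht'
        simp only [c1, c2, if_true, if_false, card_singleton, card_empty] at h1 h2 h3 h4
        omega
    · by_cases c2 : g b2 = 0
      · have : A.card ≤ 1 := by
          rw [card_le_one]
          intro t ht t' ht'
          rw [hmem, c2] at ht ht'
          apply mul_right_cancel₀ c1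
          linear_combination ht - ht'
        simp only [c1, c2, if_true, if_false, card_singleton, card_empty] at h1 h2 h3 h4
        omega
      · have : A.card ≤ 2 := by
          by_contra hcon
          obtain ⟨a, ha, b, hb, c, hc, n1, n2, n3⟩ := two_lt_card.1 (not_le.1 hcon)
          rw [hmem] at ha hb hc
          apply f2 a b c n1 n2 n3
          apply mul_right_cancel₀ c2
          linear_combination (b - a) * (hc - ha) - (c - a) * (hb - ha)
        simp only [c1, c2, if_false, card_empty] at h1 h2 h3 h4
        omega

theorem Bas.exists_f (B : Bas b0 b1 b2) {q : ℕ} (hq : Nat.card K = q) {O : Finset (Submodule K (Fin 3 → K))}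
    (hO : IsH3 q O) (h0 : span K {b0} ∈ O) (h1 : span K {b1} ∈ O) (h2 : span K {b2} ∈ O) :
    ∃ f, Cond f ∧ Of b0 b1 b2 f = O := by
  have hq1 := one_lt_q hq
  have hex : ∀ t : K, ∃ y, ap b0 b1 b2 t y ∈ O ∧ (t = 0 → y = 0) := by
    intro t
    by_cases ht : t = 0
    · refine ⟨0, ?_, fun _ => rfl⟩
      rw [ht, ap, zero_smul, zero_smul, add_zero, add_zero]; exact h0
    · have hl2 := rank_line (B.ap_pt t 0) (rank_span B.b2_ne) B.ap_ne2
      have hev := hO.2.1 _ le_top hl2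
      have hpos : 0 < s O (ap b0 b1 b2 t 0 ⊔ span K {b2}) := s_pos_iff.2 ⟨_, h2, le_sup_right⟩
      obtain ⟨Q, hQ, hQL, hQ2⟩ := exists_of_lt_s (S := O) (U := span K {b2}) (W := ap b0 b1 b2 t 0 ⊔ span K {b2}) (by
        rw [s_pt_mem hO.1 h2]
        obtain ⟨u, hu⟩ := hev; omega)
      obtain ⟨v, hv, rfl⟩ := exists_span (hO.1 Q hQ)
      obtain ⟨v1, hv1, v2, hv2, rfl⟩ := Submodule.mem_sup.1 (span_le_iff.1 hQL)
      obtain ⟨x, rfl⟩ := Submodule.mem_span_singleton.1 hv1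
      obtain ⟨z, rfl⟩ := Submodule.mem_span_singleton.1 hv2
      have hx : x ≠ 0 := by
        rintro rfl
        apply hQ2
        rw [span_le_iff, zero_smul, zero_add]
        exact Submodule.smul_mem _ _ (mem_span_singleton_self _)
      refine ⟨x⁻¹ * z, ?_, fun h => absurd h ht⟩
      have : b0 + t • b1 + (x⁻¹ * z) • b2 = x⁻¹ • (x • (b0 + t • b1 + (0:K) • b2) + z • b2) := by
        rw [smul_add, smul_smul, smul_smul, inv_mul_cancel₀ hx, one_smul, zero_smul, add_zero]
      rw [ap, this, span_unit (inv_ne_zero hx)]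
      exact hQ
  choose f hf hf0 using hex
  have hsub : Of b0 b1 b2 f ⊆ O := by
    intro P hP
    rw [Of, mem_insert, mem_insert, mem_apset] at hP
    rcases hP with rfl | rfl | ⟨t, rfl⟩
    · exact h1
    · exact h2
    · exact hf t
  refine ⟨f, ⟨hf0 0 rfl, ?_, ?_⟩, eq_of_subset_of_card_le hsub (by rw [B.card_Of hq, ← hO.2.2, s_top])⟩
  · intro a b hab he
    have hne : ap b0 b1 b2 a (f a) ≠ ap b0 b1 b2 b (f b) := fun h => hab (B.ap_inj h).1
    have hl2 := rank_line (B.ap_pt a (f a)) (B.ap_pt b (f b)) hne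
    have t1 := three_le_s (L := ap b0 b1 b2 a (f a) ⊔ ap b0 b1 b2 b (f b)) (hf a) (hf b) h1 hne B.ap_ne1 B.ap_ne1 le_sup_left le_sup_right (by
      rw [span_le_iff, ← Submodule.smul_mem_iff _ (sub_ne_zero.2 hab)]
      have : (a - b) • b1 = (b0 + a • b1 + f a • b2) - (b0 + b • b1 + f b • b2) := by
        rw [he, sub_smul]; abel
      rw [this]
      exact Submodule.sub_mem _ ((le_sup_left : ap b0 b1 b2 a (f a) ≤ _) (mem_span_singleton_self _))
        ((le_sup_right : ap b0 b1 b2 b (f b) ≤ _) (mem_span_singleton_self _)))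
    have t2 := H3_line hq hO hl2
    omega
  · intro a b c hab hac hbc he
    have hne : ap b0 b1 b2 a (f a) ≠ ap b0 b1 b2 b (f b) := fun h => hab (B.ap_inj h).1
    have hne2 : ap b0 b1 b2 a (f a) ≠ ap b0 b1 b2 c (f c) := fun h => hac (B.ap_inj h).1
    have hne3 : ap b0 b1 b2 b (f b) ≠ ap b0 b1 b2 c (f c) := fun h => hbc (B.ap_inj h).1
    have hl2 := rank_line (B.ap_pt a (f a)) (B.ap_pt b (f b)) hne
    have t1 := three_le_s (L := ap b0 b1 b2 a (f a) ⊔ ap b0 b1 b2 b (f b)) (hf a) (hf b) (hf c) hne hne2 hne3 le_sup_left le_sup_right (by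
      rw [ap, ap, ap, span_le_iff, ← Submodule.smul_mem_iff _ (sub_ne_zero.2 hab.symm)]
      have : (b - a) • (b0 + c • b1 + f c • b2) = (b - c) • (b0 + a • b1 + f a • b2) + (c - a) • (b0 + b • b1 + f b • b2) := by
        have e1 : (b - a) * f c = (b - c) * f a + (c - a) * f b := by linear_combination he
        simp only [smul_add, smul_smul, e1]
        module
      rw [this]
      exact Submodule.add_mem _ (Submodule.smul_mem _ _ ((le_sup_left : ap b0 b1 b2 a (f a) ≤ _) (mem_span_singleton_self _)))
        (Submodule.smul_mem _ _ ((le_sup_right : ap b0 b1 b2 b (f b) ≤ _) (mem_span_singleton_self _))))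
    have t2 := H3_line hq hO hl2
    omega

theorem Bas.count (B : Bas b0 b1 b2) {q : ℕ} (hq : Nat.card K = q) :
    NN q {span K {b2}, span K {b1}, span K {b0}} = Nat.card {f : K → K // Cond f} := by
  have := Fintype.ofFinite K
  rw [NN, Nat.card_eq_fintype_card, Fintype.card_subtype]
  symm
  apply card_bij (fun f _ => Of b0 b1 b2 f)
  · intro f hf
    have hf := (mem_filter.1 hf).2
    rw [mem_filter, mem_H3]
    refine ⟨B.Of_H3 hq hf, ?_⟩
    intro P hP
    simp only [mem_insert, mem_singleton] at hP
    rw [Of, mem_insert, mem_insert, mem_apset]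
    rcases hP with rfl | rfl | rfl
    · right; left; rfl
    · left; rfl
    · right; right
      refine ⟨0, ?_⟩
      rw [hf.1, ap, zero_smul, zero_smul, add_zero, add_zero]
  · intro f hf g hg h
    funext t
    have h1 : ap b0 b1 b2 t (f t) ∈ Of b0 b1 b2 g := by
      rw [← h, Of, mem_insert, mem_insert, mem_apset]
      exact Or.inr (Or.inr ⟨t, rfl⟩)
    rw [Of, mem_insert, mem_insert, mem_apset] at h1
    rcases h1 with h1 | h1 | ⟨t', h1⟩
    · exact absurd h1 B.ap_ne1
    · exact absurd h1 B.ap_ne2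
    · obtain ⟨rfl, h2⟩ := B.ap_inj h1
      exact h2
  · intro O hO
    rw [mem_filter, mem_H3] at hO
    obtain ⟨hO, hA⟩ := hO
    obtain ⟨f, hf, hfO⟩ := B.exists_f hq hO (hA (by simp)) (hA (by simp)) (hA (by simp))
    exact ⟨f, mem_filter.2 ⟨mem_univ _, hf⟩, hfO⟩

theorem exists_bas {P0 P1 P2 : Submodule K (Fin 3 → K)} (h0 : finrank K P0 = 1) (h1 : finrank K P1 = 1)
    (h2 : finrank K P2 = 1) (hne : P0 ≠ P1) (hn : ¬ P2 ≤ P0 ⊔ P1) :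
    ∃ b0 b1 b2, Bas b0 b1 b2 ∧ P0 = span K {b0} ∧ P1 = span K {b1} ∧ P2 = span K {b2} := by
  obtain ⟨b0, n0, rfl⟩ := exists_span h0
  obtain ⟨b1, n1, rfl⟩ := exists_span h1
  obtain ⟨b2, n2, rfl⟩ := exists_span h2
  refine ⟨b0, b1, b2, ⟨?_, ?_⟩, rfl, rfl, rfl⟩
  · intro x y z h
    have m0 : b0 ∈ span K {b0} ⊔ span K {b1} := (le_sup_left : span K {b0} ≤ _) (mem_span_singleton_self _)
    have m1 : b1 ∈ span K {b0} ⊔ span K {b1} := (le_sup_right : span K {b1} ≤ _) (mem_span_singleton_self _)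
    have hz : z = 0 := by
      by_contra hz
      apply hn
      rw [span_le_iff, ← Submodule.smul_mem_iff _ hz]
      have : z • b2 = -(x • b0 + y • b1) := by rw [eq_neg_iff_add_eq_zero, add_comm]; exact h
      rw [this]
      exact Submodule.neg_mem _ (Submodule.add_mem _ (Submodule.smul_mem _ _ m0) (Submodule.smul_mem _ _ m1))
    subst hz
    rw [zero_smul, add_zero] at h
    have hy : y = 0 := by
      by_contra hy
      apply hne
      symm
      apply pt_eq h1 h0
      rw [span_le_iff, ← Submodule.smul_mem_iff _ hy]
      have : y • b1 = -(x • b0) := by rw [eq_neg_iff_add_eq_zero, add_comm]; exact h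
      rw [this]
      exact Submodule.neg_mem _ (Submodule.smul_mem _ _ (mem_span_singleton_self _))
    subst hy
    rw [zero_smul, add_zero] at h
    exact ⟨(smul_eq_zero.1 h).resolve_right n0, rfl, rfl⟩
  · intro v
    have htop : span K {b0} ⊔ span K {b1} ⊔ span K {b2} = ⊤ := by
      apply eq_of_le_rank le_top
      rw [rank_sup_pt h2 hn, rank_line h0 h1 hne, finrank_top, finrank_fin_fun]
    have hv : v ∈ span K {b0} ⊔ span K {b1} ⊔ span K {b2} := htop ▸ Submodule.mem_top
    obtain ⟨w, hw, w2, hw2, rfl⟩ := Submodule.mem_sup.1 hv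
    obtain ⟨w0, hw0, w1, hw1, rfl⟩ := Submodule.mem_sup.1 hw
    obtain ⟨x, rfl⟩ := Submodule.mem_span_singleton.1 hw0
    obtain ⟨y, rfl⟩ := Submodule.mem_span_singleton.1 hw1
    obtain ⟨z, rfl⟩ := Submodule.mem_span_singleton.1 hw2
    exact ⟨x, y, z, rfl⟩

theorem H3_final {q : ℕ} (hq : Nat.card K = q) :
    (q + 2) * (H3 K q).card = (q * q + q + 1) * (q ^ 2 * Nat.card {f : K → K // Cond f}) := by
  apply H3_count hq
  intro P0 P1 P2 h0 h1 h2 hne hn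
  obtain ⟨b0, b1, b2, B, rfl, rfl, rfl⟩ := exists_bas h0 h1 h2 hne hn
  exact B.count hq
end par
end HC

open Submodule
set_option linter.unusedSectionVars false
set_option linter.unusedVariables false
namespace HC
open scoped Classical
open Finset Module

section Enum

/-- the triple condition on codes -/
def trip (mul : ℕ → ℕ → ℕ) (a x b y c z : ℕ) : Bool :=
  mul (b ^^^ a) (z ^^^ x) != mul (c ^^^ a) (y ^^^ x)

def new2 (mul : ℕ → ℕ → ℕ) (m v i w : ℕ) : List ℕ → Bool
  | [] => true
  | u :: l => trip mul l.length u i w m v && new2 mul m v i w l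

def new1 (mul : ℕ → ℕ → ℕ) (m v : ℕ) : List ℕ → Bool
  | [] => true
  | w :: l => (v != w) && (new2 mul m v l.length w l && new1 mul m v l)

def newv (mul : ℕ → ℕ → ℕ) (l : List ℕ) (v : ℕ) : Bool :=
  (l.length != 0 || v == 0) && new1 mul l.length v l

def enum (q : ℕ) (mul : ℕ → ℕ → ℕ) : ℕ → List (List ℕ)
  | 0 => [[]]
  | m + 1 => (enum q mul m).flatMap (fun l => ((List.range q).filter (newv mul l)).map (· :: l))

def mulT (h q M x y : ℕ) : ℕ := (M >>> (h * (q * x + y))) % q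

def M4 : ℕ := 2625168384
def M8 : ℕ := 2821848294356612419217921029917578219971947684264937521152
theorem enum4 : (enum 4 (mulT 2 4 M4) 4).length = 3 := by decide +kernel
theorem enum8 : (enum 8 (mulT 3 8 M8) 8).length = 70 := by decide +kernel

/-- field of order four -/
def F4 := Fin 4
/-- field of order eight -/
def F8 := Fin 8
instance : Fintype F4 := inferInstanceAs (Fintype (Fin 4))
instance : Fintype F8 := inferInstanceAs (Fintype (Fin 8))
instance : DecidableEq F4 := inferInstanceAs (DecidableEq (Fin 4))
instance : DecidableEq F8 := inferInstanceAs (DecidableEq (Fin 8))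

def F4.add (x y : F4) : F4 := Fin.ofNat 4 (x.val ^^^ y.val)
def F4.mul (x y : F4) : F4 := Fin.ofNat 4 (mulT 2 4 M4 x.val y.val)
def F4.inv (x : F4) : F4 := Fin.ofNat 4 (180 >>> (2 * x.val))
def F8.add (x y : F8) : F8 := Fin.ofNat 8 (x.val ^^^ y.val)
def F8.mul (x y : F8) : F8 := Fin.ofNat 8 (mulT 3 8 M8 x.val y.val)
def F8.inv (x : F8) : F8 := Fin.ofNat 8 (9272648 >>> (3 * x.val))

instance : Zero F4 := ⟨(0 : Fin 4)⟩
instance : One F4 := ⟨(1 : Fin 4)⟩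
instance : Add F4 := ⟨F4.add⟩
instance : Mul F4 := ⟨F4.mul⟩
instance : Neg F4 := ⟨fun x => x⟩
instance : Zero F8 := ⟨(0 : Fin 8)⟩
instance : One F8 := ⟨(1 : Fin 8)⟩
instance : Add F8 := ⟨F8.add⟩
instance : Mul F8 := ⟨F8.mul⟩
instance : Neg F8 := ⟨fun x => x⟩

instance : Field F4 where
  add_assoc := by decide +kernel
  zero_add := by decide +kernel
  add_zero := by decide +kernel
  add_comm := by decide +kernel
  nsmul := nsmulRec
  zsmul := zsmulRec
  neg_add_cancel := by decide +kernel
  sub := F4.add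
  sub_eq_add_neg := by intros; rfl
  left_distrib := by decide +kernel
  right_distrib := by decide +kernel
  zero_mul := by decide +kernel
  mul_zero := by decide +kernel
  mul_assoc := by decide +kernel
  one_mul := by decide +kernel
  mul_one := by decide +kernel
  mul_comm := by decide +kernel
  inv := F4.inv
  exists_pair_ne := by decide +kernel
  mul_inv_cancel := by decide +kernel
  inv_zero := by decide +kernel
  nnqsmul := _
  nnqsmul_def := fun _ _ => rfl
  qsmul := _
  qsmul_def := fun _ _ => rfl

instance : Field F8 where
  add_assoc := by decide +kernel
  zero_add := by decide +kernel
  add_zero := by decide +kernel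
  add_comm := by decide +kernel
  nsmul := nsmulRec
  zsmul := zsmulRec
  neg_add_cancel := by decide +kernel
  sub := F8.add
  sub_eq_add_neg := by intros; rfl
  left_distrib := by decide +kernel
  right_distrib := by decide +kernel
  zero_mul := by decide +kernel
  mul_zero := by decide +kernel
  mul_assoc := by decide +kernel
  one_mul := by decide +kernel
  mul_one := by decide +kernel
  mul_comm := by decide +kernel
  inv := F8.inv
  exists_pair_ne := by decide +kernel
  mul_inv_cancel := by decide +kernel
  inv_zero := by decide +kernel
  nnqsmul := _
  nnqsmul_def := fun _ _ => rfl
  qsmul := _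
  qsmul_def := fun _ _ => rfl

/-- coordinates for the field `K` -/
structure Coord (K : Type*) [Field K] (q : ℕ) (mul : ℕ → ℕ → ℕ) (ι : Fin q ≃ K) : Prop where
  zero : ∀ x : Fin q, x.val = 0 ↔ ι x = 0
  sub : ∀ x y : Fin q, ∃ z : Fin q, z.val = x.val ^^^ y.val ∧ ι z = ι x - ι y
  mul : ∀ x y : Fin q, ∃ z : Fin q, z.val = mul x.val y.val ∧ ι z = ι x * ι y

theorem coord4 {K : Type*} [Field K] [Finite K] (h : Nat.card K = 4) :
    ∃ ι : Fin 4 ≃ K, Coord K 4 (mulT 2 4 M4) ι := by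
  have := Fintype.ofFinite K
  let e : F4 ≃+* K := FiniteField.ringEquivOfCardEq (by
    rw [← Nat.card_eq_fintype_card (α := K), h]; rfl)
  have hz : ∀ x : F4, e x = 0 ↔ x = 0 := by simp
  have hs : ∀ x y : F4, e (x - y) = e x - e y := map_sub e
  have hm : ∀ x y : F4, e (x * y) = e x * e y := map_mul e
  refine ⟨e.toEquiv, ⟨fun x => ?_, fun x y => ⟨F4.add x y, ?_, ?_⟩, fun x y => ⟨F4.mul x y, ?_, ?_⟩⟩⟩
  · have h1 := hz x
    have h2 : ∀ x : Fin 4, x.val = 0 ↔ x = 0 := by decide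
    exact (h2 x).trans h1.symm
  · revert x y; unfold F4.add; decide +kernel
  · exact hs x y
  · revert x y; unfold F4.mul; decide +kernel
  · exact hm x y

theorem coord8 {K : Type*} [Field K] [Finite K] (h : Nat.card K = 8) :
    ∃ ι : Fin 8 ≃ K, Coord K 8 (mulT 3 8 M8) ι := by
  have := Fintype.ofFinite K
  let e : F8 ≃+* K := FiniteField.ringEquivOfCardEq (by
    rw [← Nat.card_eq_fintype_card (α := K), h]; rfl)
  have hz : ∀ x : F8, e x = 0 ↔ x = 0 := by simp
  have hs : ∀ x y : F8, e (x - y) = e x - e y := map_sub e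
  have hm : ∀ x y : F8, e (x * y) = e x * e y := map_mul e
  refine ⟨e.toEquiv, ⟨fun x => ?_, fun x y => ⟨F8.add x y, ?_, ?_⟩, fun x y => ⟨F8.mul x y, ?_, ?_⟩⟩⟩
  · have h1 := hz x
    have h2 : ∀ x : Fin 8, x.val = 0 ↔ x = 0 := by decide
    exact (h2 x).trans h1.symm
  · revert x y; unfold F8.add; decide +kernel
  · exact hs x y
  · revert x y; unfold F8.mul; decide +kernel
  · exact hm x y

end Enum
end HC

open Submodule
set_option linter.unusedSectionVars false
set_option linter.unusedVariables false
namespace HC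
open scoped Classical
open Finset Module

section EnumCount
variable {q : ℕ} {mul : ℕ → ℕ → ℕ}

def okl (q : ℕ) (mul : ℕ → ℕ → ℕ) : List ℕ → Prop
  | [] => True
  | v :: l => (v < q ∧ newv mul l v = true) ∧ okl q mul l

theorem mem_enum (m : ℕ) (l : List ℕ) : l ∈ enum q mul m ↔ l.length = m ∧ okl q mul l := by
  induction m generalizing l with
  | zero =>
    simp only [enum, List.mem_singleton, List.length_eq_zero_iff]
    constructor
    · rintro rfl; exact ⟨rfl, trivial⟩
    · exact fun h => h.1
  | succ m ih =>
    simp only [enum, List.mem_flatMap, List.mem_map, List.mem_filter, List.mem_range, ih]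
    constructor
    · rintro ⟨l', ⟨h1, h2⟩, v, h3, rfl⟩
      exact ⟨by simp [h1], h3, h2⟩
    · rintro ⟨h1, h2⟩
      cases l with
      | nil => simp at h1
      | cons v l' => exact ⟨l', ⟨by simpa using h1, h2.2⟩, v, h2.1, rfl⟩

theorem nodup_enum (m : ℕ) : (enum q mul m).Nodup := by
  induction m with
  | zero => simp [enum]
  | succ m ih =>
    rw [enum, List.nodup_flatMap]
    refine ⟨fun l _ => ?_, ?_⟩
    · apply List.Nodup.map
      · intro a b h; simpa using h
      · exact List.nodup_range.filter _
    · refine ih.imp ?_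
      intro a b hab l h1 h2
      simp only [List.mem_map] at h1 h2
      obtain ⟨v, _, rfl⟩ := h1
      obtain ⟨w, _, h⟩ := h2
      simp only [List.cons.injEq] at h
      exact hab h.2.symm

def listOf (g : ℕ → ℕ) : ℕ → List ℕ
  | 0 => []
  | m + 1 => g m :: listOf g m

theorem length_listOf (g : ℕ → ℕ) (m : ℕ) : (listOf g m).length = m := by
  induction m with
  | zero => rfl
  | succ m ih => simp [listOf, ih]

theorem listOf_eq (g g' : ℕ → ℕ) (m : ℕ) : listOf g m = listOf g' m ↔ ∀ i < m, g i = g' i := by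
  induction m with
  | zero => simp [listOf]
  | succ m ih =>
    simp only [listOf, List.cons.injEq, ih, Nat.lt_succ_iff_lt_or_eq]
    constructor
    · rintro ⟨h1, h2⟩ i (h | rfl)
      · exact h2 i h
      · exact h1
    · exact fun h => ⟨h m (Or.inr rfl), fun i hi => h i (Or.inl hi)⟩

theorem exists_listOf (l : List ℕ) : ∃ g, listOf g l.length = l := by
  induction l with
  | nil => exact ⟨fun _ => 0, rfl⟩
  | cons v l ih =>
    obtain ⟨g, hg⟩ := ih
    refine ⟨Function.update g l.length v, ?_⟩
    simp only [List.length_cons, listOf, Function.update_self, List.cons.injEq, true_and]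
    rw [← hg, length_listOf, listOf_eq]
    intro i hi
    rw [Function.update_of_ne hi.ne]

theorem new2_listOf (m v i w : ℕ) (g : ℕ → ℕ) (j : ℕ) :
    new2 mul m v i w (listOf g j) = true ↔ ∀ k < j, trip mul k (g k) i w m v = true := by
  induction j with
  | zero => simp [listOf, new2]
  | succ j ih =>
    simp only [listOf, new2, length_listOf, Bool.and_eq_true, ih, Nat.lt_succ_iff_lt_or_eq]
    constructor
    · rintro ⟨h1, h2⟩ k (h | rfl)
      · exact h2 k h
      · exact h1
    · exact fun h => ⟨h j (Or.inr rfl), fun i hi => h i (Or.inl hi)⟩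

theorem new1_listOf (m v : ℕ) (g : ℕ → ℕ) (i : ℕ) :
    new1 mul m v (listOf g i) = true ↔
      ∀ j < i, v ≠ g j ∧ ∀ k < j, trip mul k (g k) j (g j) m v = true := by
  induction i with
  | zero => simp [listOf, new1]
  | succ j ih =>
    simp only [listOf, new1, length_listOf, Bool.and_eq_true, ih, Nat.lt_succ_iff_lt_or_eq,
      new2_listOf, bne_iff_ne]
    constructor
    · rintro ⟨h1, h2, h3⟩ k (h | rfl)
      · exact h3 k h
      · exact ⟨h1, h2⟩
    · exact fun h => ⟨(h j (Or.inr rfl)).1, (h j (Or.inr rfl)).2, fun i hi => h i (Or.inl hi)⟩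

theorem okl_listOf (g : ℕ → ℕ) (m : ℕ) :
    okl q mul (listOf g m) ↔ ∀ i < m, g i < q ∧ (i = 0 → g i = 0) ∧
      ∀ j < i, g i ≠ g j ∧ ∀ k < j, trip mul k (g k) j (g j) i (g i) = true := by
  induction m with
  | zero => simp [listOf, okl]
  | succ m ih =>
    simp only [listOf, okl, ih, newv, length_listOf, Bool.and_eq_true, new1_listOf,
      Nat.lt_succ_iff_lt_or_eq, Bool.or_eq_true, bne_iff_ne, beq_iff_eq]
    constructor
    · rintro ⟨⟨h1, h2, h3⟩, h4⟩ k (h | rfl)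
      · exact h4 k h
      · exact ⟨h1, fun h => h2.resolve_left (fun h' => h' h), h3⟩
    · intro h
      obtain ⟨h1, h2, h3⟩ := h m (Or.inr rfl)
      refine ⟨⟨h1, ?_, h3⟩, fun i hi => h i (Or.inl hi)⟩
      by_cases hm : m = 0
      · exact Or.inr (h2 hm)
      · exact Or.inl hm

variable {K : Type*} [Field K] {ι : Fin q ≃ K}

theorem Coord.trip_iff (C : Coord K q mul ι) (a x b y c z : Fin q) :
    trip mul a x b y c z = true ↔ (ι b - ι a) * (ι z - ι x) ≠ (ι c - ι a) * (ι y - ι x) := by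
  obtain ⟨z1, h1, e1⟩ := C.sub b a
  obtain ⟨z2, h2, e2⟩ := C.sub z x
  obtain ⟨z3, h3, e3⟩ := C.sub c a
  obtain ⟨z4, h4, e4⟩ := C.sub y x
  obtain ⟨w1, k1, l1⟩ := C.mul z1 z2
  obtain ⟨w2, k2, l2⟩ := C.mul z3 z4
  rw [trip, bne_iff_ne, ← h1, ← h2, ← h3, ← h4, ← k1, ← k2, ← e1, ← e2, ← e3, ← e4, ← l1, ← l2,
    Ne, Ne, ← Fin.ext_iff, ι.apply_eq_iff_eq]

noncomputable def GG (ι : Fin q ≃ K) (f : K → K) (i : ℕ) : ℕ :=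
  if h : i < q then (ι.symm (f (ι ⟨i, h⟩))).val else 0

theorem GG_eq (f : K → K) (i : Fin q) : GG ι f i = (ι.symm (f (ι i))).val := by
  simp [GG]

theorem Coord.cond_iff (C : Coord K q mul ι) (f : K → K) :
    Cond f ↔ okl q mul (listOf (GG ι f) q) := by
  rw [okl_listOf]
  have hF : (∀ i < q, GG ι f i < q ∧ (i = 0 → GG ι f i = 0) ∧
      ∀ j < i, GG ι f i ≠ GG ι f j ∧ ∀ k < j, trip mul k (GG ι f k) j (GG ι f j) i (GG ι f i) = true) ↔
      (∀ i : Fin q, (ι i = 0 → f (ι i) = 0) ∧ ∀ j : Fin q, j < i → f (ι i) ≠ f (ι j) ∧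
        ∀ k : Fin q, k < j → (ι j - ι k) * (f (ι i) - f (ι k)) ≠ (ι i - ι k) * (f (ι j) - f (ι k))) := by
    have z1 : ∀ i : Fin q, (ι.symm (f (ι i))).val = 0 ↔ f (ι i) = 0 := fun i => by
      rw [C.zero]; simp
    have z2 : ∀ i j : Fin q, GG ι f i = GG ι f j ↔ f (ι i) = f (ι j) := fun i j => by
      rw [GG_eq, GG_eq, ← Fin.ext_iff, ι.symm.apply_eq_iff_eq]
    have z3 : ∀ i j k : Fin q, trip mul k (GG ι f k) j (GG ι f j) i (GG ι f i) = true ↔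
        (ι j - ι k) * (f (ι i) - f (ι k)) ≠ (ι i - ι k) * (f (ι j) - f (ι k)) := fun i j k => by
      rw [GG_eq, GG_eq, GG_eq, C.trip_iff]; simp
    constructor
    · intro h i
      obtain ⟨_, h2, h3⟩ := h i i.2
      refine ⟨fun h => ?_, fun j hj => ?_⟩
      · rw [← C.zero] at h
        rw [← z1, ← GG_eq]
        exact h2 h
      · obtain ⟨h4, h5⟩ := h3 j hj
        rw [Ne, z2] at h4
        exact ⟨h4, fun k hk => (z3 i j k).1 (h5 k hk)⟩
    · intro h i hi
      obtain ⟨h1, h2⟩ := h ⟨i, hi⟩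
      refine ⟨?_, fun h0 => ?_, fun j hj => ?_⟩
      · rw [show i = ((⟨i, hi⟩ : Fin q) : ℕ) from rfl, GG_eq]; exact Fin.is_lt _
      · rw [show i = ((⟨i, hi⟩ : Fin q) : ℕ) from rfl, GG_eq, z1]
        exact h1 ((C.zero _).1 h0)
      · obtain ⟨h3, h4⟩ := h2 ⟨j, hj.trans hi⟩ hj
        refine ⟨fun h5 => h3 ((z2 _ _).1 h5), fun k hk => ?_⟩
        exact (z3 ⟨i, hi⟩ ⟨j, hj.trans hi⟩ ⟨k, (hk.trans hj).trans hi⟩).2 (h4 ⟨k, _⟩ hk)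
  rw [hF]
  constructor
  · rintro ⟨h0, h1, h2⟩ i
    refine ⟨fun h => by rw [h, h0], fun j hj => ⟨h1 _ _ (ι.injective.ne hj.ne'), fun k hk => ?_⟩⟩
    exact h2 _ _ _ (ι.injective.ne hk.ne) (ι.injective.ne (hk.trans hj).ne) (ι.injective.ne hj.ne)
  · intro h
    have hT : ∀ i j k : Fin q, k < j → j < i →
        (ι j - ι k) * (f (ι i) - f (ι k)) ≠ (ι i - ι k) * (f (ι j) - f (ι k)) :=
      fun i j k h1 h2 => ((h i).2 j h2).2 k h1
    refine ⟨?_, ?_, ?_⟩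
    · have := (h (ι.symm 0)).1
      simpa using this
    · intro a b hab
      obtain ⟨a, rfl⟩ := ι.surjective a
      obtain ⟨b, rfl⟩ := ι.surjective b
      have hab' : a ≠ b := fun h => hab (by rw [h])
      rcases lt_or_gt_of_ne hab' with h1 | h1
      · exact (((h b).2 a h1).1).symm
      · exact ((h a).2 b h1).1
    · intro a b c hab hac hbc
      obtain ⟨a, rfl⟩ := ι.surjective a
      obtain ⟨b, rfl⟩ := ι.surjective b
      obtain ⟨c, rfl⟩ := ι.surjective c
      have hab' : a ≠ b := fun h => hab (by rw [h])
      have hac' : a ≠ c := fun h => hac (by rw [h])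
      have hbc' : b ≠ c := fun h => hbc (by rw [h])
      intro e
      rcases lt_or_gt_of_ne hab' with h1 | h1 <;> rcases lt_or_gt_of_ne hac' with h2 | h2 <;>
        rcases lt_or_gt_of_ne hbc' with h3 | h3
      · exact hT c b a h1 h3 (by linear_combination e)
      · exact hT b c a h2 h3 (by linear_combination -e)
      · exact absurd (h1.trans h3) (not_lt.2 h2.le)
      · exact hT b a c h2 h1 (by linear_combination e)
      · exact hT c a b h1 h2 (by linear_combination -e)
      · exact absurd (h2.trans h3) (not_lt.2 h1.le)
      · exact hT a c b h3 h2 (by linear_combination e)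
      · exact hT a b c h3 h1 (by linear_combination -e)

theorem Coord.card (C : Coord K q mul ι) :
    Nat.card {f : K → K // Cond f} = (enum q mul q).length := by
  rw [← List.toFinset_card_of_nodup (nodup_enum q), ← Nat.card_eq_finsetCard]
  refine Nat.card_congr (Equiv.ofBijective (fun f => ⟨listOf (GG ι f.1) q, ?_⟩) ⟨?_, ?_⟩)
  · rw [List.mem_toFinset, mem_enum]
    exact ⟨length_listOf _ _, (C.cond_iff f.1).1 f.2⟩
  · intro f g h
    simp only [Subtype.mk.injEq, listOf_eq] at h
    apply Subtype.ext
    funext x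
    obtain ⟨x, rfl⟩ := ι.surjective x
    have := h x x.2
    rw [GG_eq, GG_eq, ← Fin.ext_iff, ι.symm.apply_eq_iff_eq] at this
    exact this
  · rintro ⟨l, hl⟩
    rw [List.mem_toFinset, mem_enum] at hl
    obtain ⟨h1, h2⟩ := hl
    obtain ⟨g, hg⟩ := exists_listOf l
    rw [h1] at hg
    have hb : ∀ i < q, g i < q := by
      rw [← hg, okl_listOf] at h2
      exact fun i hi => (h2 i hi).1
    have hG : listOf (GG ι (fun x => ι ⟨g (ι.symm x), hb _ (Fin.is_lt _)⟩)) q = l := by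
      rw [← hg, listOf_eq]
      intro i hi
      simp [GG, hi]
    refine ⟨⟨fun x => ι ⟨g (ι.symm x), hb _ (Fin.is_lt _)⟩, ?_⟩, ?_⟩
    · rw [C.cond_iff, hG]; exact h2
    · exact Subtype.ext hG

theorem card_H3_4 {K : Type*} [Field K] [Finite K] (h : Nat.card K = 4) : (H3 K 4).card = 168 := by
  obtain ⟨ι, C⟩ := coord4 h
  have := H3_final h
  rw [C.card, enum4] at this
  omega

theorem card_H3_8 {K : Type*} [Field K] [Finite K] (h : Nat.card K = 8) : (H3 K 8).card = 32704 := by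
  obtain ⟨ι, C⟩ := coord8 h
  have := H3_final h
  rw [C.card, enum8] at this
  omega

end EnumCount
end HC

/-- Let `q ∈ {4,8}`, `n ≥ 3` and `1 ≤ k ≤ n-2`.  The number
of minimum weight codewords of `C_k(n,q)^⊥` equals
`[n+1 choose k-1]_q · [n-k+2 choose 3]_q · δ(q)`, where `δ(4) = 168` and
`δ(8) = 32704`. -/
theorem stmt10 {K : Type*} [Field K] [Finite K]
    (hq : Nat.card K = 4 ∨ Nat.card K = 8)
    (n k : ℕ) (hn : 3 ≤ n) (hk1 : 1 ≤ k) (hk2 : k ≤ n - 2) :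
    Nat.card {c : PGPoint K n → ZMod 2 //
        c ≠ 0 ∧ InDualCode 2 k c ∧
        ∀ c' : PGPoint K n → ZMod 2, c' ≠ 0 → InDualCode 2 k c' → wt c ≤ wt c'} =
      gaussBinom K (n + 1) (k - 1) * gaussBinom K (n - k + 2) 3 *
        (if Nat.card K = 4 then 168 else 32704) := by
  rcases hq with h | h
  · rw [if_pos h]
    exact HC.main (Or.inl rfl) h (HC.card_H3_4 h) (by norm_num) n k hn hk1 hk2
  · rw [if_neg (by omega)]
    exact HC.main (Or.inr rfl) h (HC.card_H3_8 h) (by norm_num) n k hn hk1 hk2
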